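/- Let G be a finite p-solvable group and let B be the principal p-block of G with non-abelian defect group P (so P ∈ Syl_p(G)). Then the minimal non-zero height among irreducible characters in B equals the minimal non-zero height among irreducible characters of P: mh(B) = mh(P). -/

import Mathlib

open scoped BigOperators Classical

noncomputable section

/-- `χ` is the character of some irreducible complex representation of `G`. -/
def IsIrrChar {G : Type} [Group G] (χ : G → ℂ) : Prop :=
  ∃ V : FDRep ℂ G, CategoryTheory.Simple V ∧ FDRep.character V = χ

/-- The degree of a character, as a natural number. -/
def charDeg {G : Type} [Group G] (χ : G → ℂ) : ℕ := ⌊(χ 1).re⌋₊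

/-- `p`-part of a natural number: the largest power of `p` dividing `n`. -/
def pPart (p n : ℕ) : ℕ := p ^ (n.factorization p)

/-- Inner product of class functions on a finite group. -/
def charInner (G : Type) [Group G] [Fintype G] (α β : G → ℂ) : ℂ :=
  (Nat.card G : ℂ)⁻¹ * ∑ g : G, α g * (starRingEnd ℂ) (β g)

/-- Restriction of a class function to a subgroup. -/
def charRes {G : Type} [Group G] (H : Subgroup G) (χ : G → ℂ) : H → ℂ := fun h => χ (h : G)

/-- Induced class function. -/
def charInd {G : Type} [Group G] [Fintype G] (U : Subgroup G) (τ : U → ℂ) : G → ℂ :=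
  fun g => (Nat.card U : ℂ)⁻¹ * ∑ x : G, if h : x * g * x⁻¹ ∈ U then τ ⟨x * g * x⁻¹, h⟩ else 0

/-- `G` is `p`-solvable: it has a subnormal series each of whose factors is a
`p`-group or a `p'`-group (expressed element-wise). -/
def IsPSolvable (p : ℕ) (G : Type) [Group G] : Prop :=
  ∃ (n : ℕ) (s : Fin (n + 1) → Subgroup G),
    s 0 = ⊥ ∧ s (Fin.last n) = ⊤ ∧
    ∀ i : Fin n, s i.castSucc ≤ s i.succ ∧
      ((s i.castSucc).subgroupOf (s i.succ)).Normal ∧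
      ((∀ x ∈ s i.succ, ∃ k : ℕ, x ^ p ^ k ∈ s i.castSucc) ∨
       (∀ x ∈ s i.succ, ∃ m : ℕ, Nat.Coprime m p ∧ x ^ m ∈ s i.castSucc))

set_option linter.style.haveILetI false
set_option linter.unusedSimpArgs false
set_option linter.unusedSectionVars false
set_option linter.unusedVariables false

/-! ## Basic representation theory -/
section Rep
variable {G : Type} [Group G] {V : Type} [AddCommGroup V] [Module ℂ V]

/-- invariant subspaces -/
def SInv (ρ : Representation ℂ G V) (H : Subgroup G) (W : Submodule ℂ V) : Prop :=
  ∀ h ∈ H, ∀ v ∈ W, ρ h v ∈ W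

/-- irreducible invariant subspaces -/
def IrrSub (ρ : Representation ℂ G V) (H : Subgroup G) (W : Submodule ℂ V) : Prop :=
  SInv ρ H W ∧ W ≠ ⊥ ∧ ∀ U : Submodule ℂ V, U ≤ W → SInv ρ H U → U = ⊥ ∨ U = W

/-- `d` is the degree of an irreducible representation -/
def Deg (G : Type) [Group G] (d : ℕ) : Prop :=
  ∃ (V : Type) (_ : AddCommGroup V) (_ : Module ℂ V) (_ : FiniteDimensional ℂ V)
    (ρ : Representation ℂ G V), IrrSub ρ ⊤ ⊤ ∧ Module.finrank ℂ V = d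

lemma SInv.mono {ρ : Representation ℂ G V} {H K : Subgroup G} (h : K ≤ H) {W : Submodule ℂ V}
    (hW : SInv ρ H W) : SInv ρ K W := fun x hx v hv => hW x (h hx) v hv

lemma SInv.inf {ρ : Representation ℂ G V} {H : Subgroup G} {W U : Submodule ℂ V}
    (hW : SInv ρ H W) (hU : SInv ρ H U) : SInv ρ H (W ⊓ U) :=
  fun x hx v hv => ⟨hW x hx v hv.1, hU x hx v hv.2⟩

lemma SInv.top (ρ : Representation ℂ G V) (H : Subgroup G) : SInv ρ H ⊤ :=
  fun _ _ _ _ => Submodule.mem_top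

lemma SInv.bot (ρ : Representation ℂ G V) (H : Subgroup G) : SInv ρ H ⊥ := by
  intro x _ v hv
  rw [Submodule.mem_bot] at hv ⊢
  simp [hv]

lemma inv_comp {G' : Type} [Group G'] (f : G' →* G) (ρ : Representation ℂ G V) (H : Subgroup G')
    (W : Submodule ℂ V) : SInv (ρ.comp f : Representation ℂ G' V) H W ↔ SInv ρ (H.map f) W := by
  constructor
  · rintro h _ ⟨x, hx, rfl⟩ v hv
    exact h x hx v hv
  · intro h x hx v hv
    exact h (f x) ⟨x, hx, rfl⟩ v hv

lemma irrSub_comp {G' : Type} [Group G'] (f : G' →* G) (ρ : Representation ℂ G V)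
    (H : Subgroup G') (W : Submodule ℂ V) :
    IrrSub (ρ.comp f : Representation ℂ G' V) H W ↔ IrrSub ρ (H.map f) W := by
  simp only [IrrSub, inv_comp]

/-- subrepresentation on an invariant subspace -/
def subRep (ρ : Representation ℂ G V) (H : Subgroup G) (W : Submodule ℂ V) (hW : SInv ρ H W) :
    Representation ℂ H W where
  toFun h := (ρ h).restrict (fun v hv => hW h h.2 v hv)
  map_one' := by ext v; simp
  map_mul' a b := by ext v; simp

@[simp] lemma subRep_apply (ρ : Representation ℂ G V) (H : Subgroup G) (W : Submodule ℂ V)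
    (hW : SInv ρ H W) (h : H) (v : W) : ((subRep ρ H W hW h v : W) : V) = ρ h v := rfl

lemma inv_subRep (ρ : Representation ℂ G V) (H : Subgroup G) (W : Submodule ℂ V)
    (hW : SInv ρ H W) (K : Subgroup H) (U : Submodule ℂ W) :
    SInv (subRep ρ H W hW) K U ↔ SInv ρ (K.map H.subtype) (U.map W.subtype) := by
  constructor
  · rintro h _ ⟨x, hx, rfl⟩ _ ⟨v, hv, rfl⟩
    exact ⟨_, h x hx v hv, rfl⟩
  · intro h x hx v hv
    obtain ⟨u, hu, huv⟩ := h x ⟨x, hx, rfl⟩ v ⟨v, hv, rfl⟩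
    have : u = subRep ρ H W hW x v := Subtype.ext huv
    rwa [← this]

lemma map_subtype_eq_bot {W : Submodule ℂ V} {U : Submodule ℂ W} :
    U.map W.subtype = ⊥ ↔ U = ⊥ := by
  constructor
  · intro h
    apply Submodule.map_injective_of_injective W.injective_subtype
    rw [h, Submodule.map_bot]
  · rintro rfl
    exact Submodule.map_bot _

lemma irrSub_subRep (ρ : Representation ℂ G V) (H : Subgroup G) (W : Submodule ℂ V)
    (hW : SInv ρ H W) (K : Subgroup H) (U : Submodule ℂ W) :
    IrrSub (subRep ρ H W hW) K U ↔ IrrSub ρ (K.map H.subtype) (U.map W.subtype) := by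
  unfold IrrSub
  rw [inv_subRep]
  refine and_congr Iff.rfl (and_congr ?_ ?_)
  · rw [Ne, Ne, map_subtype_eq_bot]
  · constructor
    · intro h X hX hXi
      have hXW : X ≤ W := hX.trans (Submodule.map_subtype_le W U)
      have e : (X.comap W.subtype).map W.subtype = X := by
        rw [Submodule.map_comap_subtype, inf_eq_right.2 hXW]
      have := h (X.comap W.subtype) (by
        rw [← e] at hX
        exact (Submodule.map_le_map_iff_of_injective W.injective_subtype _ _).1 hX)
        (by rw [inv_subRep, e]; exact hXi)
      rcases this with h1 | h1
      · left; rw [← e, h1, Submodule.map_bot]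
      · right; rw [← e, h1]
    · intro h X hX hXi
      rcases h (X.map W.subtype) (Submodule.map_mono hX) ((inv_subRep ..).1 hXi) with h1 | h1
      · left; exact map_subtype_eq_bot.1 h1
      · right; exact Submodule.map_injective_of_injective W.injective_subtype h1

lemma irrSub_subRep_top {ρ : Representation ℂ G V} {H : Subgroup G} {W : Submodule ℂ V}
    (hW : IrrSub ρ H W) : IrrSub (subRep ρ H W hW.1) ⊤ ⊤ := by
  rw [irrSub_subRep]
  simpa [← MonoidHom.range_eq_map] using hW

lemma deg_of_irrSub [FiniteDimensional ℂ V] {ρ : Representation ℂ G V} {H : Subgroup G}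
    {W : Submodule ℂ V} (hW : IrrSub ρ H W) : Deg H (Module.finrank ℂ W) :=
  ⟨W, inferInstance, inferInstance, inferInstance, subRep ρ H W hW.1, irrSub_subRep_top hW, rfl⟩

lemma Deg.of_surj {G' : Type} [Group G'] (f : G' →* G) (hf : Function.Surjective f) {d : ℕ}
    (h : Deg G d) : Deg G' d := by
  obtain ⟨V, _, _, _, ρ, h1, h2⟩ := h
  refine ⟨V, _, _, inferInstance, ρ.comp f, ?_, h2⟩
  rw [irrSub_comp, ← MonoidHom.range_eq_map, MonoidHom.range_eq_top.2 hf]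
  exact h1

lemma Deg.equiv {G' : Type} [Group G'] (f : G' ≃* G) {d : ℕ} : Deg G d ↔ Deg G' d :=
  ⟨Deg.of_surj f.toMonoidHom f.surjective, Deg.of_surj f.symm.toMonoidHom f.symm.surjective⟩

lemma deg_top {d : ℕ} : Deg (⊤ : Subgroup G) d ↔ Deg G d :=
  Deg.equiv (Subgroup.topEquiv.symm)

/-- factor a representation through a surjection -/
lemma exists_factor {G' : Type} [Group G'] (f : G →* G') (hf : Function.Surjective f)
    (ρ : Representation ℂ G V) (hk : ∀ g, f g = 1 → ρ g = 1) :
    ∃ ρ' : Representation ℂ G' V, ρ = ρ'.comp f := by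
  let u : G' → G := Function.surjInv hf
  have hu : ∀ x, f (u x) = x := Function.surjInv_eq hf
  have key : ∀ a b, f a = f b → ρ a = ρ b := by
    intro a b hab
    have : ρ (a * b⁻¹) = 1 := hk _ (by simp [hab])
    calc ρ a = ρ (a * b⁻¹ * b) := by simp
      _ = ρ b := by rw [map_mul, this, one_mul]
  refine ⟨⟨⟨fun x => ρ (u x), ?_⟩, ?_⟩, ?_⟩
  · rw [← map_one ρ]; apply key; simp [hu]
  · intro a b
    change ρ (u (a*b)) = ρ (u a) * ρ (u b)
    rw [← map_mul]; apply key; simp [hu]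
  · ext g : 1
    exact key _ _ (by simp [hu])

lemma deg_factor [FiniteDimensional ℂ V] {G' : Type} [Group G'] (f : G →* G')
    (hf : Function.Surjective f)
    (ρ : Representation ℂ G V) (hirr : IrrSub ρ ⊤ ⊤) (hk : ∀ g, f g = 1 → ρ g = 1) :
    Deg G' (Module.finrank ℂ V) := by
  obtain ⟨ρ', rfl⟩ := exists_factor f hf ρ hk
  rw [irrSub_comp, ← MonoidHom.range_eq_map, MonoidHom.range_eq_top.2 hf] at hirr
  exact ⟨V, _, _, inferInstance, ρ', hirr, rfl⟩

/-- Maschke -/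
lemma maschke [Finite G] {ρ : Representation ℂ G V} {H : Subgroup G} {U W : Submodule ℂ V}
    (hU : SInv ρ H U) (hW : SInv ρ H W) (hUW : U ≤ W) :
    ∃ U', SInv ρ H U' ∧ U' ≤ W ∧ U ⊓ U' = ⊥ ∧ U ⊔ U' = W := by
  let τ : Representation ℂ H V := ρ.comp H.subtype
  haveI : NeZero (Nat.card H : ℂ) := ⟨by exact_mod_cast Nat.card_pos.ne'⟩
  have hss : Representation.IsSemisimpleRepresentation τ := inferInstance
  let S : Subrepresentation τ := ⟨U, fun h v hv => hU h h.2 v hv⟩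
  obtain ⟨T, hT⟩ := hss.exists_isCompl S
  have h1 : U ⊓ T.toSubmodule = ⊥ := by
    have := congrArg Subrepresentation.toSubmodule (disjoint_iff.1 hT.1)
    rw [Subrepresentation.toSubmodule_inf] at this
    exact this
  have h2 : U ⊔ T.toSubmodule = ⊤ := by
    have := congrArg Subrepresentation.toSubmodule (codisjoint_iff.1 hT.2)
    rw [Subrepresentation.toSubmodule_sup] at this
    exact this
  refine ⟨T.toSubmodule ⊓ W, ?_, inf_le_right, ?_, ?_⟩
  · apply SInv.inf _ hW
    intro h hh v hv
    exact T.apply_mem_toSubmodule ⟨h, hh⟩ hv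
  · rw [← inf_assoc, h1, bot_inf_eq]
  · rw [← sup_inf_assoc_of_le _ hUW, h2, top_inf_eq]

lemma exists_irrSub [FiniteDimensional ℂ V] {ρ : Representation ℂ G V} {H : Subgroup G}
    {W : Submodule ℂ V} (hW : SInv ρ H W) (h0 : W ≠ ⊥) : ∃ U ≤ W, IrrSub ρ H U := by
  induction hn : Module.finrank ℂ W using Nat.strong_induction_on generalizing W with
  | _ n ih =>
    by_cases h : ∀ U : Submodule ℂ V, U ≤ W → SInv ρ H U → U = ⊥ ∨ U = W
    · exact ⟨W, le_rfl, hW, h0, h⟩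
    · push Not at h
      obtain ⟨U, hUW, hU, hb, ht⟩ := h
      obtain ⟨X, hX, hX'⟩ := ih _ (hn ▸ Submodule.finrank_lt_finrank_of_lt (lt_of_le_of_ne hUW ht))
        hU hb rfl
      exact ⟨X, hX.trans hUW, hX'⟩

/-- induction principle: every invariant subspace is built from irreducibles -/
lemma inv_induction [Finite G] [FiniteDimensional ℂ V] {ρ : Representation ℂ G V} {H : Subgroup G}
    (C : Submodule ℂ V → Prop) (hb : C ⊥)
    (hs : ∀ U U' : Submodule ℂ V, IrrSub ρ H U → SInv ρ H U' → U ⊓ U' = ⊥ → C U' → C (U ⊔ U'))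
    {W : Submodule ℂ V} (hW : SInv ρ H W) : C W := by
  induction hn : Module.finrank ℂ W using Nat.strong_induction_on generalizing W with
  | _ n ih =>
    by_cases h0 : W = ⊥
    · rw [h0]; exact hb
    · obtain ⟨U, hUW, hU⟩ := exists_irrSub hW h0
      obtain ⟨U', hU', hU'W, h1, h2⟩ := maschke hU.1 hW hUW
      rw [← h2]
      refine hs U U' hU hU' h1 (ih _ ?_ hU' rfl)
      rw [← hn]
      apply Submodule.finrank_lt_finrank_of_lt
      refine lt_of_le_of_ne hU'W ?_
      rintro rfl
      rw [inf_eq_left.2 hUW] at h1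
      exact hU.2.1 h1

lemma inv_induction' [Finite G] [FiniteDimensional ℂ V] {ρ : Representation ℂ G V} {H : Subgroup G}
    (C : Submodule ℂ V → Prop) {W : Submodule ℂ V} (hW : SInv ρ H W) (hb : C ⊥)
    (hs : ∀ U U' : Submodule ℂ V, U ≤ W → U' ≤ W → IrrSub ρ H U → SInv ρ H U' → U ⊓ U' = ⊥ →
      C U' → C (U ⊔ U')) : C W := by
  refine inv_induction (ρ := ρ) (H := H) (fun X => X ≤ W → C X) (fun _ => hb) ?_ hW le_rfl
  intro U U' hU hU' h1 h2 h3
  exact hs U U' (le_sup_left.trans h3) (le_sup_right.trans h3) hU hU' h1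
    (h2 (le_sup_right.trans h3))

lemma dvd_finrank [Finite G] [FiniteDimensional ℂ V] {ρ : Representation ℂ G V} {H : Subgroup G}
    {W : Submodule ℂ V} (hW : SInv ρ H W) (n : ℕ)
    (h : ∀ U ≤ W, IrrSub ρ H U → n ∣ Module.finrank ℂ U) : n ∣ Module.finrank ℂ W := by
  refine inv_induction' (fun X => n ∣ Module.finrank ℂ X) hW (by simp) ?_
  intro U U' hUW _ hU _ h1 h2
  have := Submodule.finrank_sup_add_finrank_inf_eq U U'
  rw [h1, finrank_bot, add_zero] at this
  rw [this]
  exact dvd_add (h U hUW hU) h2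

lemma exists_irrSub_not_dvd [Finite G] [FiniteDimensional ℂ V] {ρ : Representation ℂ G V}
    {H : Subgroup G} {W : Submodule ℂ V} (hW : SInv ρ H W) (n : ℕ)
    (h : ¬ n ∣ Module.finrank ℂ W) : ∃ U ≤ W, IrrSub ρ H U ∧ ¬ n ∣ Module.finrank ℂ U := by
  by_contra hc
  push Not at hc
  exact h (dvd_finrank hW n hc)

/-- Schur -/
lemma schur [FiniteDimensional ℂ V] {ρ : Representation ℂ G V} {H : Subgroup G}
    {W : Submodule ℂ V} (hW : IrrSub ρ H W) (T : V →ₗ[ℂ] V) (hT : ∀ v ∈ W, T v ∈ W)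
    (hc : ∀ h ∈ H, ∀ v ∈ W, T (ρ h v) = ρ h (T v)) : ∃ c : ℂ, ∀ v ∈ W, T v = c • v := by
  haveI : Nontrivial W := Submodule.nontrivial_iff_ne_bot.2 hW.2.1
  obtain ⟨c, hcc⟩ := Module.End.exists_eigenvalue (T.restrict hT)
  obtain ⟨v, hv⟩ := hcc.exists_hasEigenvector
  refine ⟨c, ?_⟩
  let U : Submodule ℂ V := W ⊓ LinearMap.ker (T - c • LinearMap.id)
  have hU : SInv ρ H U := by
    rintro h hh x ⟨hx, hx'⟩
    refine ⟨hW.1 h hh x hx, ?_⟩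
    have hx' : T x - c • x = 0 := hx'
    change T (ρ h x) - c • (ρ h x) = 0
    rw [hc h hh x hx, ← map_smul, ← map_sub, hx', map_zero]
  rcases hW.2.2 U inf_le_left hU with h | h
  · exfalso
    have : (v : V) ∈ U := by
      refine ⟨v.2, ?_⟩
      have := congrArg Subtype.val hv.apply_eq_smul
      change T v - c • (v : V) = 0
      rw [sub_eq_zero]
      exact this
    rw [h, Submodule.mem_bot] at this
    exact hv.2 (Subtype.ext this)
  · intro x hx
    rw [← h] at hx
    have hx' : T x - c • x = 0 := hx.2
    exact (sub_eq_zero.1 hx' : T x = c • x)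

/-- intertwining maps out of an irreducible subspace: injective or zero -/
lemma irr_map_inj {V' : Type} [AddCommGroup V'] [Module ℂ V']
    {ρ : Representation ℂ G V} {H : Subgroup G} {W : Submodule ℂ V} (hW : IrrSub ρ H W)
    (σ : G → V' →ₗ[ℂ] V') (T : V →ₗ[ℂ] V') (hT : ∀ h ∈ H, ∀ v ∈ W, T (ρ h v) = σ h (T v)) :
    (∀ v ∈ W, T v = 0) ∨ (∀ v ∈ W, T v = 0 → v = 0) := by
  have hi : SInv ρ H (W ⊓ LinearMap.ker T) := by
    rintro h hh x ⟨hx, hx'⟩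
    refine ⟨hW.1 h hh x hx, ?_⟩
    have hx' : T x = 0 := hx'
    change T (ρ h x) = 0
    rw [hT h hh x hx, hx', map_zero]
  rcases hW.2.2 _ inf_le_left hi with h | h
  · right
    intro v hv h0
    have : v ∈ W ⊓ LinearMap.ker T := ⟨hv, h0⟩
    rwa [h, Submodule.mem_bot] at this
  · left
    intro v hv
    rw [← h] at hv
    exact hv.2

/-- image of an irreducible subspace under an injective intertwiner -/
lemma irrSub_map {V' : Type} [AddCommGroup V'] [Module ℂ V']
    {ρ : Representation ℂ G V} {H : Subgroup G} {W : Submodule ℂ V} (hW : IrrSub ρ H W)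
    (σ : Representation ℂ G V') (T : V →ₗ[ℂ] V') (hT : ∀ h ∈ H, ∀ v ∈ W, T (ρ h v) = σ h (T v))
    (hinj : ∀ v ∈ W, T v = 0 → v = 0) : IrrSub σ H (W.map T) := by
  refine ⟨?_, ?_, ?_⟩
  · rintro h hh _ ⟨v, hv, rfl⟩
    exact ⟨ρ h v, hW.1 h hh v hv, hT h hh v hv⟩
  · intro h
    apply hW.2.1
    rw [eq_bot_iff]
    intro v hv
    have : T v ∈ W.map T := ⟨v, hv, rfl⟩
    rw [h, Submodule.mem_bot] at this
    exact hinj v hv this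
  · intro U hU hUi
    have : SInv ρ H (W ⊓ U.comap T) := by
      rintro h hh x ⟨hx, hx'⟩
      refine ⟨hW.1 h hh x hx, ?_⟩
      change T (ρ h x) ∈ U
      rw [hT h hh x hx]
      exact hUi h hh _ hx'
    rcases hW.2.2 _ inf_le_left this with h | h
    · left
      rw [eq_bot_iff]
      intro u hu
      obtain ⟨v, hv, rfl⟩ := hU hu
      have : v ∈ W ⊓ U.comap T := ⟨hv, hu⟩
      rw [h, Submodule.mem_bot] at this
      simp [this]
    · right
      apply le_antisymm hU
      rintro _ ⟨v, hv, rfl⟩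
      rw [← h] at hv
      exact hv.2

lemma finrank_map_of_inj {V' : Type} [AddCommGroup V'] [Module ℂ V'] {W : Submodule ℂ V}
    (T : V →ₗ[ℂ] V') (hinj : ∀ v ∈ W, T v = 0 → v = 0) :
    Module.finrank ℂ (W.map T) = Module.finrank ℂ W := by
  have h : Function.Injective (T.domRestrict W) := by
    rw [injective_iff_map_eq_zero]
    intro v hv
    exact Subtype.ext (hinj v v.2 hv)
  rw [← LinearMap.finrank_range_of_inj h, LinearMap.range_domRestrict]

lemma SInv.map_mem_iff {ρ : Representation ℂ G V} {H : Subgroup G} {W : Submodule ℂ V}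
    (hW : SInv ρ H W) {h : G} (hh : h ∈ H) (v : V) : ρ h v ∈ W ↔ v ∈ W := by
  refine ⟨fun hv => ?_, hW h hh v⟩
  have := hW h⁻¹ (H.inv_mem hh) _ hv
  rwa [← Module.End.mul_apply, ← map_mul, inv_mul_cancel, map_one] at this

lemma rho_inv_apply (ρ : Representation ℂ G V) (g : G) (v : V) : ρ g⁻¹ (ρ g v) = v := by
  rw [← Module.End.mul_apply, ← map_mul, inv_mul_cancel, map_one, Module.End.one_apply]

lemma rho_apply_inv (ρ : Representation ℂ G V) (g : G) (v : V) : ρ g (ρ g⁻¹ v) = v := by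
  rw [← Module.End.mul_apply, ← map_mul, mul_inv_cancel, map_one, Module.End.one_apply]

lemma irr_iff (ρ : Representation ℂ G V) : IrrSub ρ ⊤ ⊤ ↔ ρ.IsIrreducible := by
  constructor
  · intro h
    have hne : Nontrivial (Subrepresentation ρ) := by
      refine ⟨⊥, ⊤, fun hc => h.2.1 ?_⟩
      exact (congrArg Subrepresentation.toSubmodule hc).symm
    refine { toNontrivial := hne, eq_bot_or_eq_top := fun S => ?_ }
    rcases h.2.2 S.toSubmodule le_top (fun g _ v hv => S.apply_mem_toSubmodule g hv) with h | h
    · left; exact Subrepresentation.toSubmodule_injective h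
    · right; exact Subrepresentation.toSubmodule_injective h
  · intro h
    refine ⟨SInv.top _ _, ?_, ?_⟩
    · intro hc
      have : (⊥ : Subrepresentation ρ) ≠ ⊤ := bot_ne_top
      exact this (Subrepresentation.toSubmodule_injective hc.symm)
    · intro U _ hU
      have := h.eq_bot_or_eq_top ⟨U, fun g v hv => hU g trivial v hv⟩
      rcases this with h | h
      · left; exact congrArg Subrepresentation.toSubmodule h
      · right; exact congrArg Subrepresentation.toSubmodule h

lemma Deg.pos {d : ℕ} (h : Deg G d) : 0 < d := by
  obtain ⟨V, _, _, _, ρ, h1, h2⟩ := h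
  rw [← h2]
  by_contra hc
  have : Module.finrank ℂ V = 0 := by omega
  apply h1.2.1
  haveI := Module.finrank_zero_iff.1 this
  exact Subsingleton.elim _ _

end Rep

/-! ## Weights and Clifford theory -/
section Weights

/-- weights: functions with the contragredient action -/
def Wt (ι : Type) : Type := ι → ℂ

instance {ι : Type} : CoeFun (Wt ι) (fun _ => ι → ℂ) := ⟨fun w => w⟩

instance wtAction {G ι : Type} [Group G] [MulAction G ι] : MulAction G (Wt ι) where
  smul g w := fun i => w (g⁻¹ • i)
  one_smul w := by
    funext i
    change w ((1 : G)⁻¹ • i) = w i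
    simp
  mul_smul a b w := by
    funext i
    change w ((a * b)⁻¹ • i) = w (b⁻¹ • a⁻¹ • i)
    rw [mul_inv_rev, mul_smul]

lemma wt_smul_apply {G ι : Type} [Group G] [MulAction G ι] (g : G) (w : Wt ι) (i : ι) :
    (g • w) i = w (g⁻¹ • i) := rfl

variable {V : Type} [AddCommGroup V] [Module ℂ V] {ι : Type}

/-- joint eigenspace -/
def eig (f : ι → V →ₗ[ℂ] V) (w : Wt ι) : Submodule ℂ V where
  carrier := {v | ∀ i, f i v = w i • v}
  add_mem' := by
    intro a b ha hb i
    rw [map_add, ha i, hb i, smul_add]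
  zero_mem' := by intro i; simp
  smul_mem' := by
    intro c v hv i
    rw [map_smul, hv i, smul_comm]

lemma mem_eig {f : ι → V →ₗ[ℂ] V} {w : Wt ι} {v : V} :
    v ∈ eig f w ↔ ∀ i, f i v = w i • v := Iff.rfl

lemma eig_indep (f : ι → V →ₗ[ℂ] V) : iSupIndep (fun w : Wt ι => eig f w) := by
  rw [iSupIndep_iff_finsetSum_eq_zero_imp_eq_zero]
  intro s
  induction s using Finset.induction_on with
  | empty => intro v _ _ i hi; simp at hi
  | insert a s ha ih =>
    intro v hv h0
    have key : ∀ w ∈ s, v w = 0 := by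
      intro w hw
      have hne : w ≠ a := fun h => ha (h ▸ hw)
      obtain ⟨j, hj⟩ : ∃ j, w j ≠ a j := by
        by_contra hc
        push Not at hc
        exact hne (funext hc)
      have h1 : ∑ x ∈ s, (x j - a j) • v x = 0 := by
        have e1 : f j (∑ x ∈ insert a s, v x) - a j • (∑ x ∈ insert a s, v x) = 0 := by
          rw [h0]; simp
        rw [map_sum, Finset.smul_sum, ← Finset.sum_sub_distrib, Finset.sum_insert ha,
          hv a (Finset.mem_insert_self a s) j, sub_self, zero_add] at e1
        rw [← e1]
        refine Finset.sum_congr rfl fun x hx => ?_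
        rw [hv x (Finset.mem_insert_of_mem hx) j, sub_smul]
      have := ih (fun x => (x j - a j) • v x)
        (fun x hx => Submodule.smul_mem _ _ (hv x (Finset.mem_insert_of_mem hx))) h1 w hw
      exact (smul_eq_zero.1 this).resolve_left (sub_ne_zero.2 hj)
    intro w hw
    rcases Finset.mem_insert.1 hw with rfl | hw
    · rw [Finset.sum_insert ha, Finset.sum_eq_zero key, add_zero] at h0
      exact h0
    · exact key w hw

lemma finrank_finset_sup {κ : Type} [FiniteDimensional ℂ V] (E : κ → Submodule ℂ V)
    (hE : iSupIndep E) (s : Finset κ) :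
    Module.finrank ℂ (s.sup E : Submodule ℂ V) = ∑ i ∈ s, Module.finrank ℂ (E i) := by
  induction s using Finset.induction_on with
  | empty => simp
  | insert a s ha ih =>
    rw [Finset.sup_insert, Finset.sum_insert ha, ← ih]
    have h := Submodule.finrank_sup_add_finrank_inf_eq (E a) (s.sup E)
    have hd : E a ⊓ s.sup E = ⊥ := by
      rw [← disjoint_iff]
      refine (hE a).mono_right ?_
      refine Finset.sup_le fun j hj => ?_
      exact le_iSup₂_of_le j (fun h => ha (h ▸ hj)) le_rfl
    rw [hd, finrank_bot, add_zero] at h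
    exact h

variable {G : Type} [Group G] [MulAction G ι]

/-- the family `f` is `H`-equivariant -/
def Equivar (ρ : Representation ℂ G V) (H : Subgroup G) (f : ι → V →ₗ[ℂ] V) : Prop :=
  ∀ h ∈ H, ∀ i v, ρ h (f i v) = f (h • i) (ρ h v)

lemma eig_smul {ρ : Representation ℂ G V} {H : Subgroup G} {f : ι → V →ₗ[ℂ] V}
    (hf : Equivar ρ H f) {h : G} (hh : h ∈ H) {w : Wt ι} {v : V} (hv : v ∈ eig f w) :
    ρ h v ∈ eig f (h • w) := by
  intro i
  have := hf h hh (h⁻¹ • i) v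
  rw [smul_inv_smul] at this
  rw [← this, hv, map_smul]
  rfl

lemma eig_inv {ρ : Representation ℂ G V} {H : Subgroup G} {f : ι → V →ₗ[ℂ] V}
    (hf : Equivar ρ H f) (w : Wt ι) : SInv ρ (MulAction.stabilizer G w ⊓ H) (eig f w) := by
  rintro h ⟨h1, h2⟩ v hv
  have := eig_smul hf h2 hv
  rwa [show h • w = w from h1] at this

lemma clifford [Finite G] [FiniteDimensional ℂ V] {ρ : Representation ℂ G V} {H : Subgroup G}
    {f : ι → V →ₗ[ℂ] V} (hf : Equivar ρ H f) {W : Submodule ℂ V} (hW : IrrSub ρ H W)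
    (w : Wt ι) (hw : W ⊓ eig f w ≠ ⊥) :
    Module.finrank ℂ W = (MulAction.stabilizer G w).relIndex H *
      Module.finrank ℂ (W ⊓ eig f w : Submodule ℂ V) ∧
    IrrSub ρ (MulAction.stabilizer G w ⊓ H) (W ⊓ eig f w) := by
  have hfin : Finite H := inferInstance
  have hfinO : Finite (MulAction.orbit H w) := Set.finite_range _ |>.to_subtype
  let O : Finset (Wt ι) := (Set.toFinite (MulAction.orbit H w)).toFinset
  have memO : ∀ x, x ∈ O ↔ ∃ h ∈ H, h • w = x := by
    intro x
    simp only [O, Set.Finite.mem_toFinset]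
    constructor
    · rintro ⟨h, rfl⟩; exact ⟨h, h.2, rfl⟩
    · rintro ⟨h, hh, rfl⟩; exact ⟨⟨h, hh⟩, rfl⟩
  -- general statement on subspaces
  have gen : ∀ X : Submodule ℂ V, X ≤ W ⊓ eig f w → X ≠ ⊥ →
      SInv ρ (MulAction.stabilizer G w ⊓ H) X →
      Module.finrank ℂ W = O.card * Module.finrank ℂ X := by
    intro X hX hX0 hXi
    -- translates
    have hch : ∀ x : Wt ι, ∃ h : G, x ∈ O → (h ∈ H ∧ h • w = x) := by
      intro x
      by_cases hx : x ∈ O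
      · obtain ⟨h, h1, h2⟩ := (memO x).1 hx
        exact ⟨h, fun _ => ⟨h1, h2⟩⟩
      · exact ⟨1, fun h => absurd h hx⟩
    choose t ht using hch
    let E : Wt ι → Submodule ℂ V := fun x => if x ∈ O then X.map (ρ (t x)) else ⊥
    have hEx : ∀ x ∈ O, E x = X.map (ρ (t x)) := fun x hx => if_pos hx
    have hEle : ∀ x, E x ≤ eig f x := by
      intro x
      by_cases hx : x ∈ O
      · rw [hEx x hx]
        rintro _ ⟨v, hv, rfl⟩
        have := eig_smul hf (ht x hx).1 (hX hv).2
        rwa [(ht x hx).2] at this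
      · simp [E, hx]
    have hind : iSupIndep E := (eig_indep f).mono hEle
    have hsum : O.sup E = W := by
      have hle : O.sup E ≤ W := by
        refine Finset.sup_le fun x hx => ?_
        rw [hEx x hx]
        rintro _ ⟨v, hv, rfl⟩
        exact hW.1 _ (ht x hx).1 _ (hX hv).1
      have hinv : SInv ρ H (O.sup E) := by
        intro h hh
        suffices hs : O.sup E ≤ (O.sup E).comap (ρ h) from fun v hv => hs hv
        refine Finset.sup_le fun x hx => ?_
        rw [hEx x hx]
        rintro _ ⟨v, hv, rfl⟩
        have hx' : h • x ∈ O := by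
          rw [memO]
          exact ⟨h * t x, H.mul_mem hh (ht x hx).1, by rw [mul_smul, (ht x hx).2]⟩
        have hle : E (h • x) ≤ O.sup E := Finset.le_sup hx'
        apply hle
        rw [hEx _ hx']
        have h1 := ht _ hx'
        have h2 := ht _ hx
        refine ⟨ρ ((t (h • x))⁻¹ * h * t x) v, ?_, ?_⟩
        · refine hXi _ ⟨?_, ?_⟩ v hv
          · change ((t (h • x))⁻¹ * h * t x) • w = w
            rw [mul_smul, mul_smul, h2.2, inv_smul_eq_iff, h1.2]
          · exact H.mul_mem (H.mul_mem (H.inv_mem h1.1) hh) h2.1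
        · rw [← Module.End.mul_apply, ← Module.End.mul_apply, ← map_mul, ← map_mul]
          congr 2
          group
      rcases hW.2.2 _ hle hinv with h | h
      · exfalso
        have hwO : w ∈ O := (memO w).2 ⟨1, H.one_mem, one_smul _ _⟩
        have h1 : E w = ⊥ := by
          rw [eq_bot_iff, ← h]
          exact Finset.le_sup hwO
        rw [hEx w hwO] at h1
        apply hX0
        rw [eq_bot_iff]
        intro v hv
        have : ρ (t w) v ∈ X.map (ρ (t w)) := ⟨v, hv, rfl⟩
        rw [h1, Submodule.mem_bot] at this
        rw [Submodule.mem_bot, ← rho_inv_apply ρ (t w) v, this, map_zero]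
      · exact h
    rw [← hsum, finrank_finset_sup E hind]
    rw [Finset.card_eq_sum_ones, Finset.sum_mul]
    refine Finset.sum_congr rfl fun x hx => ?_
    rw [one_mul, hEx x hx]
    apply finrank_map_of_inj
    intro v _ h0
    rw [← rho_inv_apply ρ (t x) v, h0, map_zero]
  have hcard : O.card = (MulAction.stabilizer G w).relIndex H := by
    have h1 : Nat.card (MulAction.orbit H w) = (MulAction.stabilizer H w).index :=
      (MulAction.index_stabilizer H w).symm
    have h2 : MulAction.stabilizer H w = (MulAction.stabilizer G w).subgroupOf H := by
      ext h; rfl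
    rw [Subgroup.relIndex, ← h2, ← h1, Nat.card_eq_card_finite_toFinset (Set.toFinite _)]
  have hinv0 : SInv ρ (MulAction.stabilizer G w ⊓ H) (W ⊓ eig f w) :=
    (hW.1.mono inf_le_right).inf (eig_inv hf w)
  refine ⟨?_, hinv0, hw, ?_⟩
  · rw [← hcard]
    exact gen _ le_rfl hw hinv0
  · intro U hU hUi
    by_cases h0 : U = ⊥
    · left; exact h0
    · right
      have e1 := gen _ le_rfl hw hinv0
      have e2 := gen U hU h0 hUi
      have hO : 0 < O.card := Finset.card_pos.2 ⟨w, (memO w).2 ⟨1, H.one_mem, one_smul _ _⟩⟩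
      rw [e1] at e2
      exact Submodule.eq_of_le_of_finrank_eq hU (Nat.eq_of_mul_eq_mul_left hO e2).symm

end Weights

/-! ## Coinduction -/
section Coind
variable {G : Type} [Group G] {U : Type} [AddCommGroup U] [Module ℂ U]

/-- a subrepresentation for the whole group -/
def topRep (ρ : Representation ℂ G U) (Y : Submodule ℂ U) (hY : SInv ρ ⊤ Y) :
    Representation ℂ G Y where
  toFun h := (ρ h).restrict (fun v hv => hY h trivial v hv)
  map_one' := by ext v; simp
  map_mul' a b := by ext v; simp

lemma topRep_apply (ρ : Representation ℂ G U) (Y : Submodule ℂ U) (hY : SInv ρ ⊤ Y) (g : G)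
    (y : Y) : ((topRep ρ Y hY g y : Y) : U) = ρ g y := rfl

lemma topRep_irr {ρ : Representation ℂ G U} {Y : Submodule ℂ U} (hY : IrrSub ρ ⊤ Y) :
    IrrSub (topRep ρ Y hY.1) ⊤ ⊤ := by
  have : topRep ρ Y hY.1 = (subRep ρ ⊤ Y hY.1).comp Subgroup.topEquiv.symm.toMonoidHom := rfl
  rw [this, irrSub_comp, ← MonoidHom.range_eq_map,
      MonoidHom.range_eq_top.2 Subgroup.topEquiv.symm.surjective]
  exact irrSub_subRep_top hY

/-- the space of the coinduced representation -/
def coV (H : Subgroup G) (τ : Representation ℂ H U) : Submodule ℂ (G → U) where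
  carrier := {F | ∀ (h : H) (g : G), F (h * g) = τ h (F g)}
  add_mem' := by
    intro a b ha hb h g
    simp only [Pi.add_apply, ha h g, hb h g, map_add]
  zero_mem' := by intro h g; simp
  smul_mem' := by
    intro c a ha h g
    simp only [Pi.smul_apply, ha h g, map_smul]

/-- the space of the coinduced representation, as a type -/
def CoT (H : Subgroup G) (τ : Representation ℂ H U) : Type := coV H τ

instance (H : Subgroup G) (τ : Representation ℂ H U) : AddCommGroup (CoT H τ) :=
  inferInstanceAs (AddCommGroup (coV H τ))

instance (H : Subgroup G) (τ : Representation ℂ H U) : Module ℂ (CoT H τ) :=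
  inferInstanceAs (Module ℂ (coV H τ))

/-- the coinduced representation -/
def coR (H : Subgroup G) (τ : Representation ℂ H U) : Representation ℂ G (CoT H τ) where
  toFun g :=
    { toFun := fun F => ⟨fun x => F.1 (x * g), fun h x => by
        change F.1 (h * x * g) = _
        rw [mul_assoc]; exact F.2 h (x * g)⟩
      map_add' := fun _ _ => rfl
      map_smul' := fun _ _ => rfl }
  map_one' := by
    refine LinearMap.ext fun F => Subtype.ext ?_
    funext x
    change F.1 (x * 1) = F.1 x
    rw [mul_one]
  map_mul' a b := by
    refine LinearMap.ext fun F => Subtype.ext ?_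
    funext x
    change F.1 (x * (a * b)) = F.1 (x * a * b)
    rw [mul_assoc]

lemma coR_apply (H : Subgroup G) (τ : Representation ℂ H U) (g : G) (F : CoT H τ) (x : G) :
    (coR H τ g F).1 x = F.1 (x * g) := rfl

lemma coV_basis (H : Subgroup G) (τ : Representation ℂ H U) :
    Nonempty (CoT H τ ≃ₗ[ℂ] (Quotient (QuotientGroup.rightRel H) → U)) := by
  let Q := Quotient (QuotientGroup.rightRel H)
  let π : G → Q := fun g => Quotient.mk _ g
  let r : Q → G := Quotient.out
  have hr : ∀ q, π (r q) = q := fun q => Quotient.out_eq q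
  have hπ : ∀ a b, π a = π b ↔ b * a⁻¹ ∈ H := by
    intro a b
    rw [Quotient.eq]
    exact QuotientGroup.rightRel_apply
  have hmem : ∀ g, g * (r (π g))⁻¹ ∈ H := by
    intro g
    rw [← hπ, hr]
  have hπm : ∀ (h : H) g, π (h * g) = π g := by
    intro h g
    symm
    rw [hπ]
    simp
  let fwd : CoT H τ →ₗ[ℂ] (Q → U) :=
    { toFun := fun F q => F.1 (r q)
      map_add' := fun _ _ => rfl
      map_smul' := fun _ _ => rfl }
  refine ⟨LinearEquiv.ofBijective fwd ⟨?_, ?_⟩⟩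
  · rw [injective_iff_map_eq_zero]
    intro F hF
    refine Subtype.ext (funext fun g => ?_)
    have h1 : F.1 (r (π g)) = 0 := congrFun hF (π g)
    have h2 := F.2 ⟨_, hmem g⟩ (r (π g))
    rw [h1, map_zero] at h2
    change F.1 g = 0
    simpa using h2
  · intro f
    refine ⟨⟨fun g => τ ⟨_, hmem g⟩ (f (π g)), ?_⟩, ?_⟩
    · intro h g
      rw [← Module.End.mul_apply, ← map_mul]
      change τ ⟨_, hmem (h * g)⟩ (f (π (h * g))) = _
      have e : (⟨_, hmem (h * g)⟩ : H) = h * ⟨_, hmem g⟩ := by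
        apply Subtype.ext
        change (h : G) * g * (r (π (h * g)))⁻¹ = h * (g * (r (π g))⁻¹)
        rw [hπm h g, mul_assoc]
      rw [e, hπm h g]
    · funext q
      change τ ⟨_, hmem (r q)⟩ (f (π (r q))) = f q
      have : (⟨_, hmem (r q)⟩ : H) = 1 := by
        apply Subtype.ext
        change r q * (r (π (r q)))⁻¹ = 1
        rw [hr, mul_inv_cancel]
      rw [this, map_one, hr]
      rfl

instance [Finite G] [FiniteDimensional ℂ U] (H : Subgroup G) (τ : Representation ℂ H U) :
    FiniteDimensional ℂ (CoT H τ) :=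
  inferInstanceAs (FiniteDimensional ℂ (coV H τ))

lemma finrank_coV [Finite G] [FiniteDimensional ℂ U] (H : Subgroup G) (τ : Representation ℂ H U) :
    Module.finrank ℂ (CoT H τ) = H.index * Module.finrank ℂ U := by
  obtain ⟨e⟩ := coV_basis H τ
  have : Finite (Quotient (QuotientGroup.rightRel H)) := Quotient.finite _
  have := Fintype.ofFinite (Quotient (QuotientGroup.rightRel H))
  rw [e.finrank_eq, Module.finrank_pi_fintype, Finset.sum_const, Finset.card_univ, smul_eq_mul,
    ← Nat.card_eq_fintype_card]
  congr 1
  exact Nat.card_congr (QuotientGroup.quotientRightRelEquivQuotientLeftRel H)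

/-- evaluation at one -/
def coEv (H : Subgroup G) (τ : Representation ℂ H U) : CoT H τ →ₗ[ℂ] U where
  toFun F := F.1 1
  map_add' := fun _ _ => rfl
  map_smul' := fun _ _ => rfl

lemma coEv_apply (H : Subgroup G) (τ : Representation ℂ H U) (h : H) (F : CoT H τ) :
    coEv H τ (coR H τ h F) = τ h (coEv H τ F) := by
  change F.1 (1 * h) = τ h (F.1 1)
  rw [← F.2 h 1, one_mul, mul_one]

lemma coEv_eq_zero (H : Subgroup G) (τ : Representation ℂ H U) (F : CoT H τ)
    (h : ∀ g, coEv H τ (coR H τ g F) = 0) : F = 0 := by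
  refine Subtype.ext (funext fun g => ?_)
  have := h g
  change F.1 (1 * g) = 0 at this
  rwa [one_mul] at this

/-- function supported on the subgroup -/
lemma exists_supported (H : Subgroup G) (τ : Representation ℂ H U) (u : U) :
    ∃ F : CoT H τ, F.1 1 = u ∧ ∀ g ∉ H, F.1 g = 0 := by
  refine ⟨⟨fun g => if h : g ∈ H then τ ⟨g, h⟩ u else 0, ?_⟩, ?_, ?_⟩
  · intro h g
    by_cases hg : g ∈ H
    · have hg' : (h : G) * g ∈ H := H.mul_mem h.2 hg
      simp only [hg, hg', dif_pos]
      rw [← Module.End.mul_apply, ← map_mul]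
      rfl
    · have hg' : (h : G) * g ∉ H := by
        rw [Subgroup.mul_mem_cancel_left _ h.2]; exact hg
      simp only [hg, hg', dif_neg, not_false_iff, map_zero]
  · change (if h : (1 : G) ∈ H then τ ⟨1, h⟩ u else 0) = u
    rw [dif_pos H.one_mem]
    have : (⟨1, H.one_mem⟩ : H) = 1 := rfl
    rw [this, map_one]; rfl
  · intro g hg
    exact dif_neg hg

lemma coind_irr [Finite G] [FiniteDimensional ℂ U] (H : Subgroup G) (τ : Representation ℂ H U)
    (hτ : IrrSub τ ⊤ ⊤) (n : ℕ) (hn : ¬ n ∣ H.index * Module.finrank ℂ U) :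
    ∃ (V : Type) (_ : AddCommGroup V) (_ : Module ℂ V) (_ : FiniteDimensional ℂ V)
      (ρ : Representation ℂ G V) (T : V →ₗ[ℂ] U) (W : Submodule ℂ V),
      IrrSub ρ ⊤ ⊤ ∧ ¬ n ∣ Module.finrank ℂ V ∧
      Module.finrank ℂ V ≤ H.index * Module.finrank ℂ U ∧
      (∀ (h : H) (v : V), T (ρ h v) = τ h (T v)) ∧ IrrSub ρ H W ∧
      Module.finrank ℂ W = Module.finrank ℂ U ∧ (∀ v ∈ W, T v = 0 → v = 0) := by
  obtain ⟨Y, -, hY, hYn⟩ := exists_irrSub_not_dvd (W := ⊤) (SInv.top (coR H τ) ⊤) n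
    (by rw [finrank_top, finrank_coV]; exact hn)
  let ρ : Representation ℂ G Y := topRep (coR H τ) Y hY.1
  have hρirr : IrrSub (topRep (coR H τ) Y hY.1) ⊤ ⊤ := topRep_irr hY
  let T : Y →ₗ[ℂ] U := (coEv H τ).comp Y.subtype
  have hT : ∀ (h : H) (v : Y), T (ρ h v) = τ h (T v) := fun h v => coEv_apply H τ h v
  have hker : SInv ρ H (LinearMap.ker T) := by
    intro h hh v hv
    rw [LinearMap.mem_ker] at hv ⊢
    rw [hT ⟨h, hh⟩ v, hv, map_zero]
  obtain ⟨W, hWi, -, hW1, hW2⟩ := maschke hker (SInv.top ρ H) le_top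
  have hinj : ∀ v ∈ W, T v = 0 → v = 0 := by
    intro v hv h0
    have : v ∈ LinearMap.ker T ⊓ W := ⟨h0, hv⟩
    rwa [hW1, Submodule.mem_bot] at this
  have himg : ∀ W' : Submodule ℂ Y, SInv ρ H W' → SInv τ ⊤ (W'.map T) := by
    rintro W' hW' h - _ ⟨v, hv, rfl⟩
    exact ⟨ρ h v, hW' h h.2 v hv, hT h v⟩
  have hW0 : W ≠ ⊥ := by
    rintro rfl
    rw [sup_bot_eq] at hW2
    apply hY.2.1
    rw [eq_bot_iff]
    intro y hy
    rw [Submodule.mem_bot]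
    apply coEv_eq_zero
    intro g
    have : (⟨coR H τ g y, hY.1 g trivial y hy⟩ : Y) ∈ LinearMap.ker T := by rw [hW2]; trivial
    exact this
  have hmapbot : ∀ W' ≤ W, W'.map T = ⊥ → W' = ⊥ := by
    intro W' hW' h
    rw [eq_bot_iff]
    intro v hv
    have : T v ∈ W'.map T := ⟨v, hv, rfl⟩
    rw [h, Submodule.mem_bot] at this
    exact hinj v (hW' hv) this
  have hmaptop : W.map T = ⊤ :=
    (hτ.2.2 _ le_top (himg W hWi)).resolve_left fun h => hW0 (hmapbot W le_rfl h)
  refine ⟨Y, inferInstance, inferInstance, inferInstance, ρ, T, W, hρirr, hYn, ?_, hT, ?_, ?_, hinj⟩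
  · rw [← finrank_coV]
    exact Submodule.finrank_le Y
  · refine ⟨hWi, hW0, ?_⟩
    intro W' hW' hW'i
    rcases hτ.2.2 _ le_top (himg W' hW'i) with h | h
    · left; exact hmapbot W' hW' h
    · right
      apply le_antisymm hW'
      intro v hv
      have : T v ∈ W'.map T := by rw [h]; trivial
      obtain ⟨v', hv', h'⟩ := this
      have : v - v' = 0 := hinj _ (W.sub_mem hv (hW' hv')) (by rw [map_sub, h', sub_self])
      rw [sub_eq_zero.1 this]
      exact hv'
  · rw [← finrank_map_of_inj T hinj, hmaptop, finrank_top]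

end Coind

/-! ## Class sums and central idempotents -/
section ClassSums
variable {M : Type} [Group M] [Fintype M]

/-- sum over the conjugates of `x` -/
def csum {V : Type} [AddCommGroup V] [Module ℂ V] (ρ : Representation ℂ M V) (x : M) :
    V →ₗ[ℂ] V := ∑ y : M, ρ (y * x * y⁻¹)

/-- class sum in the group algebra -/
def cs (x : M) : MonoidAlgebra ℂ M := ∑ y : M, MonoidAlgebra.single (y * x * y⁻¹) 1

/-- left regular representation -/
def lreg (M : Type) [Group M] : Representation ℂ M (MonoidAlgebra ℂ M) where
  toFun g := LinearMap.mulLeft ℂ (MonoidAlgebra.single g 1)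
  map_one' := by
    refine LinearMap.ext fun a => ?_
    change MonoidAlgebra.single 1 1 * a = a
    rw [← MonoidAlgebra.one_def, one_mul]
  map_mul' a b := by
    refine LinearMap.ext fun x => ?_
    change MonoidAlgebra.single (a * b) 1 * x =
      MonoidAlgebra.single a 1 * (MonoidAlgebra.single b 1 * x)
    rw [← mul_assoc, MonoidAlgebra.single_mul_single, one_mul]

lemma lreg_apply (g : M) (a : MonoidAlgebra ℂ M) :
    lreg M g a = MonoidAlgebra.single g 1 * a := rfl

lemma csum_lreg (x : M) (a : MonoidAlgebra ℂ M) : csum (lreg M) x a = cs x * a := by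
  simp only [csum, cs, LinearMap.sum_apply, lreg_apply, Finset.sum_mul]

section
variable {V : Type} [AddCommGroup V] [Module ℂ V] (ρ : Representation ℂ M V)

lemma csum_eq (x : M) : csum ρ x = ρ.asAlgebraHom (cs x) := by
  simp only [csum, cs, map_sum, Representation.asAlgebraHom_single, one_smul]

lemma csum_conj (m x : M) : csum ρ (m * x * m⁻¹) = csum ρ x := by
  unfold csum
  refine Fintype.sum_equiv (Equiv.mulRight m) _ _ fun y => ?_
  congr 1
  simp only [Equiv.coe_mulRight]
  group

lemma csum_comm (m x : M) (v : V) : csum ρ x (ρ m v) = ρ m (csum ρ x v) := by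
  have h : csum ρ x = ∑ y : M, ρ (m * y * x * (m * y)⁻¹) := by
    unfold csum
    exact (Fintype.sum_equiv (Equiv.mulLeft m) _ _ fun y => by simp).symm
  conv_lhs => rw [h]
  simp only [csum, LinearMap.sum_apply, map_sum]
  refine Finset.sum_congr rfl fun y _ => ?_
  rw [← Module.End.mul_apply, ← Module.End.mul_apply, ← map_mul, ← map_mul]
  congr 2
  group

lemma eig_csum_inv (w : Wt M) : SInv ρ ⊤ (eig (csum ρ) w) := by
  intro m _ v hv x
  rw [csum_comm, hv x, map_smul]

lemma exists_weight [FiniteDimensional ℂ V] {W : Submodule ℂ V} (hW : IrrSub ρ ⊤ W) :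
    ∃ w : Wt M, W ≤ eig (csum ρ) w := by
  have : ∀ x, ∃ c : ℂ, ∀ v ∈ W, csum ρ x v = c • v := by
    intro x
    refine schur hW _ ?_ ?_
    · intro v hv
      unfold csum
      rw [LinearMap.sum_apply]
      exact Submodule.sum_mem _ fun y _ => hW.1 _ trivial v hv
    · intro h _ v _
      exact csum_comm ρ h x v
  choose c hc using this
  exact ⟨c, fun v hv x => hc x v hv⟩

lemma top_le_eig [FiniteDimensional ℂ V] : (⊤ : Submodule ℂ V) ≤ ⨆ w : Wt M, eig (csum ρ) w := by
  refine inv_induction (ρ := ρ) (H := ⊤) (fun X => X ≤ ⨆ w : Wt M, eig (csum ρ) w) bot_le ?_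
    (SInv.top _ _)
  intro U U' hU _ _ h
  obtain ⟨w, hw⟩ := exists_weight ρ hU
  exact sup_le (hw.trans (le_iSup (fun w : Wt M => eig (csum ρ) w) w)) h

end

lemma eig_unique {V ι : Type} [AddCommGroup V] [Module ℂ V] (f : ι → V →ₗ[ℂ] V)
    (a b : Wt ι →₀ V) (ha : ∀ w, a w ∈ eig f w) (hb : ∀ w, b w ∈ eig f w)
    (h : (a.sum fun _ v => v) = b.sum fun _ v => v) : a = b := by
  have hi := (iSupIndep_iff_finsetSum_eq_zero_imp_eq_zero _).1 (eig_indep f)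
    (a.support ∪ b.support) (fun w => a w - b w) (fun w _ => Submodule.sub_mem _ (ha w) (hb w)) (by
      rw [Finset.sum_sub_distrib, sub_eq_zero]
      rw [Finsupp.sum_of_support_subset a Finset.subset_union_left _ (by simp),
        Finsupp.sum_of_support_subset b Finset.subset_union_right _ (by simp)] at h
      exact h)
  ext w
  by_cases hw : w ∈ a.support ∪ b.support
  · exact sub_eq_zero.1 (hi w hw)
  · simp only [Finset.mem_union, Finsupp.mem_support_iff, not_or, not_not] at hw
    rw [hw.1, hw.2]

lemma exists_idemp (M : Type) [Group M] [Fintype M] : ∃ e : Wt M →₀ MonoidAlgebra ℂ M,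
    (∀ w, e w ∈ eig (csum (lreg M)) w) ∧ (e.sum fun _ v => v) = 1 :=
  (Submodule.mem_iSup_iff_exists_finsupp _ _).1 (top_le_eig (lreg M) (Submodule.mem_top (x := 1)))

/-- the central idempotents -/
def idem (M : Type) [Group M] [Fintype M] : Wt M →₀ MonoidAlgebra ℂ M :=
  Classical.choose (exists_idemp M)

lemma idem_mem (w : Wt M) : idem M w ∈ eig (csum (lreg M)) w :=
  (Classical.choose_spec (exists_idemp M)).1 w

lemma idem_sum : ((idem M).sum fun _ v => v) = 1 := (Classical.choose_spec (exists_idemp M)).2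

lemma cs_mul_idem (x : M) (w : Wt M) : cs x * idem M w = w x • idem M w := by
  rw [← csum_lreg]; exact idem_mem w x

lemma idem_apply {V : Type} [AddCommGroup V] [Module ℂ V] (ρ : Representation ℂ M V)
    {w : Wt M} {v : V} (hv : v ∈ eig (csum ρ) w) (w' : Wt M) :
    ρ.asAlgebraHom (idem M w') v = if w' = w then v else 0 := by
  let φ : MonoidAlgebra ℂ M →+ V :=
    { toFun := fun a => ρ.asAlgebraHom a v
      map_zero' := by simp
      map_add' := by intro a b; simp }
  have h := eig_unique (csum ρ) ((idem M).mapRange φ (map_zero φ)) (Finsupp.single w v) ?_ ?_ ?_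
  · have h2 := DFunLike.congr_fun h w'
    rw [Finsupp.mapRange_apply, Finsupp.single_apply] at h2
    change ρ.asAlgebraHom (idem M w') v = _ at h2
    rw [h2]
    by_cases hc : w' = w
    · simp [hc]
    · simp [hc, Ne.symm hc]
  · intro u x
    rw [Finsupp.mapRange_apply]
    change csum ρ x (ρ.asAlgebraHom (idem M u) v) = u x • ρ.asAlgebraHom (idem M u) v
    rw [csum_eq, ← Module.End.mul_apply, ← map_mul, cs_mul_idem, map_smul]
    rfl
  · intro u
    by_cases hu : u = w
    · subst hu; simpa using hv
    · simp [Finsupp.single_apply, Ne.symm hu]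
  · rw [Finsupp.sum_mapRange_index (by simp), Finsupp.sum_single_index rfl]
    have : ρ.asAlgebraHom ((idem M).sum fun _ v => v) v = v := by rw [idem_sum]; simp
    rw [Finsupp.sum, map_sum, LinearMap.sum_apply] at this
    exact this

lemma idem_ne_zero_of_weight {V : Type} [AddCommGroup V] [Module ℂ V] (ρ : Representation ℂ M V)
    {w : Wt M} {v : V} (hv : v ∈ eig (csum ρ) w) (h0 : v ≠ 0) : idem M w ≠ 0 := by
  intro h
  have := idem_apply ρ hv w
  rw [h, if_pos rfl] at this
  simp at this
  exact h0 this.symm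

lemma lreg_alg (a b : MonoidAlgebra ℂ M) : (lreg M).asAlgebraHom a b = a * b := by
  have : (lreg M).asAlgebraHom = Algebra.lmul ℂ (MonoidAlgebra ℂ M) := by
    apply MonoidAlgebra.algHom_ext
    · intro x
      rw [Representation.asAlgebraHom_single, one_smul]
      rfl
    · exact Subsingleton.elim _ _
  rw [this]; rfl

lemma idem_mul (w' w : Wt M) : idem M w' * idem M w = if w' = w then idem M w else 0 := by
  rw [← lreg_alg]
  exact (idem_apply (lreg M) (idem_mem w) w' : _ = if _ then idem M w else 0)

/-- coefficients -/
def ec (w : Wt M) (x : M) : ℂ := (idem M w).coeff x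

lemma alg_sum (a : MonoidAlgebra ℂ M) : a = ∑ x : M, a.coeff x • MonoidAlgebra.single x 1 := by
  apply MonoidAlgebra.ext
  ext z
  rw [MonoidAlgebra.coeff_sum, Finsupp.finsetSum_apply]
  simp [MonoidAlgebra.coeff_single, Finsupp.single_apply]

section Equivariance
variable {A : Type} [Group A] [MulDistribMulAction A M]

lemma ec_smul (a : A) (w : Wt M) (x : M) : ec (a • w) x = ec w (a⁻¹ • x) := by
  let θ : MonoidAlgebra ℂ M →ₐ[ℂ] MonoidAlgebra ℂ M :=
    MonoidAlgebra.mapDomainAlgHom ℂ ℂ (MulDistribMulAction.toMonoidHom M a)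
  have hθs : ∀ x, θ (MonoidAlgebra.single x 1) = MonoidAlgebra.single (a • x) 1 := by
    intro x
    exact MonoidAlgebra.mapDomain_single
  have hθ : ∀ b x, (θ b).coeff x = b.coeff (a⁻¹ • x) := by
    intro b x
    have h1 : (θ b).coeff = Finsupp.mapDomain (a • ·) b.coeff := MonoidAlgebra.coeff_mapDomain _ _
    rw [h1]
    conv_lhs => rw [← smul_inv_smul a x]
    exact Finsupp.mapDomain_apply (MulAction.injective a) _ _
  have hcs : ∀ x, θ (cs x) = cs (a • x) := by
    intro x
    unfold cs
    rw [map_sum]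
    refine Fintype.sum_equiv (MulAction.toPerm a) _ _ fun y => ?_
    rw [hθs]
    simp [smul_mul', smul_inv']
  have h := eig_unique (csum (lreg M)) (((idem M).mapDomain (a • ·)).mapRange θ (map_zero θ))
    (idem M) ?_ idem_mem ?_
  · have h2 := DFunLike.congr_fun h (a • w)
    rw [Finsupp.mapRange_apply, Finsupp.mapDomain_apply (MulAction.injective a)] at h2
    have h3 := congrArg (fun b => MonoidAlgebra.coeff b x) h2
    change (θ (idem M w)).coeff x = _ at h3
    rw [hθ] at h3
    exact h3.symm
  · intro u
    obtain ⟨w, rfl⟩ := MulAction.surjective a u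
    intro x
    rw [Finsupp.mapRange_apply, Finsupp.mapDomain_apply (MulAction.injective a), csum_lreg]
    have e : cs x = θ (cs (a⁻¹ • x)) := by rw [hcs, smul_inv_smul]
    rw [e, ← map_mul, cs_mul_idem, map_smul]
    rfl
  · rw [Finsupp.sum_mapRange_index (by simp)]
    rw [Finsupp.sum_mapDomain_index_inj (MulAction.injective a), idem_sum]
    have : θ ((idem M).sum fun _ v => v) = 1 := by rw [idem_sum, map_one]
    rw [Finsupp.sum, map_sum] at this
    exact this

lemma idem_smul_ne (a : A) (w : Wt M) : idem M (a • w) ≠ 0 ↔ idem M w ≠ 0 := by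
  have key : ∀ (b : A) (u : Wt M), idem M u = 0 → idem M (b • u) = 0 := by
    intro b u hu
    apply MonoidAlgebra.ext
    ext x
    have := ec_smul b u x
    unfold ec at this
    rw [this, hu]
    rfl
  constructor
  · intro h h0; exact h (key a w h0)
  · intro h h0
    apply h
    have := key a⁻¹ _ h0
    rwa [inv_smul_smul] at this

end Equivariance

lemma wt_conj {w : Wt M} (hw : idem M w ≠ 0) (m x : M) : w (m * x * m⁻¹) = w x := by
  have h1 := idem_mem w (m * x * m⁻¹)
  rw [csum_conj, idem_mem w x] at h1
  have h2 : (w x - w (m * x * m⁻¹)) • idem M w = 0 := by rw [sub_smul, h1, sub_self]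
  exact (sub_eq_zero.1 ((smul_eq_zero.1 h2).resolve_right hw)).symm

lemma ec_conj (w : Wt M) (m x : M) : ec w (m * x * m⁻¹) = ec w x := by
  by_cases hw : idem M w = 0
  · simp [ec, hw]
  · have h := ec_smul (MulAut.conj m⁻¹) w x
    have h2 : (MulAut.conj m⁻¹) • w = w := by
      funext z
      rw [wt_smul_apply]
      change w ((MulAut.conj m⁻¹)⁻¹ z) = w z
      rw [← map_inv, inv_inv, MulAut.conj_apply]
      exact wt_conj hw m z
    rw [h2] at h
    rw [h]
    change _ = ec w ((MulAut.conj m⁻¹)⁻¹ x)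
    rw [← map_inv, inv_inv, MulAut.conj_apply]

lemma coeff_cs_mul (x z : M) (a : MonoidAlgebra ℂ M) :
    (cs x * a).coeff z = ∑ y : M, a.coeff ((y * x * y⁻¹)⁻¹ * z) := by
  unfold cs
  rw [Finset.sum_mul, MonoidAlgebra.coeff_sum, Finsupp.finsetSum_apply]
  refine Finset.sum_congr rfl fun y _ => ?_
  rw [MonoidAlgebra.coeff_single_mul_apply, one_mul]

lemma wt_mul_ec (w : Wt M) (x z : M) : w x * ec w z = ∑ y : M, ec w ((y * x * y⁻¹)⁻¹ * z) := by
  have h := congrArg (fun b => MonoidAlgebra.coeff b z) (cs_mul_idem x w)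
  simp only [coeff_cs_mul] at h
  exact h.symm

lemma ec_inv (w : Wt M) (x : M) : (Fintype.card M : ℂ) * ec w x⁻¹ = w x * ec w 1 := by
  rw [wt_mul_ec]
  have : ∀ y : M, ec w ((y * x * y⁻¹)⁻¹ * 1) = ec w x⁻¹ := by
    intro y
    have e : (y * x * y⁻¹)⁻¹ * 1 = y * x⁻¹ * y⁻¹ := by group
    rw [e, ec_conj]
  simp only [this, Finset.sum_const, Finset.card_univ, nsmul_eq_mul]

lemma column (x x' : M) : ∑ w ∈ (idem M).support, w x * ec w x' =
    ((Finset.univ.filter fun y : M => y * x * y⁻¹ = x').card : ℂ) := by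
  have h : cs x * ((idem M).sum fun _ v => v) = cs x := by rw [idem_sum, mul_one]
  rw [Finsupp.sum, Finset.mul_sum] at h
  have h2 := congrArg (fun b => MonoidAlgebra.coeff b x') h
  simp only [cs_mul_idem] at h2
  rw [MonoidAlgebra.coeff_sum, Finsupp.finsetSum_apply] at h2
  have h3 : (cs x).coeff x' = ((Finset.univ.filter fun y : M => y * x * y⁻¹ = x').card : ℂ) := by
    unfold cs
    rw [MonoidAlgebra.coeff_sum, Finsupp.finsetSum_apply]
    simp [MonoidAlgebra.coeff_single, Finsupp.single_apply]
  rw [← h3, ← h2]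
  rfl

lemma row (w w' : Wt M) (hw : idem M w ≠ 0) :
    ∑ x : M, ec w' x * w x = if w' = w then (Fintype.card M : ℂ) else 0 := by
  have h1 : ∑ x : M, ec w' x • cs x = (Fintype.card M : ℂ) • idem M w' := by
    unfold cs
    simp only [Finset.smul_sum]
    rw [Finset.sum_comm]
    have : ∀ y : M, ∑ x : M, ec w' x • MonoidAlgebra.single (y * x * y⁻¹) (1 : ℂ) = idem M w' := by
      intro y
      conv_rhs => rw [alg_sum (idem M w')]
      refine Fintype.sum_equiv (MulAut.conj y).toEquiv _ _ fun x => ?_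
      change _ = ec w' (y * x * y⁻¹) • MonoidAlgebra.single (y * x * y⁻¹) (1 : ℂ)
      rw [ec_conj]
    simp only [this, Finset.sum_const, Finset.card_univ]
    rw [Nat.cast_smul_eq_nsmul]
  have h2 : (∑ x : M, ec w' x • cs x) * idem M w = (∑ x : M, ec w' x * w x) • idem M w := by
    rw [Finset.sum_mul, Finset.sum_smul]
    refine Finset.sum_congr rfl fun x _ => ?_
    rw [smul_mul_assoc, cs_mul_idem, smul_smul]
  rw [h1, smul_mul_assoc, idem_mul] at h2
  by_cases hc : w' = w
  · rw [if_pos hc] at h2 ⊢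
    have : ((∑ x : M, ec w' x * w x) - (Fintype.card M : ℂ)) • idem M w = 0 := by
      rw [sub_smul, ← h2, sub_self]
    exact sub_eq_zero.1 ((smul_eq_zero.1 this).resolve_right hw)
  · rw [if_neg hc, smul_zero] at h2
    rw [if_neg hc]
    exact (smul_eq_zero.1 h2.symm).resolve_right hw

lemma trace_mulRight (a : MonoidAlgebra ℂ M) :
    LinearMap.trace ℂ _ (LinearMap.mulRight ℂ a) = (Fintype.card M : ℂ) * a.coeff 1 := by
  rw [LinearMap.trace_eq_matrix_trace ℂ (MonoidAlgebra.basis M ℂ), Matrix.trace]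
  have : ∀ g : M, (LinearMap.toMatrix (MonoidAlgebra.basis M ℂ) (MonoidAlgebra.basis M ℂ)
      (LinearMap.mulRight ℂ a)).diag g = a.coeff 1 := by
    intro g
    rw [Matrix.diag_apply, LinearMap.toMatrix_apply]
    have e1 : MonoidAlgebra.basis M ℂ g = MonoidAlgebra.single g 1 := by simp
    have e2 : ∀ b : MonoidAlgebra ℂ M, (MonoidAlgebra.basis M ℂ).repr b g = b.coeff g := by
      intro b; rfl
    rw [e1, e2, LinearMap.mulRight_apply, MonoidAlgebra.coeff_single_mul_apply]
    simp
  simp only [this, Finset.sum_const, Finset.card_univ, nsmul_eq_mul]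

lemma finrank_range_mulRight (a : MonoidAlgebra ℂ M) (ha : a * a = a) :
    (Module.finrank ℂ (LinearMap.range (LinearMap.mulRight ℂ a)) : ℂ)
      = (Fintype.card M : ℂ) * a.coeff 1 := by
  rw [← trace_mulRight]
  have : IsIdempotentElem (LinearMap.mulRight ℂ a) := by
    refine LinearMap.ext fun b => ?_
    change b * a * a = b * a
    rw [mul_assoc, ha]
  exact (LinearMap.IsIdempotentElem.isProj_range _ this).trace.symm

/-- the dimension of the block -/
def bd (w : Wt M) : ℕ := Module.finrank ℂ (LinearMap.range (LinearMap.mulRight ℂ (idem M w)))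

lemma bd_eq (w : Wt M) : (bd w : ℂ) = (Fintype.card M : ℂ) * ec w 1 :=
  finrank_range_mulRight _ (by rw [idem_mul, if_pos rfl])

lemma bd_wt (w : Wt M) (x : M) : (Fintype.card M : ℂ) ^ 2 * ec w x⁻¹ = bd w * w x := by
  rw [bd_eq, sq, mul_assoc, ec_inv]; ring

lemma wt_integral {w : Wt M} (hw : idem M w ≠ 0) (x : M) : IsIntegral ℤ (w x) := by
  refine isIntegral_of_smul_mem_submodule (M := ℂ)
    (Submodule.span ℤ (Set.range (ec w))) ?_ ?_ (w x) ?_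
  · intro h
    apply hw
    apply MonoidAlgebra.ext
    ext z
    have : ec w z ∈ Submodule.span ℤ (Set.range (ec w)) := Submodule.subset_span ⟨z, rfl⟩
    rw [h, Submodule.mem_bot] at this
    exact this
  · exact Submodule.fg_span (Set.finite_range _)
  · intro n hn
    induction hn using Submodule.span_induction with
    | mem n hn =>
      obtain ⟨z, rfl⟩ := hn
      rw [smul_eq_mul, wt_mul_ec]
      exact Submodule.sum_mem _ fun y _ => Submodule.subset_span ⟨_, rfl⟩
    | zero => simp
    | add a b _ _ ha hb => rw [smul_add]; exact Submodule.add_mem _ ha hb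
    | smul c a _ ha => rw [smul_comm]; exact Submodule.smul_mem _ _ ha

lemma ec_integral {w : Wt M} (hw : idem M w ≠ 0) (x : M) :
    IsIntegral ℤ ((Fintype.card M : ℂ) ^ 2 * ec w x) := by
  have := bd_wt w x⁻¹
  rw [inv_inv] at this
  rw [this]
  have h2 := (isIntegral_algebraMap (R := ℤ) (A := ℂ) (x := (bd w : ℤ))).mul (wt_integral hw x⁻¹)
  simpa using h2

lemma int_dvd {a b : ℤ} {z : ℂ} (hz : IsIntegral ℤ z) (h : (a : ℂ) = b * z) : b ∣ a := by
  by_cases hb : b = 0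
  · subst hb; simp at h; simp [h]
  · have hb' : (b : ℚ) ≠ 0 := by exact_mod_cast hb
    have hbc : (b : ℂ) ≠ 0 := by exact_mod_cast hb
    have e : z = algebraMap ℚ ℂ ((a : ℚ) / b) := by
      simp only [eq_ratCast, Rat.cast_div, Rat.cast_intCast]
      rw [h]; field_simp
    rw [e, isIntegral_algebraMap_iff (algebraMap ℚ ℂ).injective,
      IsIntegrallyClosed.isIntegral_iff] at hz
    obtain ⟨y, hy⟩ := hz
    refine ⟨y, ?_⟩
    have hy' : (y : ℚ) = a / b := by simpa using hy
    have : (a : ℚ) = b * y := by rw [hy']; field_simp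
    exact_mod_cast this

lemma bd_dvd {w : Wt M} (hw : idem M w ≠ 0) : bd w ∣ Fintype.card M ^ 3 := by
  have h := row w w hw
  rw [if_pos rfl] at h
  have h2 : (((Fintype.card M ^ 3 : ℕ) : ℤ) : ℂ) = ((bd w : ℕ) : ℤ) * ∑ x : M, w x⁻¹ * w x := by
    push_cast
    have h3 : (Fintype.card M : ℂ) ^ 3 = (Fintype.card M : ℂ) ^ 2 * ∑ x : M, ec w x * w x := by
      rw [h]; ring
    rw [h3, Finset.mul_sum, Finset.mul_sum]
    refine Finset.sum_congr rfl fun x _ => ?_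
    have := bd_wt w x⁻¹
    rw [inv_inv] at this
    rw [← mul_assoc, this]
    ring
  exact_mod_cast int_dvd (IsIntegral.sum _ fun x _ =>
    (wt_integral hw _).mul (wt_integral hw _)) h2

end ClassSums

/-! ## Degrees and congruences -/
section Degrees
variable {M : Type} [Group M] [Fintype M]

lemma char_weight {V : Type} [AddCommGroup V] [Module ℂ V] [FiniteDimensional ℂ V]
    (ρ : Representation ℂ M V) {w : Wt M} (hw : ⊤ ≤ eig (csum ρ) w) (x : M) :
    (Fintype.card M : ℂ) * ρ.character x = w x * Module.finrank ℂ V := by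
  have h1 : csum ρ x = w x • LinearMap.id := by
    refine LinearMap.ext fun v => ?_
    exact hw (Submodule.mem_top (x := v)) x
  have h2 := congrArg (LinearMap.trace ℂ V) h1
  rw [map_smul, LinearMap.trace_id, csum, map_sum] at h2
  rw [← smul_eq_mul (w x), ← h2]
  have : ∀ y : M, LinearMap.trace ℂ V (ρ (y * x * y⁻¹)) = ρ.character x := fun y =>
    ρ.char_conj x y
  rw [Finset.sum_congr rfl fun y _ => this y]
  simp

lemma char_norm {V : Type} [AddCommGroup V] [Module ℂ V] [FiniteDimensional ℂ V]
    (ρ : Representation ℂ M V) (hirr : IrrSub ρ ⊤ ⊤) :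
    ∑ x : M, ρ.character x * ρ.character x⁻¹ = (Fintype.card M : ℂ) := by
  haveI := (irr_iff ρ).1 hirr
  have hc : (Nat.card M : ℂ) ≠ 0 := by exact_mod_cast Nat.card_pos.ne'
  haveI : Invertible (Nat.card M : ℂ) := invertibleOfNonzero hc
  have h := Representation.char_orthonormal ρ ρ
  rw [if_pos ⟨Representation.Equiv.refl ρ⟩] at h
  rw [← Nat.card_eq_fintype_card]
  field_simp at h
  simpa using h

lemma Deg.sq_dvd {d : ℕ} (h : Deg M d) : d ^ 2 ∣ Fintype.card M ^ 3 := by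
  obtain ⟨V, _, _, _, ρ, hirr, rfl⟩ := h
  obtain ⟨w, hw⟩ := exists_weight ρ hirr
  have hn := char_norm ρ hirr
  have hnz : idem M w ≠ 0 := by
    obtain ⟨v, -, hv⟩ := Submodule.exists_mem_ne_zero_of_ne_bot hirr.2.1
    exact idem_ne_zero_of_weight ρ (hw Submodule.mem_top) hv
  have h2 : (((Fintype.card M ^ 3 : ℕ) : ℤ) : ℂ) =
      ((Module.finrank ℂ V ^ 2 : ℕ) : ℤ) * ∑ x : M, w x * w x⁻¹ := by
    push_cast
    have h3 : (Fintype.card M : ℂ) ^ 3 = ∑ x : M, ((Fintype.card M : ℂ) * ρ.character x) *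
        ((Fintype.card M : ℂ) * ρ.character x⁻¹) := by
      rw [pow_succ]
      nth_rewrite 2 [← hn]
      rw [Finset.mul_sum]
      exact Finset.sum_congr rfl fun x _ => by ring
    rw [h3, Finset.mul_sum]
    refine Finset.sum_congr rfl fun x _ => ?_
    rw [char_weight ρ hw, char_weight ρ hw]
    ring
  exact_mod_cast int_dvd (IsIntegral.sum _ fun x _ =>
    (wt_integral hnz _).mul (wt_integral hnz _)) h2

lemma Deg.of_pGroup {p : ℕ} (hp : p.Prime) (hM : IsPGroup p M) {d : ℕ} (h : Deg M d) :
    ∃ k, d = p ^ k := by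
  haveI := Fact.mk hp
  obtain ⟨n, hn⟩ := IsPGroup.iff_card.1 hM
  have h1 := h.sq_dvd
  rw [← Nat.card_eq_fintype_card, hn, ← pow_mul] at h1
  have h2 : d ∣ p ^ (n * 3) := (dvd_pow_self d two_ne_zero).trans h1
  obtain ⟨k, -, hk⟩ := (Nat.dvd_prime_pow hp).1 h2
  exact ⟨k, hk⟩

lemma Deg.of_pPrime {p : ℕ} (hp : p.Prime) (hM : ¬ p ∣ Nat.card M) {d : ℕ} (h : Deg M d) :
    ¬ p ∣ d := by
  intro hd
  apply hM
  have := (hd.trans (dvd_pow_self d two_ne_zero)).trans h.sq_dvd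
  rw [Nat.card_eq_fintype_card]
  exact hp.dvd_of_dvd_pow this

lemma bd_pPrime {p : ℕ} (hp : p.Prime) (hM : ¬ p ∣ Nat.card M) {w : Wt M} (hw : idem M w ≠ 0) :
    ¬ p ∣ bd w := by
  intro hd
  apply hM
  rw [Nat.card_eq_fintype_card]
  exact hp.dvd_of_dvd_pow (hd.trans (bd_dvd hw))

/-- irreducibles of the same weight are isomorphic -/
lemma iso_of_weight {V V' : Type} [AddCommGroup V] [Module ℂ V] [FiniteDimensional ℂ V]
    [AddCommGroup V'] [Module ℂ V'] [FiniteDimensional ℂ V']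
    (ρ : Representation ℂ M V) (ρ' : Representation ℂ M V') (h : IrrSub ρ ⊤ ⊤) (h' : IrrSub ρ' ⊤ ⊤)
    {w : Wt M} (hw : ⊤ ≤ eig (csum ρ) w) (hw' : ⊤ ≤ eig (csum ρ') w) :
    ∃ T : V ≃ₗ[ℂ] V', ∀ m v, T (ρ m v) = ρ' m (T v) := by
  haveI := (irr_iff ρ).1 h
  haveI := (irr_iff ρ').1 h'
  have hc : (Nat.card M : ℂ) ≠ 0 := by exact_mod_cast Nat.card_pos.ne'
  haveI : Invertible (Nat.card M : ℂ) := invertibleOfNonzero hc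
  have ho := Representation.char_orthonormal ρ' ρ
  have hn := char_norm ρ h
  have hd : (Module.finrank ℂ V : ℂ) ≠ 0 := by
    exact_mod_cast (Deg.pos ⟨V, _, _, inferInstance, ρ, h, rfl⟩).ne'
  have hd' : (Module.finrank ℂ V' : ℂ) ≠ 0 := by
    exact_mod_cast (Deg.pos ⟨V', _, _, inferInstance, ρ', h', rfl⟩).ne'
  have hne : ∑ g : M, ρ'.character g * ρ.character g⁻¹ ≠ 0 := by
    have e : ∀ g, ρ'.character g = (Module.finrank ℂ V' : ℂ) / Module.finrank ℂ V *
        ρ.character g := by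
      intro g
      have h1 := char_weight ρ hw g
      have h2 := char_weight ρ' hw' g
      rw [← Nat.card_eq_fintype_card] at h1 h2
      field_simp
      apply mul_left_cancel₀ hc
      linear_combination (Module.finrank ℂ V : ℂ) * h2 - (Module.finrank ℂ V' : ℂ) * h1
    simp only [e, mul_assoc]
    rw [← Finset.mul_sum, hn, ← Nat.card_eq_fintype_card]
    positivity
  by_cases hE : Nonempty (ρ.Equiv ρ')
  · obtain ⟨T⟩ := hE
    refine ⟨T.toLinearEquiv, fun m v => ?_⟩
    exact LinearMap.congr_fun (T.toIntertwiningMap.isIntertwining' m) v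
  · rw [if_neg hE] at ho
    exfalso
    apply hne
    have := (mul_eq_zero.1 ho).resolve_left (inv_ne_zero hc)
    simpa using this

/-- orbit counting with values -/
lemma orbit_congr {p : ℕ} (hp : p.Prime) {E X : Type} [Group E] [MulAction E X]
    (hE : IsPGroup p E) (s : Finset X) (hs : ∀ (e : E), ∀ x ∈ s, e • x ∈ s) (f : X → ℂ)
    (hf : ∀ (e : E), ∀ x ∈ s, f (e • x) = f x) (hIntg : ∀ x ∈ s, IsIntegral ℤ (f x)) :
    ∃ z, IsIntegral ℤ z ∧
      ∑ x ∈ s, f x = ∑ x ∈ s.filter (fun x => ∀ e : E, e • x = x), f x + p * z := by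
  haveI := Fact.mk hp
  have key : ∀ v : ℂ, ∃ c : ℤ, ((s.filter fun x => f x = v).card : ℤ) =
      (((s.filter (fun x => ∀ e : E, e • x = x)).filter fun x => f x = v).card : ℤ) + p * c := by
    intro v
    let Y : SubMulAction E X :=
      { carrier := {x | x ∈ s ∧ f x = v}
        smul_mem' := fun e x hx => ⟨hs e x hx.1, by rw [hf e x hx.1]; exact hx.2⟩ }
    have hY : (Y : Set X) = ↑(s.filter fun x => f x = v) := by
      ext x
      rw [Finset.coe_filter]
      exact Iff.rfl
    haveI : Finite Y := by
      have : (Y : Set X).Finite := by rw [hY]; exact Finset.finite_toSet _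
      exact this
    have h1 := hE.card_modEq_card_fixedPoints Y
    have c1 : Nat.card Y = (s.filter fun x => f x = v).card := by
      have : Nat.card Y = (Y : Set X).ncard := rfl
      rw [this, hY, Set.ncard_coe_finset]
    have c2 : Nat.card (MulAction.fixedPoints E Y) =
        ((s.filter (fun x => ∀ e : E, e • x = x)).filter fun x => f x = v).card := by
      rw [← Set.ncard_coe_finset, ← Nat.card_coe_set_eq]
      refine Nat.card_congr
        { toFun := fun y => ⟨y.1.1, ?_⟩
          invFun := fun y => ⟨⟨y.1, ?_⟩, ?_⟩
          left_inv := fun y => rfl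
          right_inv := fun y => rfl }
      · have h2 := y.1.2
        have h3 := y.2
        simp only [Finset.coe_filter, Finset.mem_filter, Set.mem_ofPred_eq]
        exact ⟨⟨h2.1, fun e => congrArg Subtype.val (h3 e)⟩, h2.2⟩
      · have := y.2
        simp only [Finset.coe_filter, Finset.mem_filter, Set.mem_ofPred_eq] at this
        exact ⟨this.1.1, this.2⟩
      · have := y.2
        simp only [Finset.coe_filter, Finset.mem_filter, Set.mem_ofPred_eq] at this
        intro e
        exact Subtype.ext (this.1.2 e)
    rw [c1, c2] at h1
    obtain ⟨c, hc⟩ := (Int.natCast_modEq_iff.2 h1).symm.dvd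
    exact ⟨c, by linarith⟩
  choose c hc using key
  refine ⟨∑ v ∈ s.image f, (c v : ℂ) * v, ?_, ?_⟩
  · refine IsIntegral.sum _ fun v hv => ?_
    obtain ⟨x, hx, rfl⟩ := Finset.mem_image.1 hv
    refine IsIntegral.mul ?_ (hIntg x hx)
    have := isIntegral_algebraMap (R := ℤ) (A := ℂ) (x := c (f x))
    simpa using this
  · have e1 : ∀ t ⊆ s, ∑ x ∈ t, f x = ∑ v ∈ s.image f, ((t.filter fun x => f x = v).card : ℂ) * v := by
      intro t ht
      rw [← Finset.sum_fiberwise_of_maps_to (s := t) (t := s.image f) (g := f)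
        (fun x hx => Finset.mem_image_of_mem f (ht hx))]
      refine Finset.sum_congr rfl fun v _ => ?_
      rw [Finset.sum_congr rfl (g := fun _ => v) (fun x hx => (Finset.mem_filter.1 hx).2)]
      simp
    rw [e1 s (Finset.Subset.refl _), e1 _ (Finset.filter_subset _ _), Finset.mul_sum,
      ← Finset.sum_add_distrib]
    refine Finset.sum_congr rfl fun v _ => ?_
    have := hc v
    have h2 : ((s.filter fun x => f x = v).card : ℂ) =
      (((s.filter (fun x => ∀ e : E, e • x = x)).filter fun x => f x = v).card : ℂ) + p * c v := by
      exact_mod_cast this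
    rw [h2]; ring

end Degrees

/-! ## Coprime action: fixed points and fixed weights -/
section Coprime

lemma exists_norm {A : Type} [Group A] [Finite A] {p : ℕ} (hp : p.Prime) {P E : Subgroup A}
    (hP : IsPGroup p P) (hE : E < P) : ∃ g ∈ P, g ∉ E ∧ ∀ e ∈ E, g⁻¹ * e * g ∈ E := by
  haveI := Fact.mk hp
  haveI := hP.isNilpotent
  have hn := Group.normalizerCondition_of_isNilpotent (G := P)
  have hlt : E.subgroupOf P < ⊤ := by
    rw [lt_top_iff_ne_top, Ne, Subgroup.subgroupOf_eq_top]
    exact hE.not_ge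
  obtain ⟨g, hg, hgE⟩ := SetLike.exists_of_lt (hn _ hlt)
  refine ⟨g, g.2, fun h => hgE (Subgroup.mem_subgroupOf.2 h), fun e he => ?_⟩
  have := (Subgroup.mem_normalizer_iff'').1 hg ⟨e, hE.le he⟩
  exact Subgroup.mem_subgroupOf.1 (this.1 (Subgroup.mem_subgroupOf.2 he))

lemma eq_top_of_meets {C : Type} [Group C] [Finite C] (F : Subgroup C)
    (h : ∀ c, ∃ x ∈ F, IsConj c x) : F = ⊤ := by
  haveI := Fintype.ofFinite C
  have hb := MulAction.sum_card_fixedBy_eq_card_orbits_mul_card_group C (C ⧸ F)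
  have h1 : Fintype.card (Quotient (MulAction.orbitRel C (C ⧸ F))) = 1 := by
    rw [Fintype.card_eq_one_iff_nonempty_unique]
    have := (MulAction.pretransitive_iff_subsingleton_quotient C (C ⧸ F)).1 inferInstance
    exact ⟨⟨⟨Quotient.mk _ ((1 : C) : C ⧸ F)⟩, fun a => Subsingleton.elim _ _⟩⟩
  rw [h1, one_mul] at hb
  have h2 : ∀ c : C, 1 ≤ Fintype.card (MulAction.fixedBy (C ⧸ F) c) := by
    intro c
    obtain ⟨x, hx, hc⟩ := h c
    obtain ⟨y, hy⟩ := isConj_iff.1 hc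
    apply Fintype.card_pos_iff.2
    refine ⟨⟨((y⁻¹ : C) : C ⧸ F), ?_⟩⟩
    rw [MulAction.mem_fixedBy, MulAction.Quotient.smul_coe, QuotientGroup.eq]
    rw [smul_eq_mul, show (c * y⁻¹)⁻¹ * y⁻¹ = (y * c * y⁻¹)⁻¹ by group, hy]
    exact F.inv_mem hx
  have h3 : ∑ c : C, 1 = ∑ c : C, Fintype.card (MulAction.fixedBy (C ⧸ F) c) := by
    rw [hb]; simp
  have h4 := (Finset.sum_eq_sum_iff_of_le (fun c _ => h2 c)).1 h3 1 (Finset.mem_univ _)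
  have h5 : F.index = 1 := by
    rw [Subgroup.index, Nat.card_eq_fintype_card, h4]
    refine Fintype.card_congr (Equiv.symm ?_)
    rw [MulAction.fixedBy_one_eq_univ]
    exact Equiv.Set.univ _
  exact Subgroup.index_eq_one.1 h5

lemma conj_fix {p : ℕ} (hp : p.Prime) {C : Type} [Group C] [Finite C] (hC : ¬ p ∣ Nat.card C)
    (σ : MulAut C) (k : ℕ) (hσ : σ ^ p ^ k = 1) (h : ∀ c, IsConj c (σ c)) : ∀ c, σ c = c := by
  haveI := Fact.mk hp
  have hz : ∀ z ∈ Subgroup.zpowers σ, ∀ c, IsConj c (z c) := by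
    intro z hz
    have hn : ∀ n : ℕ, ∀ c, IsConj c ((σ ^ n) c) := by
      intro n
      induction n with
      | zero => intro c; exact IsConj.refl _
      | succ n ih => intro c; rw [pow_succ]; exact (h c).trans (ih (σ c))
    obtain ⟨n, rfl⟩ := (mem_powers_iff_mem_zpowers.2 hz)
    exact hn n
  have hZ : IsPGroup p (Subgroup.zpowers σ) := by
    rintro ⟨z, hz⟩
    obtain ⟨n, rfl⟩ := Subgroup.mem_zpowers_iff.1 hz
    refine ⟨k, Subtype.ext ?_⟩
    change (σ ^ n) ^ p ^ k = 1
    rw [← zpow_natCast, ← zpow_mul, mul_comm, zpow_mul, zpow_natCast, hσ, one_zpow]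
  let F : Subgroup C :=
    { carrier := {c | σ c = c}
      mul_mem' := by
        intro a b ha hb
        change σ (a * b) = a * b
        rw [map_mul, ha, hb]
      one_mem' := map_one σ
      inv_mem' := by
        intro a ha
        change σ a⁻¹ = a⁻¹
        rw [map_inv, ha] }
  have hF : F = ⊤ := by
    apply eq_top_of_meets
    intro c
    let Y : SubMulAction (Subgroup.zpowers σ) C :=
      { carrier := {x | IsConj c x}
        smul_mem' := fun e x hx => IsConj.trans hx (hz e e.2 x) }
    have hY : ¬ p ∣ Nat.card Y := by
      intro hd
      apply hC
      have e : (Y : Set C) = MulAction.orbit (ConjAct C) c := by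
        ext x
        rw [ConjAct.mem_orbit_conjAct, isConj_comm]
        exact Iff.rfl
      have e2 : Nat.card Y = (MulAction.orbit (ConjAct C) c).ncard := by
        rw [← e]; rfl
      rw [e2, ← MulAction.index_stabilizer] at hd
      have := hd.trans (Subgroup.index_dvd_card _)
      exact this
    obtain ⟨y, hy⟩ := hZ.nonempty_fixed_point_of_prime_not_dvd_card Y hY
    exact ⟨y.1, congrArg Subtype.val (hy ⟨σ, Subgroup.mem_zpowers σ⟩), y.2⟩
  intro c
  have : c ∈ F := by rw [hF]; trivial
  exact this

variable {M : Type} [Group M] [Fintype M] {A : Type} [Group A] [Finite A] [MulDistribMulAction A M]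
  {p : ℕ}

lemma fixed_of_weight (hp : p.Prime) (hM : ¬ p ∣ Nat.card M) {P E : Subgroup A} (hEP : E ≤ P)
    (hP : IsPGroup p P) {w : Wt M} (hw : idem M w ≠ 0) (hE : ∀ e ∈ E, e • w = w)
    (hnP : ∃ g ∈ P, g • w ≠ w) : ∃ q : M, (∀ e ∈ E, e • q = q) ∧ ∃ g ∈ P, g • q ≠ q := by
  by_contra hcon
  push Not at hcon
  let E0 : Subgroup A := P ⊓ MulAction.stabilizer A w
  have hEE0 : E ≤ E0 := fun e he => ⟨hEP he, hE e he⟩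
  have hlt : E0 < P := by
    refine lt_of_le_of_ne inf_le_left fun h => ?_
    obtain ⟨g, hg, hgw⟩ := hnP
    rw [← h] at hg
    exact hgw hg.2
  obtain ⟨g, hgP, hgE, hgn⟩ := exists_norm hp hP hlt
  have hgw : g • w ≠ w := fun h => hgE ⟨hgP, h⟩
  have hE0 : IsPGroup p E0 := hP.to_le hlt.le
  have fixw : ∀ e ∈ E0, e • w = w := fun e he => he.2
  have fixgw : ∀ e ∈ E0, e • g • w = g • w := by
    intro e he
    have := fixw _ (hgn e he)
    rw [mul_smul, mul_smul, inv_smul_eq_iff] at this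
    exact this
  have hgnz : idem M (g • w) ≠ 0 := (idem_smul_ne g w).2 hw
  have tr : ∀ (u : Wt M), (∀ e ∈ E0, e • u = u) → ∀ e ∈ E0, ∀ x, u (e • x) = u x := by
    intro u hu e he x
    have := congrFun (hu _ (E0.inv_mem he)) x
    rw [wt_smul_apply, inv_inv] at this
    exact this
  have tr2 : ∀ (u : Wt M), (∀ e ∈ E0, e • u = u) → ∀ e ∈ E0, ∀ x, ec u (e • x) = ec u x := by
    intro u hu e he x
    have := ec_smul e⁻¹ u x
    rw [hu _ (E0.inv_mem he), inv_inv] at this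
    exact this.symm
  have cong : ∀ (u : Wt M), idem M u ≠ 0 → (∀ e ∈ E0, e • u = u) → ∃ z, IsIntegral ℤ z ∧
      ∑ x : M, (Fintype.card M : ℂ) ^ 2 * ec u x * w x =
      ∑ x ∈ Finset.univ.filter (fun x : M => ∀ e : E0, e • x = x),
        (Fintype.card M : ℂ) ^ 2 * ec u x * w x + p * z := by
    intro u hu0 hu
    refine orbit_congr hp hE0 Finset.univ (fun _ _ _ => Finset.mem_univ _) _ ?_ ?_
    · intro e x _
      have h1 := tr w fixw e e.2 x
      have h2 := tr2 u hu e e.2 x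
      change (Fintype.card M : ℂ) ^ 2 * ec u ((e : A) • x) * w ((e : A) • x) = _
      rw [h1, h2]
    · intro x _
      exact (ec_integral hu0 x).mul (wt_integral hw x)
  obtain ⟨z1, hz1, e1⟩ := cong w hw fixw
  obtain ⟨z2, hz2, e2⟩ := cong (g • w) hgnz fixgw
  have e3 : ∑ x ∈ Finset.univ.filter (fun x : M => ∀ e : E0, e • x = x),
        (Fintype.card M : ℂ) ^ 2 * ec (g • w) x * w x =
      ∑ x ∈ Finset.univ.filter (fun x : M => ∀ e : E0, e • x = x),
        (Fintype.card M : ℂ) ^ 2 * ec w x * w x := by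
    refine Finset.sum_congr rfl fun x hx => ?_
    have hx' := (Finset.mem_filter.1 hx).2
    have hxg : g⁻¹ • x = x :=
      hcon x (fun e he => hx' ⟨e, hEE0 he⟩) _ (P.inv_mem hgP)
    rw [ec_smul, hxg]
  have r1 := row w w hw
  have r2 := row w (g • w) hw
  rw [if_pos rfl] at r1
  rw [if_neg hgw] at r2
  simp only [mul_assoc] at e1 e2 e3
  rw [← Finset.mul_sum, r1] at e1
  rw [← Finset.mul_sum, r2, e3] at e2
  have key : (((Fintype.card M ^ 3 : ℕ) : ℤ) : ℂ) = ((p : ℤ) : ℂ) * (z1 - z2) := by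
    push_cast
    linear_combination e1 - e2
  have := int_dvd (hz1.sub hz2) key
  have h2 : p ∣ Fintype.card M ^ 3 := by exact_mod_cast this
  apply hM
  rw [Nat.card_eq_fintype_card]
  exact hp.dvd_of_dvd_pow h2

end Coprime

section Coprime2
variable {M : Type} [Group M] [Fintype M] {A : Type} [Group A] [Finite A] [MulDistribMulAction A M]
  {p : ℕ}

lemma weight_of_fixed (hp : p.Prime) (hM : ¬ p ∣ Nat.card M) {P E : Subgroup A} (hEP : E ≤ P)
    (hP : IsPGroup p P) {q : M} (hE : ∀ e ∈ E, e • q = q)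
    (hnP : ∃ g ∈ P, g • q ≠ q) :
    ∃ w : Wt M, idem M w ≠ 0 ∧ (∀ e ∈ E, e • w = w) ∧ ∃ g ∈ P, g • w ≠ w := by
  haveI := Fact.mk hp
  by_contra hcon
  push Not at hcon
  let C : Subgroup M :=
    { carrier := {c | ∀ e ∈ E, e • c = c}
      mul_mem' := by
        intro a b ha hb e he
        rw [smul_mul', ha e he, hb e he]
      one_mem' := fun e _ => smul_one e
      inv_mem' := by
        intro a ha e he
        rw [smul_inv', ha e he] }
  let E0 : Subgroup A :=
    { carrier := {g | g ∈ P ∧ ∀ c ∈ C, g • c = c}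
      mul_mem' := by
        rintro a b ⟨ha, ha'⟩ ⟨hb, hb'⟩
        exact ⟨P.mul_mem ha hb, fun c hc => by rw [mul_smul, hb' c hc, ha' c hc]⟩
      one_mem' := ⟨P.one_mem, fun c _ => one_smul _ c⟩
      inv_mem' := by
        rintro a ⟨ha, ha'⟩
        exact ⟨P.inv_mem ha, fun c hc => by rw [inv_smul_eq_iff, ha' c hc]⟩ }
  have hEE0 : E ≤ E0 := fun e he => ⟨hEP he, fun c hc => hc e he⟩
  have hCE0 : ∀ c, (∀ e ∈ E0, e • c = c) → c ∈ C := fun c hc e he => hc e (hEE0 he)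
  have hlt : E0 < P := by
    refine lt_of_le_of_ne (fun x hx => hx.1) fun h => ?_
    obtain ⟨g, hg, hgw⟩ := hnP
    rw [← h] at hg
    exact hgw (hg.2 q hE)
  obtain ⟨g, hgP, hgE, hgn⟩ := exists_norm hp hP hlt
  have hE0 : IsPGroup p E0 := hP.to_le hlt.le
  have hgC : ∀ c ∈ C, g • c ∈ C := by
    intro c hc
    refine hCE0 _ fun e he => ?_
    have := (hgn e he).2 c hc
    rw [mul_smul, mul_smul, inv_smul_eq_iff] at this
    exact this
  have hgC' : ∀ c ∈ C, g⁻¹ • c ∈ C := by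
    intro c hc
    let φ : C → C := fun c => ⟨g • c.1, hgC c c.2⟩
    have hφ : Function.Injective φ := by
      intro a b hab
      exact Subtype.ext (smul_left_cancel g (congrArg Subtype.val hab))
    obtain ⟨b, hb⟩ := (Finite.injective_iff_surjective.1 hφ) ⟨c, hc⟩
    have : g • b.1 = c := congrArg Subtype.val hb
    rw [← this, inv_smul_smul]
    exact b.2
  have claim : ∀ c ∈ C, ∃ y ∈ C, y * c * y⁻¹ = g • c := by
    intro c hc
    have cong : ∀ c' ∈ C, ∃ z, IsIntegral ℤ z ∧
        ∑ w ∈ (idem M).support, (Fintype.card M : ℂ) ^ 2 * ec w c' * w c =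
        ∑ w ∈ (idem M).support.filter (fun w => ∀ e : E0, e • w = w),
          (Fintype.card M : ℂ) ^ 2 * ec w c' * w c + p * z := by
      intro c' hc'
      refine orbit_congr hp hE0 (idem M).support ?_
        (fun w => (Fintype.card M : ℂ) ^ 2 * ec w c' * w c) ?_ ?_
      · intro e w hw
        rw [Finsupp.mem_support_iff] at hw ⊢
        exact (idem_smul_ne (e : A) w).2 hw
      · intro e w _
        change (Fintype.card M : ℂ) ^ 2 * ec ((e : A) • w) c' * ((e : A) • w) c = _
        rw [ec_smul, wt_smul_apply, (E0.inv_mem e.2).2 c hc, (E0.inv_mem e.2).2 c' hc']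
      · intro w hw
        rw [Finsupp.mem_support_iff] at hw
        exact (ec_integral hw c').mul (wt_integral hw c)
    obtain ⟨z1, hz1, e1⟩ := cong c hc
    obtain ⟨z2, hz2, e2⟩ := cong (g • c) (hgC c hc)
    have e3 : ∑ w ∈ (idem M).support.filter (fun w => ∀ e : E0, e • w = w),
          (Fintype.card M : ℂ) ^ 2 * ec w (g • c) * w c =
        ∑ w ∈ (idem M).support.filter (fun w => ∀ e : E0, e • w = w),
          (Fintype.card M : ℂ) ^ 2 * ec w c * w c := by
      refine Finset.sum_congr rfl fun w hw => ?_
      obtain ⟨h1, h2⟩ := Finset.mem_filter.1 hw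
      rw [Finsupp.mem_support_iff] at h1
      have h3 := hcon w h1 (fun e he => h2 ⟨e, hEE0 he⟩) _ (P.inv_mem hgP)
      have h4 := ec_smul g⁻¹ w c
      rw [h3, inv_inv] at h4
      rw [h4]
    have col1 := column c c
    have col2 := column c (g • c)
    have hcol : ∀ x', ∑ w ∈ (idem M).support, (Fintype.card M : ℂ) ^ 2 * ec w x' * w c =
        (Fintype.card M : ℂ) ^ 2 * ∑ w ∈ (idem M).support, w c * ec w x' := by
      intro x'
      rw [Finset.mul_sum]
      exact Finset.sum_congr rfl fun w _ => by ring
    rw [hcol, col1] at e1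
    rw [hcol, col2, e3] at e2
    set a : ℕ := (Finset.univ.filter fun y : M => y * c * y⁻¹ = c).card with ha
    set b : ℕ := (Finset.univ.filter fun y : M => y * c * y⁻¹ = g • c).card with hb
    have key : (((Fintype.card M : ℤ) ^ 2 * ((a : ℤ) - b) : ℤ) : ℂ) = ((p : ℤ) : ℂ) * (z1 - z2) := by
      push_cast
      linear_combination e1 - e2
    have hd := int_dvd (hz1.sub hz2) key
    have hpI : Prime (p : ℤ) := Nat.prime_iff_prime_int.1 hp
    have hM' : ¬ (p : ℤ) ∣ (Fintype.card M : ℤ) := by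
      rw [← Nat.card_eq_fintype_card]; exact_mod_cast hM
    have hd2 : (p : ℤ) ∣ (a : ℤ) - b :=
      (hpI.dvd_or_dvd hd).resolve_left fun h => hM' (hpI.dvd_of_dvd_pow h)
    have hpa : ¬ p ∣ a := by
      intro h
      apply hM
      have : a = Nat.card (Subgroup.centralizer ({c} : Set M)) := by
        rw [ha, ← Set.ncard_coe_finset, ← Nat.card_coe_set_eq]
        refine Nat.card_congr (Equiv.setCongr ?_)
        ext y
        simp only [Finset.coe_filter, Finset.mem_univ, true_and, Set.mem_ofPred_eq, SetLike.mem_coe,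
          Subgroup.mem_centralizer_singleton_iff]
        rw [mul_inv_eq_iff_eq_mul]
      rw [this] at h
      exact h.trans (Subgroup.card_subgroup_dvd_card _)
    have hpb : ¬ p ∣ b := by
      intro h
      apply hpa
      have : (p : ℤ) ∣ a := by
        have := dvd_add hd2 (Int.natCast_dvd_natCast.2 h)
        simpa using this
      exact_mod_cast this
    let Y : SubMulAction E0 M :=
      { carrier := {y | y * c * y⁻¹ = g • c}
        smul_mem' := by
          intro e y hy
          change ((e : A) • y) * c * ((e : A) • y)⁻¹ = g • c
          have h1 : (e : A) • c = c := e.2.2 c hc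
          have h2 : (e : A) • (g • c) = g • c := e.2.2 _ (hgC c hc)
          nth_rewrite 1 [← h1]
          rw [← smul_inv', ← smul_mul', ← smul_mul', hy, h2] }
    have hY : Nat.card Y = b := by
      have h1 : (Y : Set M) = ↑(Finset.univ.filter fun y : M => y * c * y⁻¹ = g • c) := by
        ext y
        rw [Finset.coe_filter]
        simp only [Finset.mem_univ, true_and]
        exact Iff.rfl
      have : Nat.card Y = (Y : Set M).ncard := rfl
      rw [this, h1, Set.ncard_coe_finset]
    obtain ⟨y, hy⟩ := hE0.nonempty_fixed_point_of_prime_not_dvd_card Y (by rwa [hY])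
    refine ⟨y.1, hCE0 _ fun e he => ?_, y.2⟩
    exact congrArg Subtype.val (hy ⟨e, he⟩)
  let σ : MulAut C :=
    { toFun := fun c => ⟨g • c.1, hgC c c.2⟩
      invFun := fun c => ⟨g⁻¹ • c.1, hgC' c c.2⟩
      left_inv := fun c => Subtype.ext (inv_smul_smul g c.1)
      right_inv := fun c => Subtype.ext (smul_inv_smul g c.1)
      map_mul' := fun a b => Subtype.ext (smul_mul' g a.1 b.1) }
  have hσn : ∀ (n : ℕ) (c : C), ((σ ^ n) c).1 = g ^ n • c.1 := by
    intro n
    induction n with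
    | zero => intro c; simp
    | succ n ih =>
      intro c
      rw [pow_succ, pow_succ, mul_smul]
      exact ih (σ c)
  obtain ⟨k, hk⟩ := hP ⟨g, hgP⟩
  have hk' : g ^ p ^ k = 1 := congrArg Subtype.val hk
  have hσ := conj_fix hp (C := C) (fun h => hM (h.trans (Subgroup.card_subgroup_dvd_card _))) σ k
    (by
      refine MulEquiv.ext fun c => Subtype.ext ?_
      rw [hσn, hk', one_smul]; rfl)
    (by
      intro c
      obtain ⟨y, hy, hyc⟩ := claim c c.2
      exact isConj_iff.2 ⟨⟨y, hy⟩, Subtype.ext hyc⟩)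
  apply hgE
  exact ⟨hgP, fun c hc => congrArg Subtype.val (hσ ⟨c, hc⟩)⟩

end Coprime2

/-! ## p-solvable groups -/
section PSolv
variable {G : Type} [Group G]

/-- `H` normalizes `X` -/
def Nrm (H X : Subgroup G) : Prop := ∀ h ∈ H, ∀ x ∈ X, h * x * h⁻¹ ∈ X

lemma nrm_top {X : Subgroup G} : Nrm ⊤ X ↔ X.Normal :=
  ⟨fun h => ⟨fun x hx g => h g trivial x hx⟩, fun h g _ x hx => h.conj_mem x hx g⟩

lemma Nrm.mono {H K X : Subgroup G} (h : Nrm H X) (hk : K ≤ H) : Nrm K X :=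
  fun k hk' => h k (hk hk')

lemma Nrm.le_normalizer {H X : Subgroup G} (h : Nrm H X) : H ≤ Subgroup.normalizer (X : Set G) := by
  intro g hg
  rw [Subgroup.mem_normalizer_iff]
  intro x
  refine ⟨h g hg x, fun hx => ?_⟩
  have := h g⁻¹ (H.inv_mem hg) _ hx
  simpa [mul_assoc] using this

lemma nrm_of_le_normalizer {H X : Subgroup G} (h : H ≤ Subgroup.normalizer (X : Set G)) : Nrm H X :=
  fun g hg x hx => (Subgroup.mem_normalizer_iff.1 (h hg) x).1 hx

lemma Nrm.sup {H X Y : Subgroup G} (hX : Nrm H X) (hY : Nrm H Y) : Nrm H (X ⊔ Y) :=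
  nrm_of_le_normalizer (le_trans (le_inf hX.le_normalizer hY.le_normalizer)
    (Subgroup.normalizer_inf_normalizer_le_normalizer_sup X Y))

lemma Nrm.inf {H X Y : Subgroup G} (hX : Nrm H X) (hY : Nrm H Y) : Nrm H (X ⊓ Y) :=
  fun h hh x hx => ⟨hX h hh x hx.1, hY h hh x hx.2⟩

lemma Nrm.self (X : Subgroup G) : Nrm X X := fun _ hh _ hx =>
  X.mul_mem (X.mul_mem hh hx) (X.inv_mem hh)

lemma card_sup_normal (X Y : Subgroup G) [X.Normal] :
    Nat.card (X ⊔ Y : Subgroup G) = Nat.card X * X.relIndex Y := by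
  have h := Subgroup.relIndex_mul_relIndex ⊥ X (X ⊔ Y) bot_le le_sup_left
  rw [Subgroup.relIndex_sup_left, Subgroup.relIndex_bot_left, Subgroup.relIndex_bot_left] at h
  exact h.symm

lemma card_sup_dvd {X Y : Subgroup G} (h : Nrm Y X) :
    Nat.card (X ⊔ Y : Subgroup G) ∣ Nat.card X * Nat.card Y := by
  let L := X ⊔ Y
  have hn : Nrm L X := by
    apply nrm_of_le_normalizer
    exact sup_le (Nrm.self X).le_normalizer h.le_normalizer
  haveI : (X.subgroupOf L).Normal :=
    (Subgroup.normal_subgroupOf_iff le_sup_left).2 fun x l hx hl => hn l hl x hx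
  have h1 := card_sup_normal (X.subgroupOf L) (Y.subgroupOf L)
  rw [← Subgroup.subgroupOf_sup le_sup_left le_sup_right] at h1
  have e : ∀ Z : Subgroup G, Z ≤ L → Nat.card (Z.subgroupOf L) = Nat.card Z := fun Z hZ =>
    Nat.card_congr (Subgroup.subgroupOfEquivOfLe hZ).toEquiv
  rw [e _ le_rfl, e _ le_sup_left] at h1
  change Nat.card L ∣ _
  rw [h1]
  refine mul_dvd_mul_left _ ?_
  rw [← e _ le_sup_right]
  exact Subgroup.relIndex_dvd_card _ _

/-- conjugate subgroup -/
def cj (g : G) (X : Subgroup G) : Subgroup G := X.map (MulAut.conj g).toMonoidHom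

lemma mem_cj {g x : G} {X : Subgroup G} : x ∈ cj g X ↔ g⁻¹ * x * g ∈ X := by
  constructor
  · rintro ⟨y, hy, rfl⟩
    have : g⁻¹ * (g * y * g⁻¹) * g = y := by group
    change g⁻¹ * (g * y * g⁻¹) * g ∈ X
    rwa [this]
  · intro h
    refine ⟨_, h, ?_⟩
    change g * (g⁻¹ * x * g) * g⁻¹ = x
    group

lemma card_cj (g : G) (X : Subgroup G) : Nat.card (cj g X) = Nat.card X :=
  Nat.card_congr (X.equivMapOfInjective _ (MulAut.conj g).injective).toEquiv.symm

lemma exists_greatest [Finite G] (π : ℕ → Prop) (h1 : π 1) (hmul : ∀ a b, π a → π b → π (a * b))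
    (hdvd : ∀ a b, a ∣ b → π b → π a) (H : Subgroup G) :
    ∃ X ≤ H, Nrm H X ∧ π (Nat.card X) ∧ ∀ Y ≤ H, Nrm H Y → π (Nat.card Y) → Y ≤ X := by
  let S : Set (Subgroup G) := {X | X ≤ H ∧ Nrm H X ∧ π (Nat.card X)}
  have hS : S.Nonempty := ⟨⊥, bot_le, fun h _ x hx => by
    rw [Subgroup.mem_bot] at hx ⊢; simp [hx], by simpa using h1⟩
  obtain ⟨X, hX, hmax⟩ := Set.exists_max_image S (fun X => Nat.card X) (Set.toFinite S) hS
  refine ⟨X, hX.1, hX.2.1, hX.2.2, fun Y hY1 hY2 hY3 => ?_⟩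
  have hsup : X ⊔ Y ∈ S := ⟨sup_le hX.1 hY1, hX.2.1.sup hY2,
    hdvd _ _ (card_sup_dvd (hX.2.1.mono hY1)) (hmul _ _ hX.2.2 hY3)⟩
  have := hmax _ hsup
  have e : X = X ⊔ Y := Subgroup.eq_of_le_of_card_ge le_sup_left this
  rw [e]; exact le_sup_right

lemma nrm_greatest {π : ℕ → Prop} {H K X : Subgroup G} (hK : Nrm K H)
    (h1 : X ≤ H) (h2 : Nrm H X) (h3 : π (Nat.card X))
    (h4 : ∀ Y ≤ H, Nrm H Y → π (Nat.card Y) → Y ≤ X) : Nrm K X := by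
  intro k hk x hx
  refine h4 (cj k X) ?_ ?_ ?_ ?_
  · intro y hy
    have := hK k hk _ (h1 (mem_cj.1 hy))
    simpa [mul_assoc] using this
  · intro h hh y hy
    rw [mem_cj] at hy ⊢
    have e : k⁻¹ * (h * y * h⁻¹) * k = (k⁻¹ * h * k) * (k⁻¹ * y * k) * (k⁻¹ * h * k)⁻¹ := by group
    rw [e]
    refine h2 _ ?_ _ hy
    have := hK k⁻¹ (K.inv_mem hk) h hh
    simpa using this
  · rw [card_cj]; exact h3
  · rw [mem_cj]
    have : k⁻¹ * (k * x * k⁻¹) * k = x := by group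
    rwa [this]

lemma card_pGroup [Finite G] {p : ℕ} (hp : p.Prime) (X : Subgroup G) :
    IsPGroup p X ↔ ∃ k, Nat.card X = p ^ k := by
  haveI := Fact.mk hp
  exact IsPGroup.iff_card

lemma pPrime_of_elts [Finite G] {p : ℕ} (hp : p.Prime) (X : Subgroup G)
    (h : ∀ x ∈ X, ∃ m : ℕ, Nat.Coprime m p ∧ x ^ m = 1) : ¬ p ∣ Nat.card X := by
  haveI := Fact.mk hp
  intro hd
  obtain ⟨x, hx⟩ := exists_prime_orderOf_dvd_card' p hd
  obtain ⟨m, hm, hxm⟩ := h x x.2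
  have h1 : x ^ m = 1 := Subtype.ext hxm
  have h2 := orderOf_dvd_of_pow_eq_one h1
  rw [hx] at h2
  exact hp.one_lt.ne' (Nat.Coprime.eq_one_of_dvd hm.symm h2)

lemma elts_of_pPrime [Finite G] {p : ℕ} (hp : p.Prime) (X : Subgroup G)
    (h : ¬ p ∣ Nat.card X) : ∀ x ∈ X, ∃ m : ℕ, Nat.Coprime m p ∧ x ^ m = 1 := by
  intro x hx
  refine ⟨Nat.card X, ((Nat.Prime.coprime_iff_not_dvd hp).2 h).symm, ?_⟩
  exact congrArg Subtype.val (pow_card_eq_one' (x := (⟨x, hx⟩ : X)))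

/-- p-solvable groups have normal p- or p'-subgroups -/
lemma exists_normal_sub [Finite G] {p : ℕ} (hp : p.Prime) (hG : IsPSolvable p G) (K : Subgroup G)
    (hK : K.Normal) (hne : K ≠ ⊥) :
    ∃ N ≤ K, N.Normal ∧ N ≠ ⊥ ∧ (IsPGroup p N ∨ ¬ p ∣ Nat.card N) := by
  obtain ⟨n, s, h0, h1, hs⟩ := hG
  have step : ∀ (π : ℕ → Prop), π 1 → (∀ a b, π a → π b → π (a * b)) →
      (∀ a b, a ∣ b → π b → π a) → ∀ H L : Subgroup G, H ≤ L → Nrm L H →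
      (∃ B ≤ H, B ≠ ⊥ ∧ Nrm H B ∧ π (Nat.card B)) → (∃ B ≤ L, B ≠ ⊥ ∧ Nrm L B ∧ π (Nat.card B)) := by
    intro π p1 p2 p3 H L hHL hL ⟨B, b1, b2, b3, b4⟩
    obtain ⟨X, x1, x2, x3, x4⟩ := exists_greatest π p1 p2 p3 H
    refine ⟨X, x1.trans hHL, fun h => b2 ?_, nrm_greatest hL x1 x2 x3 x4, x3⟩
    have := x4 B b1 b3 b4
    rw [h] at this
    exact le_bot_iff.1 this
  let Q : Subgroup G → Prop := fun H =>
    (∃ B ≤ H, B ≠ ⊥ ∧ Nrm H B ∧ (∃ k, Nat.card B = p ^ k)) ∨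
    (∃ B ≤ H, B ≠ ⊥ ∧ Nrm H B ∧ ¬ p ∣ Nat.card B)
  have stepQ : ∀ H L : Subgroup G, H ≤ L → Nrm L H → Q H → Q L := by
    rintro H L hHL hL (h | h)
    · left
      refine step (fun n => ∃ k, n = p ^ k) ⟨0, by simp⟩ ?_ ?_ H L hHL hL h
      · rintro a b ⟨k, rfl⟩ ⟨l, rfl⟩
        exact ⟨k + l, (pow_add _ _ _).symm⟩
      · rintro a b hab ⟨l, rfl⟩
        obtain ⟨k, -, hk⟩ := (Nat.dvd_prime_pow hp).1 hab
        exact ⟨k, hk⟩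
    · right
      refine step (fun n => ¬ p ∣ n) ?_ ?_ ?_ H L hHL hL h
      · exact fun h => hp.one_lt.ne' (Nat.dvd_one.1 h)
      · intro a b ha hb h
        exact ((Nat.Prime.dvd_mul hp).1 h).elim ha hb
      · intro a b hab hb h
        exact hb (h.trans hab)
  have main : ∀ i : Fin (n + 1), s i ⊓ K ≠ ⊥ → Q (s i ⊓ K) := by
    intro i
    induction i using Fin.induction with
    | zero => intro h; exact absurd (by rw [h0]; simp) h
    | succ i ih =>
      intro hne'
      obtain ⟨hle, hnorm, hel⟩ := hs i
      by_cases hb : s i.castSucc ⊓ K = ⊥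
      · have hb' : ∀ x, x ∈ s i.castSucc → x ∈ K → x = 1 := fun x h1 h2 => by
          have : x ∈ s i.castSucc ⊓ K := ⟨h1, h2⟩
          rwa [hb, Subgroup.mem_bot] at this
        rcases hel with hel | hel
        · left
          refine ⟨_, le_rfl, hne', Nrm.self _, ?_⟩
          rw [← card_pGroup hp]
          rintro ⟨x, hx⟩
          obtain ⟨k, hk⟩ := hel x hx.1
          exact ⟨k, Subtype.ext (hb' _ hk (K.pow_mem hx.2 _))⟩
        · right
          refine ⟨_, le_rfl, hne', Nrm.self _, pPrime_of_elts hp _ ?_⟩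
          intro x hx
          obtain ⟨k, hk1, hk⟩ := hel x hx.1
          exact ⟨k, hk1, hb' _ hk (K.pow_mem hx.2 _)⟩
      · refine stepQ _ _ (inf_le_inf_right K hle) ?_ (ih hb)
        rintro h ⟨hh1, hh2⟩ x ⟨hx1, hx2⟩
        exact ⟨(Subgroup.normal_subgroupOf_iff hle).1 hnorm x h hx1 hh1, hK.conj_mem x hx2 h⟩
  have hlast := main (Fin.last n) (by rw [h1]; simpa using hne)
  rw [h1, top_inf_eq] at hlast
  have hKK : Nrm ⊤ K := nrm_top.2 hK
  rcases hlast with ⟨B, b1, b2, b3, b4⟩ | ⟨B, b1, b2, b3, b4⟩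
  · obtain ⟨X, x1, x2, x3, x4⟩ := exists_greatest (fun n => ∃ k, n = p ^ k) ⟨0, by simp⟩ (by
      rintro a b ⟨k, rfl⟩ ⟨l, rfl⟩
      exact ⟨k + l, (pow_add _ _ _).symm⟩) (by
      rintro a b hab ⟨l, rfl⟩
      obtain ⟨k, -, hk⟩ := (Nat.dvd_prime_pow hp).1 hab
      exact ⟨k, hk⟩) K
    refine ⟨X, x1, nrm_top.1 (nrm_greatest (π := fun n => ∃ k, n = p ^ k) hKK x1 x2 x3 x4),
      fun h => b2 ?_, Or.inl ?_⟩
    · have := x4 B b1 b3 b4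
      rw [h] at this
      exact le_bot_iff.1 this
    · rwa [card_pGroup hp]
  · obtain ⟨X, x1, x2, x3, x4⟩ := exists_greatest (fun n => ¬ p ∣ n)
      (fun h => hp.one_lt.ne' (Nat.dvd_one.1 h))
      (fun a b ha hb h => ((Nat.Prime.dvd_mul hp).1 h).elim ha hb)
      (fun a b hab hb h => hb (h.trans hab)) K
    refine ⟨X, x1, nrm_top.1 (nrm_greatest (π := fun n => ¬ p ∣ n) hKK x1 x2 x3 x4),
      fun h => b2 ?_, Or.inr x3⟩
    have := x4 B b1 b3 b4
    rw [h] at this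
    exact le_bot_iff.1 this

lemma IsPSolvable.comap {G' : Type} [Group G'] {p : ℕ} (hG : IsPSolvable p G) (f : G' →* G)
    (hf : ∀ x, f x = 1 → ∃ m : ℕ, Nat.Coprime m p ∧ x ^ m = 1) : IsPSolvable p G' := by
  obtain ⟨n, s, h0, h1, hs⟩ := hG
  refine ⟨n + 1, Fin.cons ⊥ (fun i => (s i).comap f), Fin.cons_zero _ _, ?_, ?_⟩
  · rw [← Fin.succ_last, Fin.cons_succ, h1, Subgroup.comap_top]
  · intro i
    refine Fin.cases ?_ (fun j => ?_) i
    · rw [Fin.castSucc_zero, Fin.cons_zero, Fin.cons_succ, h0]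
      refine ⟨bot_le, ?_, Or.inr ?_⟩
      · exact (Subgroup.normal_subgroupOf_iff bot_le).2 fun x k hx _ => by
          rw [Subgroup.mem_bot] at hx ⊢; simp [hx]
      · intro x hx
        obtain ⟨m, hm, hm'⟩ := hf x hx
        exact ⟨m, hm, hm'⟩
    · rw [← Fin.succ_castSucc, Fin.cons_succ, Fin.cons_succ]
      obtain ⟨hle, hnorm, hel⟩ := hs j
      refine ⟨Subgroup.comap_mono hle, ?_, ?_⟩
      · refine (Subgroup.normal_subgroupOf_iff (Subgroup.comap_mono hle)).2 fun x k hx hk => ?_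
        have := (Subgroup.normal_subgroupOf_iff hle).1 hnorm (f x) (f k) hx hk
        rw [Subgroup.mem_comap]
        simpa using this
      · refine hel.imp ?_ ?_
        · intro h x hx
          obtain ⟨k, hk⟩ := h (f x) hx
          exact ⟨k, by rw [Subgroup.mem_comap]; simpa using hk⟩
        · intro h x hx
          obtain ⟨k, hk, hk'⟩ := h (f x) hx
          exact ⟨k, hk, by rw [Subgroup.mem_comap]; simpa using hk'⟩

lemma IsPSolvable.sub {p : ℕ} (hG : IsPSolvable p G) (H : Subgroup G) : IsPSolvable p H :=
  hG.comap H.subtype fun x hx => ⟨1, Nat.coprime_one_left p, by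
    rw [pow_one]; exact Subtype.ext hx⟩

lemma IsPSolvable.map {G' : Type} [Group G'] {p : ℕ} (hG : IsPSolvable p G) (f : G →* G')
    (hf : Function.Surjective f) : IsPSolvable p G' := by
  obtain ⟨n, s, h0, h1, hs⟩ := hG
  refine ⟨n, fun i => (s i).map f, by simp [h0], ?_, ?_⟩
  · beta_reduce
    rw [h1, ← MonoidHom.range_eq_map, MonoidHom.range_eq_top.2 hf]
  · intro i
    obtain ⟨hle, hnorm, hel⟩ := hs i
    refine ⟨Subgroup.map_mono hle, ?_, ?_⟩
    · refine (Subgroup.normal_subgroupOf_iff (Subgroup.map_mono hle)).2 ?_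
      rintro _ _ ⟨x, hx, rfl⟩ ⟨k, hk, rfl⟩
      exact ⟨_, (Subgroup.normal_subgroupOf_iff hle).1 hnorm x k hx hk, by simp⟩
    · refine hel.imp ?_ ?_
      · rintro h _ ⟨x, hx, rfl⟩
        obtain ⟨k, hk⟩ := h x hx
        exact ⟨k, _, hk, by simp⟩
      · rintro h _ ⟨x, hx, rfl⟩
        obtain ⟨k, hk, hk'⟩ := h x hx
        exact ⟨k, hk, _, hk', by simp⟩

lemma IsPSolvable.quot {p : ℕ} (hG : IsPSolvable p G) (N : Subgroup G) [N.Normal] :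
    IsPSolvable p (G ⧸ N) := hG.map (QuotientGroup.mk' N) (QuotientGroup.mk'_surjective N)

end PSolv

section HH
variable {G : Type} [Group G] [Finite G] {p : ℕ}

/-- Hall-Higman Lemma 1.2.3 -/
lemma hall_higman (hp : p.Prime) (hG : IsPSolvable p G)
    (hO : ∀ N : Subgroup G, N.Normal → ¬ p ∣ Nat.card N → N = ⊥)
    (N : Subgroup G) (hN : N.Normal) (hNp : IsPGroup p N)
    (hmax : ∀ X : Subgroup G, X.Normal → IsPGroup p X → X ≤ N) :
    Subgroup.centralizer (N : Set G) ≤ N := by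
  haveI := Fact.mk hp
  by_contra hCN
  let C := Subgroup.centralizer (N : Set G)
  have hCn : C.Normal := inferInstance
  let f := QuotientGroup.mk' N
  have hf : Function.Surjective f := QuotientGroup.mk'_surjective N
  have hker : ∀ x, f x = 1 ↔ x ∈ N := fun x => QuotientGroup.eq_one_iff x
  have hCb : (C.map f).Normal := hCn.map f hf
  have hne : C.map f ≠ ⊥ := by
    intro h
    apply hCN
    intro x hx
    rw [← hker]
    have : f x ∈ C.map f := ⟨x, hx, rfl⟩
    rwa [h, Subgroup.mem_bot] at this
  obtain ⟨B, hBC, hBn, hB0, hB⟩ := exists_normal_sub hp (hG.quot N) _ hCb hne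
  have hDn : (B.comap f).Normal := hBn.comap f
  have hND : N ≤ B.comap f := by
    intro x hx
    rw [Subgroup.mem_comap, (hker x).2 hx]; exact B.one_mem
  rcases hB with hB | hB
  · apply hB0
    have h1 : IsPGroup p (B.comap f) := hB.comap_of_ker_isPGroup f (by
      rw [QuotientGroup.ker_mk']; exact hNp)
    have h2 := hmax _ hDn h1
    rw [eq_bot_iff]
    intro y hy
    obtain ⟨x, rfl⟩ := hf y
    exact (hker x).2 (h2 hy)
  · let D : Subgroup G := B.comap f ⊓ C
    have hD : D.Normal := inferInstance
    have hDN : ¬ D ≤ N := by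
      intro h
      apply hB0
      rw [eq_bot_iff]
      intro y hy
      obtain ⟨c, hc, rfl⟩ := hBC hy
      exact (hker c).2 (h ⟨hy, hc⟩)
    let Z : Subgroup D := N.subgroupOf D
    haveI : Z.Normal := inferInstance
    have hZc : ∀ z ∈ Z, ∀ d : D, d * z = z * d := by
      intro z hz d
      have h1 := Subgroup.mem_centralizer_iff.1 d.2.2 z (Subgroup.mem_subgroupOf.1 hz)
      exact Subtype.ext h1.symm
    have hidx : ¬ p ∣ Z.index := by
      have := pPrime_of_elts hp (⊤ : Subgroup (D ⧸ Z)) (by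
        intro x _
        obtain ⟨d, rfl⟩ := QuotientGroup.mk_surjective x
        obtain ⟨m, hm, h⟩ := elts_of_pPrime hp B hB (f d) d.2.1
        refine ⟨m, hm, ?_⟩
        rw [← QuotientGroup.mk_pow, QuotientGroup.eq_one_iff, Subgroup.mem_subgroupOf, ← hker]
        simpa using h)
      rwa [Subgroup.card_top] at this
    have hZp : IsPGroup p Z := by
      have : IsPGroup p (N.comap D.subtype) := hNp.comap_subtype
      exact this
    have hcop : Nat.Coprime (Nat.card Z) Z.index := by
      obtain ⟨k, hk⟩ := IsPGroup.iff_card.1 hZp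
      rw [hk]
      exact Nat.Coprime.pow_left _ ((Nat.Prime.coprime_iff_not_dvd hp).2 hidx)
    obtain ⟨H, hH⟩ := Subgroup.exists_right_complement'_of_coprime hcop
    have hHcard : Nat.card H = Z.index := (hH.symm.index_eq_card).symm
    have hHn : H.Normal := by
      constructor
      intro k hk d
      obtain ⟨⟨⟨z, hz⟩, ⟨h, hh⟩⟩, hzh⟩ := hH.2 d
      have : z * h = d := hzh
      rw [← this]
      have e : z * h * k * (z * h)⁻¹ = z * (h * k * h⁻¹) * z⁻¹ := by group
      rw [e, ← hZc z hz, mul_inv_cancel_right]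
      exact H.mul_mem (H.mul_mem hh hk) (H.inv_mem hh)
    obtain ⟨X, x1, x2, x3, x4⟩ := exists_greatest (fun n => ¬ p ∣ n)
      (fun h => hp.one_lt.ne' (Nat.dvd_one.1 h))
      (fun a b ha hb h => ((Nat.Prime.dvd_mul hp).1 h).elim ha hb)
      (fun a b hab hb h => hb (h.trans hab)) D
    have hXn := nrm_top.1 (nrm_greatest (π := fun n => ¬ p ∣ n) (nrm_top.2 hD) x1 x2 x3 x4)
    have hX0 := hO X hXn x3
    have hHX : H.map D.subtype ≤ X := by
      apply x4
      · rintro _ ⟨x, _, rfl⟩; exact x.2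
      · rintro d hd _ ⟨x, hx, rfl⟩
        exact ⟨_, hHn.conj_mem x hx ⟨d, hd⟩, rfl⟩
      · rw [← Nat.card_congr (H.equivMapOfInjective _ D.subtype_injective).toEquiv, hHcard]
        exact hidx
    rw [hX0, le_bot_iff, Subgroup.map_eq_bot_iff_of_injective _ D.subtype_injective] at hHX
    rw [hHX, Subgroup.card_bot] at hHcard
    have hZt := Subgroup.index_eq_one.1 hHcard.symm
    exact hDN (Subgroup.subgroupOf_eq_top.1 hZt)

end HH

section Syl
variable {G : Type} [Group G] [Finite G] {p : ℕ}

lemma syl_card (hp : p.Prime) (P : Sylow p G) : Nat.card P = p ^ (Nat.card G).factorization p := by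
  haveI := Fact.mk hp
  exact P.card_eq_multiplicity

lemma exists_syl_between (hp : p.Prime) (H E : Subgroup G) (hEH : E ≤ H) (hE : IsPGroup p E)
    (hi : ¬ p ∣ H.index) : ∃ R : Sylow p G, E ≤ R ∧ (R : Subgroup G) ≤ H := by
  haveI := Fact.mk hp
  obtain ⟨S, hS⟩ := (hE.comap_subtype (K := H)).exists_le_sylow
  have hc : Nat.card ((S : Subgroup H).map H.subtype) = p ^ (Nat.card G).factorization p := by
    rw [Nat.card_congr ((S : Subgroup H).equivMapOfInjective _ H.subtype_injective).toEquiv.symm]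
    have := syl_card hp S
    rw [this, ← H.card_mul_index, Nat.factorization_mul Nat.card_pos.ne' H.index_ne_zero_of_finite]
    simp [Nat.factorization_eq_zero_of_not_dvd hi]
  refine ⟨Sylow.ofCard _ hc, ?_, ?_⟩
  · intro x hx
    exact ⟨⟨x, hEH hx⟩, hS (by simpa [Subgroup.mem_subgroupOf] using hx), rfl⟩
  · rintro _ ⟨y, _, rfl⟩
    exact y.2

/-- Sylow subgroups of a subgroup -/
lemma exists_syl_sub (hp : p.Prime) (H : Subgroup G) : ∃ E ≤ H, IsPGroup p E ∧
    Nat.card E = p ^ (Nat.card H).factorization p ∧ ∃ P : Sylow p G, E ≤ P := by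
  haveI := Fact.mk hp
  obtain ⟨S⟩ : Nonempty (Sylow p H) := inferInstance
  have h1 : IsPGroup p ((S : Subgroup H).map H.subtype) := S.2.map _
  refine ⟨(S : Subgroup H).map H.subtype, ?_, h1, ?_, h1.exists_le_sylow⟩
  · rintro _ ⟨y, _, rfl⟩
    exact y.2
  · rw [Nat.card_congr ((S : Subgroup H).equivMapOfInjective _ H.subtype_injective).toEquiv.symm]
    exact syl_card hp S

lemma card_map_mul {G' : Type} [Group G'] (f : G →* G') (X : Subgroup G) :
    Nat.card (X.map f) * Nat.card (X ⊓ f.ker : Subgroup G) = Nat.card X := by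
  have h := Subgroup.card_mul_index ((f.comp X.subtype).ker)
  rw [Subgroup.index_ker] at h
  have h1 : (f.comp X.subtype).range = X.map f := by
    rw [MonoidHom.range_comp, Subgroup.range_subtype]
  have h2 : Nat.card (f.comp X.subtype).ker = Nat.card (X ⊓ f.ker : Subgroup G) := by
    rw [← Nat.card_congr (((f.comp X.subtype).ker).equivMapOfInjective _ X.subtype_injective).toEquiv.symm]
    congr 2
    ext x
    simp [Subgroup.mem_map, MonoidHom.mem_ker, and_comm]
  rw [h1, h2] at h
  rw [mul_comm]; exact h

lemma map_syl {G' : Type} [Group G'] (hp : p.Prime) (f : G →* G') (hf : Function.Surjective f) (P : Sylow p G) :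
    ∃ P' : Sylow p G', (P' : Subgroup G') = (P : Subgroup G).map f := by
  haveI := Fact.mk hp
  haveI : Finite G' := Finite.of_surjective f hf
  exact ⟨P.mapSurjective hf, rfl⟩

lemma le_of_map_le {G' : Type} [Group G'] (f : G →* G') {P R : Subgroup G}
    (h : P.map f ≤ R.map f) : P ≤ R ⊔ f.ker := by
  intro x hx
  obtain ⟨y, hy, hxy⟩ := h ⟨x, hx, rfl⟩
  have : x = y * (y⁻¹ * x) := by group
  rw [this]
  refine Subgroup.mul_mem_sup hy ?_
  rw [MonoidHom.mem_ker, map_mul, map_inv, hxy]; simp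

lemma conj_of_le {P R : Sylow p G} (hp : p.Prime) {Q : Subgroup G} (hQ : Q.Normal)
    (h : (R : Subgroup G) ≤ (P : Subgroup G) ⊔ Q) : ∃ q ∈ Q, ∀ x, x ∈ (R : Subgroup G) ↔ q⁻¹ * x * q ∈ (P : Subgroup G) := by
  haveI := Fact.mk hp
  let J := (P : Subgroup G) ⊔ Q
  have hP : (P : Subgroup G) ≤ J := le_sup_left
  obtain ⟨g, hg⟩ := MulAction.exists_smul_eq J (P.subtype hP) (R.subtype h)
  have hgJ : (g : G) ∈ (P : Subgroup G) ⊔ Q := g.2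
  rw [sup_comm, Subgroup.mem_sup_of_normal_left] at hgJ
  obtain ⟨q, hq, y, hy, hqy⟩ := hgJ
  refine ⟨q, hq, fun x => ?_⟩
  have key : ∀ x : J, x ∈ R.subtype h ↔ g⁻¹ * x * g ∈ P.subtype hP := by
    intro x
    rw [← hg]
    change x ∈ ((g • P.subtype hP : Sylow p J) : Subgroup J) ↔ _
    rw [Sylow.coe_subgroup_smul, Subgroup.mem_pointwise_smul_iff_inv_smul_mem]
    rw [← map_inv, MulAut.smul_def, MulAut.conj_apply, inv_inv]
    rfl
  have hJ : x ∈ J ↔ q⁻¹ * x * q ∈ J := by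
    have hqJ : q ∈ J := Subgroup.mem_sup_right hq
    constructor
    · intro hx; exact J.mul_mem (J.mul_mem (J.inv_mem hqJ) hx) hqJ
    · intro hx
      have := J.mul_mem (J.mul_mem hqJ hx) (J.inv_mem hqJ)
      simpa [mul_assoc] using this
  have e : q⁻¹ * x * q = y * ((g : G)⁻¹ * x * g) * y⁻¹ := by rw [← hqy]; group
  have e2 : ((g : G)⁻¹ * x * g) = y⁻¹ * (q⁻¹ * x * q) * y := by rw [← hqy]; group
  constructor
  · intro hx
    have := (key ⟨x, h hx⟩).1 hx
    have h3 : (g : G)⁻¹ * x * g ∈ (P : Subgroup G) := this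
    rw [e]
    exact P.mul_mem (P.mul_mem hy h3) (P.inv_mem hy)
  · intro hx
    have hxJ := hJ.2 (hP hx)
    have h3 : (g : G)⁻¹ * x * g ∈ (P : Subgroup G) := by
      rw [e2]; exact P.mul_mem (P.mul_mem (P.inv_mem hy) hx) hy
    exact (key ⟨x, hxJ⟩).2 h3

lemma inf_bot_of_pPrime (hp : p.Prime) {P Q : Subgroup G} (hP : IsPGroup p P) (hQ : ¬ p ∣ Nat.card Q)
    {x : G} (h1 : x ∈ P) (h2 : x ∈ Q) : x = 1 := by
  obtain ⟨k, hk⟩ := hP ⟨x, h1⟩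
  have hk' : x ^ p ^ k = 1 := congrArg Subtype.val hk
  obtain ⟨m, hm, hxm⟩ := elts_of_pPrime hp Q hQ x h2
  have := Nat.dvd_gcd (orderOf_dvd_of_pow_eq_one hk') (orderOf_dvd_of_pow_eq_one hxm)
  rw [Nat.Coprime.gcd_eq_one (Nat.Coprime.pow_left k hm.symm)] at this
  exact orderOf_eq_one_iff.1 (Nat.dvd_one.1 this)

end Syl

section Conj
variable {G : Type} [Group G]

instance conjNAct (N : Subgroup G) [N.Normal] : MulDistribMulAction G N :=
  MulDistribMulAction.compHom N (MulAut.conjNormal : G →* MulAut N)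

lemma conjN_coe (N : Subgroup G) [N.Normal] (g : G) (x : N) : ((g • x : N) : G) = g * x * g⁻¹ := rfl

lemma conjN_fix (N : Subgroup G) [N.Normal] (g : G) (x : N) : g • x = x ↔ g * x = x * g := by
  rw [Subtype.ext_iff, conjN_coe, mul_inv_eq_iff_eq_mul]

variable [Fintype G] {V : Type} [AddCommGroup V] [Module ℂ V]

lemma equivar_csum (N : Subgroup G) [N.Normal] (ρ : Representation ℂ G V) (H : Subgroup G) :
    Equivar ρ H (fun x : N => csum (ρ.comp N.subtype : Representation ℂ N V) x) := by
  intro g _ x v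
  simp only [csum, LinearMap.sum_apply, map_sum]
  refine Fintype.sum_equiv (MulDistribMulAction.toMulEquiv N g).toEquiv _ _ (fun y => ?_)
  simp only [MonoidHom.comp_apply, Subgroup.coe_subtype, Subgroup.coe_mul, Subgroup.coe_inv]
  rw [← Module.End.mul_apply, ← Module.End.mul_apply, ← map_mul, ← map_mul]
  congr 2
  change g * _ = (↑(g • y : N) * ↑(g • x : N) * (↑(g • y : N))⁻¹) * g
  rw [conjN_coe, conjN_coe]
  group

lemma le_stab (N : Subgroup G) [N.Normal] {w : Wt N} (hw : idem N w ≠ 0) :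
    N ≤ MulAction.stabilizer G w := by
  intro m hm
  rw [MulAction.mem_stabilizer_iff]
  funext x
  rw [wt_smul_apply]
  have := wt_conj hw (⟨m, hm⟩⁻¹ : N) x
  rw [← this]
  congr 1

lemma idem_apply_mem {M : Type} [Group M] [Fintype M] (ρ : Representation ℂ M V) (w : Wt M) (v : V) :
    ρ.asAlgebraHom (idem M w) v ∈ eig (csum ρ) w := by
  intro x
  rw [csum_eq, ← Module.End.mul_apply, ← map_mul, cs_mul_idem, map_smul, LinearMap.smul_apply]

end Conj

section Ideal
variable {G : Type} [Group G] [Fintype G] {p : ℕ}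

/-- the idempotent of a weight, in the group algebra of `G` -/
def eG (Q : Subgroup G) (w : Wt Q) : MonoidAlgebra ℂ G :=
  ∑ x : Q, ec w x • MonoidAlgebra.single (x : G) 1

/-- inclusion of group algebras -/
def iG (Q : Subgroup G) : MonoidAlgebra ℂ Q →ₐ[ℂ] MonoidAlgebra ℂ G :=
  MonoidAlgebra.mapDomainAlgHom ℂ ℂ Q.subtype

lemma iG_idem (Q : Subgroup G) (w : Wt Q) : iG Q (idem Q w) = eG Q w := by
  conv_lhs => rw [alg_sum (idem Q w)]
  rw [map_sum]
  refine Finset.sum_congr rfl fun x _ => ?_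
  rw [map_smul]
  simp [iG, ec]

lemma eG_idem (Q : Subgroup G) (w : Wt Q) : eG Q w * eG Q w = eG Q w := by
  rw [← iG_idem, ← map_mul, idem_mul, if_pos rfl]

lemma eG_apply (Q : Subgroup G) (w : Wt Q) (a : MonoidAlgebra ℂ G) :
    Representation.asAlgebraHom ((lreg G).comp Q.subtype : Representation ℂ Q _) (idem Q w) a = eG Q w * a := by
  conv_lhs => rw [alg_sum (idem Q w)]
  rw [map_sum, LinearMap.sum_apply, eG, Finset.sum_mul]
  refine Finset.sum_congr rfl fun x _ => ?_
  rw [map_smul, LinearMap.smul_apply, Representation.asAlgebraHom_single, one_smul, smul_mul_assoc]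
  rfl

lemma eG_coeff (Q : Subgroup G) (w : Wt Q) (g : G) :
    (eG Q w).coeff g = if h : g ∈ Q then ec w ⟨g, h⟩ else 0 := by
  rw [eG, MonoidAlgebra.coeff_sum, Finsupp.finsetSum_apply]
  simp only [MonoidAlgebra.coeff_smul, MonoidAlgebra.coeff_single, Finsupp.smul_apply,
    Finsupp.single_apply]
  split_ifs with h
  · rw [Finset.sum_eq_single ⟨g, h⟩]
    · simp
    · intro b _ hb
      rw [if_neg]
      · simp
      · intro h'; exact hb (Subtype.ext h')
    · simp
  · refine Finset.sum_eq_zero fun x _ => ?_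
    rw [if_neg]
    · simp
    · rintro rfl; exact h x.2

lemma eG_conj (Q : Subgroup G) [Q.Normal] (w : Wt Q) (g : G) (hg : g • w = w) :
    MonoidAlgebra.single g 1 * eG Q w = eG Q w * MonoidAlgebra.single g 1 := by
  simp only [eG, Finset.mul_sum, Finset.sum_mul]
  refine Fintype.sum_equiv (MulDistribMulAction.toMulEquiv Q g).toEquiv _ _ (fun x => ?_)
  change _ = ec w (g • x) • MonoidAlgebra.single ((g • x : Q) : G) 1 * _
  have h1 : ec w (g • x) = ec w x := by
    have := ec_smul g w (g • x)
    rw [hg, inv_smul_smul] at this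
    exact this
  rw [h1, mul_smul_comm, smul_mul_assoc, MonoidAlgebra.single_mul_single,
    MonoidAlgebra.single_mul_single, conjN_coe]
  congr 2
  group

/-- averaging idempotent -/
def aG (E : Subgroup G) : MonoidAlgebra ℂ G :=
  (Fintype.card E : ℂ)⁻¹ • ∑ e : E, MonoidAlgebra.single (e : G) 1

lemma aG_mul (E : Subgroup G) (e : E) : MonoidAlgebra.single (e : G) 1 * aG E = aG E := by
  rw [aG, mul_smul_comm, Finset.mul_sum]
  congr 1
  refine Fintype.sum_equiv (Equiv.mulLeft e) _ _ (fun x => ?_)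
  simp [MonoidAlgebra.single_mul_single]

lemma aG_idem (E : Subgroup G) : aG E * aG E = aG E := by
  nth_rewrite 1 [aG]
  rw [smul_mul_assoc, Finset.sum_mul]
  simp only [aG_mul]
  rw [Finset.sum_const, Finset.card_univ, ← Nat.cast_smul_eq_nsmul ℂ, smul_smul, inv_mul_cancel₀,
    one_smul]
  exact Nat.cast_ne_zero.2 Fintype.card_ne_zero

lemma coeff_one_mul_comm (a b : MonoidAlgebra ℂ G) : (a * b).coeff 1 = (b * a).coeff 1 := by
  conv_lhs => rw [alg_sum a]
  conv_rhs => rw [alg_sum a]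
  rw [Finset.sum_mul, Finset.mul_sum, MonoidAlgebra.coeff_sum, MonoidAlgebra.coeff_sum,
    Finsupp.finsetSum_apply, Finsupp.finsetSum_apply]
  refine Finset.sum_congr rfl fun x _ => ?_
  rw [smul_mul_assoc, mul_smul_comm, MonoidAlgebra.coeff_smul, MonoidAlgebra.coeff_smul,
    Finsupp.smul_apply, Finsupp.smul_apply, MonoidAlgebra.coeff_single_mul_apply,
    MonoidAlgebra.coeff_mul_single_apply]
  simp

lemma ideal_deg (hp : p.Prime) (Q : Subgroup G) [Q.Normal] (hQ : ¬ p ∣ Nat.card Q) {w : Wt Q}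
    (hw : idem Q w ≠ 0) {E : Subgroup G} (hE : IsPGroup p E) (hfix : ∀ e ∈ E, e • w = w) (j : ℕ)
    (hj : ¬ p ^ j * Nat.card E ∣ Nat.card G) :
    ∃ d, Deg G d ∧ (MulAction.stabilizer G w).index ∣ d ∧ ¬ p ^ j ∣ d := by
  haveI := Fact.mk hp
  have hcomm : aG E * eG Q w = eG Q w * aG E := by
    rw [aG, smul_mul_assoc, mul_smul_comm, Finset.sum_mul, Finset.mul_sum]
    congr 1
    exact Finset.sum_congr rfl fun e _ => eG_conj Q w e (hfix e e.2)
  set f := eG Q w * aG E with hf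
  have hff : f * f = f := by
    rw [hf]
    calc eG Q w * aG E * (eG Q w * aG E) = eG Q w * (aG E * eG Q w) * aG E := by
          simp only [mul_assoc]
      _ = (eG Q w * eG Q w) * (aG E * aG E) := by rw [hcomm, hf]; simp only [mul_assoc]
      _ = _ := by rw [eG_idem, aG_idem]
  have hf1 : (Fintype.card E : ℂ) * f.coeff 1 = ec w 1 := by
    rw [hf, aG, mul_smul_comm, MonoidAlgebra.coeff_smul, Finsupp.smul_apply, smul_eq_mul,
      ← mul_assoc, mul_inv_cancel₀ (Nat.cast_ne_zero.2 Fintype.card_ne_zero), one_mul,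
      Finset.mul_sum, MonoidAlgebra.coeff_sum, Finsupp.finsetSum_apply]
    rw [Finset.sum_eq_single 1]
    · simp only [MonoidAlgebra.coeff_mul_single_apply]
      rw [eG_coeff]
      have : (1 : G) * (((1 : E) : G))⁻¹ = 1 := by simp
      simp only [this, mul_one]
      rw [dif_pos Q.one_mem]
      rfl
    · intro e _ he
      rw [MonoidAlgebra.coeff_mul_single_apply, eG_coeff, dif_neg, zero_mul]
      rw [one_mul]
      intro h
      exact he (Subtype.ext (inf_bot_of_pPrime hp hE hQ e.2 (by simpa using Q.inv_mem h)))
    · simp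
  let I := LinearMap.range (LinearMap.mulRight ℂ f)
  have hdim : Module.finrank ℂ I * Nat.card E * Nat.card Q = Nat.card G * bd w := by
    have h1 := finrank_range_mulRight f hff
    have h2 := bd_eq w
    have : ((Module.finrank ℂ I * Nat.card E * Nat.card Q : ℕ) : ℂ) = (Nat.card G * bd w : ℕ) := by
      push_cast
      rw [h2, ← hf1, h1]
      simp only [Nat.card_eq_fintype_card]
      ring
    exact_mod_cast this
  have hnd : ¬ p ^ j ∣ Module.finrank ℂ I := by
    intro h
    apply hj
    obtain ⟨k, hk⟩ := (card_pGroup hp E).1 hE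
    rw [hk, ← pow_add]
    have h1 : p ^ (j + k) ∣ Nat.card G * bd w := by
      rw [← hdim, hk, pow_add]
      exact (mul_dvd_mul_right h _).mul_right _
    exact (((Nat.Prime.coprime_iff_not_dvd hp).2 (bd_pPrime hp hQ hw)).pow_left _).dvd_of_dvd_mul_right h1
  have hI : SInv (lreg G) ⊤ I := by
    rintro g _ _ ⟨a, rfl⟩
    exact ⟨MonoidAlgebra.single g 1 * a, by simp [lreg_apply, mul_assoc]⟩
  obtain ⟨Y, hYI, hY, hYd⟩ := exists_irrSub_not_dvd hI (p ^ j) hnd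
  have hD := deg_of_irrSub hY
  have hD' : Deg G (Module.finrank ℂ Y) := (Deg.equiv (Subgroup.topEquiv (G := G))).2 hD
  refine ⟨_, hD', ?_, hYd⟩
  -- weight
  obtain ⟨b, hb, hb0⟩ := Submodule.exists_mem_ne_zero_of_ne_bot hY.2.1
  obtain ⟨g, hg⟩ : ∃ g, b.coeff g ≠ 0 := by
    by_contra hcon
    push Not at hcon
    apply hb0
    apply MonoidAlgebra.ext
    ext g
    exact hcon g
  have haY := hY.1 g⁻¹ trivial b hb
  set a := lreg G g⁻¹ b with ha
  have ha1 : a.coeff 1 ≠ 0 := by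
    rw [ha, lreg_apply, MonoidAlgebra.coeff_single_mul_apply]
    simpa using hg
  have hae : a * eG Q w = a := by
    obtain ⟨c, hc⟩ := hYI haY
    rw [← hc]
    simp only [LinearMap.mulRight_apply]
    rw [hf, mul_assoc, mul_assoc, hcomm, ← mul_assoc (eG Q w), eG_idem]
  have hne : eG Q w * a ≠ 0 := by
    intro h0
    apply ha1
    rw [← hae, coeff_one_mul_comm, h0]
    simp
  have hmem : eG Q w * a ∈ Y := by
    rw [eG, Finset.sum_mul]
    refine Y.sum_mem fun x _ => ?_
    rw [smul_mul_assoc]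
    exact Y.smul_mem _ (hY.1 x trivial a haY)
  have hmem2 := idem_apply_mem ((lreg G).comp Q.subtype : Representation ℂ Q _) w a
  rw [eG_apply] at hmem2
  have hcl := clifford (equivar_csum Q (lreg G) ⊤) hY w (fun h => hne (by
    have : eG Q w * a ∈ (⊥ : Submodule ℂ (MonoidAlgebra ℂ G)) := h ▸ ⟨hmem, hmem2⟩
    simpa using this))
  rw [hcl.1, Subgroup.relIndex_top_right]
  exact dvd_mul_right _ _

end Ideal

section LemmaL

lemma card_quot_lt {G : Type} [Group G] [Finite G] (N : Subgroup G) (h : N ≠ ⊥) :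
    Nat.card (G ⧸ N) < Nat.card G := by
  have h1 := Subgroup.card_eq_card_quotient_mul_card_subgroup N
  have h2 : 1 < Nat.card N := by
    rw [Subgroup.one_lt_card_iff_ne_bot]; exact h
  have h3 : 0 < Nat.card (G ⧸ N) := Nat.card_pos
  nlinarith

lemma lemL {p : ℕ} (hp : p.Prime) (k : ℕ) : ∀ (n : ℕ) (G : Type) [Group G] [Finite G], Nat.card G = n →
    IsPSolvable p G → ∀ (P R : Sylow p G) (D : Subgroup G), P ≠ R → D ≤ P → D ≤ R →
    Nat.card P ≤ p ^ k * Nat.card D → ∃ d, Deg G d ∧ p ∣ d ∧ ¬ p ^ (k + 1) ∣ d := by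
  haveI := Fact.mk hp
  intro n
  induction n using Nat.strong_induction_on with
  | _ n ih =>
  intro G _ _ hn hG P R D hPR hDP hDR hD
  haveI : Fintype G := Fintype.ofFinite G
  -- passing to quotients
  have quot : ∀ (N : Subgroup G) [N.Normal], N ≠ ⊥ → ∀ R' : Sylow p G, D ≤ R' →
      (P : Subgroup G).map (QuotientGroup.mk' N) ≠ (R' : Subgroup G).map (QuotientGroup.mk' N) →
      ∃ d, Deg G d ∧ p ∣ d ∧ ¬ p ^ (k + 1) ∣ d := by
    intro N _ hN R' hDR' hne
    have hs := QuotientGroup.mk'_surjective N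
    obtain ⟨P1, hP1⟩ := map_syl hp _ hs P
    obtain ⟨R1, hR1⟩ := map_syl hp _ hs R'
    obtain ⟨d, hd, hd2⟩ := ih _ (hn ▸ card_quot_lt N hN) (G ⧸ N) rfl (hG.quot N) P1 R1
      (D.map (QuotientGroup.mk' N)) (fun h => hne (by rw [← hP1, ← hR1, h]))
      (hP1 ▸ Subgroup.map_mono hDP) (hR1 ▸ Subgroup.map_mono hDR') (by
        change Nat.card (P1 : Subgroup (G ⧸ N)) ≤ _
        rw [hP1]
        have h1 := card_map_mul (QuotientGroup.mk' N) (P : Subgroup G)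
        have h2 := card_map_mul (QuotientGroup.mk' N) D
        have h3 : Nat.card (D ⊓ (QuotientGroup.mk' N).ker : Subgroup G) ≤
          Nat.card (↑P ⊓ (QuotientGroup.mk' N).ker : Subgroup G) :=
          Subgroup.card_le_of_le (inf_le_inf_right _ hDP)
        have h4 : 0 < Nat.card (↑P ⊓ (QuotientGroup.mk' N).ker : Subgroup G) := Nat.card_pos
        change Nat.card (P : Subgroup G) ≤ _ at hD
        rw [← h1, ← h2] at hD
        refine Nat.le_of_mul_le_mul_right (hD.trans ?_) h4
        rw [mul_assoc]
        exact Nat.mul_le_mul_left _ (Nat.mul_le_mul_left _ h3))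
    exact ⟨d, hd.of_surj _ hs, hd2⟩
  have htriv : (⊤ : Subgroup G) ≠ ⊥ := by
    intro h
    apply hPR
    apply Sylow.ext
    rw [eq_bot_iff.2 (h ▸ le_top : (P : Subgroup G) ≤ ⊥), eq_bot_iff.2 (h ▸ le_top : (R : Subgroup G) ≤ ⊥)]
  obtain ⟨Q, _, hQn, hQ, hcase⟩ := exists_normal_sub hp hG ⊤ inferInstance htriv
  haveI := hQn
  have hker := QuotientGroup.ker_mk' Q
  by_cases hmap : (P : Subgroup G).map (QuotientGroup.mk' Q) ≠ (R : Subgroup G).map (QuotientGroup.mk' Q)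
  · exact quot Q hQ R hDR hmap
  push Not at hmap
  have hRPQ : (R : Subgroup G) ≤ (P : Subgroup G) ⊔ Q := by
    have := le_of_map_le (QuotientGroup.mk' Q) hmap.ge
    rwa [hker] at this
  rcases hcase with hQp | hQp
  · exfalso
    have h1 : Q ≤ P := hQp.le_sylow_of_normal P
    have h2 : (R : Subgroup G) ≤ P := hRPQ.trans (sup_le le_rfl h1)
    exact hPR (Sylow.ext (R.3 P.2 h2))
  · obtain ⟨q, hq, hqR⟩ := conj_of_le hp hQn hRPQ
    have hEq : ∀ e ∈ ((P : Subgroup G) ⊓ (R : Subgroup G) : Subgroup G), e • (⟨q, hq⟩ : Q) = ⟨q, hq⟩ := by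
      intro e he
      rw [conjN_fix]
      have h1 := (hqR e).1 he.2
      have h2 : e⁻¹ * (q⁻¹ * e * q) ∈ (P : Subgroup G) := P.mul_mem (P.inv_mem he.1) h1
      have h3 : (e⁻¹ * q⁻¹ * e) * q ∈ Q := Q.mul_mem (by
        simpa using hQn.conj_mem _ (Q.inv_mem hq) e⁻¹) hq
      have h4 := inf_bot_of_pPrime hp P.2 hQp h2 (by simpa [mul_assoc] using h3)
      have : e * q = q * e * (e⁻¹ * (q⁻¹ * e * q)) := by group
      simp only
      rw [this, h4, mul_one]
    have hnP : ∃ g ∈ (P : Subgroup G), g • (⟨q, hq⟩ : Q) ≠ ⟨q, hq⟩ := by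
      by_contra hcon
      push Not at hcon
      apply hPR
      apply Sylow.ext
      have hle : (P : Subgroup G) ≤ R := by
        intro x hx
        have h1 := hcon x hx
        rw [conjN_fix] at h1
        simp only at h1
        rw [hqR, mul_assoc, h1, inv_mul_cancel_left]
        exact hx
      exact (P.3 R.2 hle).symm
    obtain ⟨w, hw, hEw, hPw⟩ := weight_of_fixed hp hQp inf_le_left P.2 hEq hnP
    have hDE : D ≤ ((P : Subgroup G) ⊓ (R : Subgroup G) : Subgroup G) := le_inf hDP hDR
    by_cases hidx : p ∣ (MulAction.stabilizer G w).index
    · obtain ⟨d, h1, h2, h3⟩ := ideal_deg hp Q hQp hw (P.2.to_le inf_le_left) hEw (k + 1) (by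
        intro hdv
        have h4 : Nat.card P ≤ p ^ k * Nat.card ((P : Subgroup G) ⊓ (R : Subgroup G) : Subgroup G) :=
          hD.trans (Nat.mul_le_mul_left _ (Subgroup.card_le_of_le hDE))
        obtain ⟨e, he⟩ := (card_pGroup hp ((P : Subgroup G) ⊓ (R : Subgroup G) : Subgroup G)).1 (P.2.to_le inf_le_left)
        rw [he] at hdv h4
        rw [← pow_add] at hdv h4
        rw [hp.pow_dvd_iff_le_factorization Nat.card_pos.ne'] at hdv
        rw [syl_card hp P, Nat.pow_le_pow_iff_right hp.one_lt] at h4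
        omega)
      exact ⟨d, h1, hidx.trans h2, h3⟩
    · obtain ⟨R', hER', hR'⟩ := exists_syl_between hp (MulAction.stabilizer G w) ((P : Subgroup G) ⊓ (R : Subgroup G) : Subgroup G)
        (fun e he => hEw e he) (P.2.to_le inf_le_left) hidx
      refine quot Q hQ R' (hDE.trans hER') (fun h => ?_)
      obtain ⟨g, hg, hgw⟩ := hPw
      apply hgw
      have := le_of_map_le (QuotientGroup.mk' Q) h.le
      rw [hker] at this
      exact (this.trans (sup_le hR' (le_stab Q hw))) hg

end LemmaL

section Twist
variable {G : Type} [Group G] {V : Type} [AddCommGroup V] [Module ℂ V]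

/-- twisting by a linear character -/
def twist (μ : G →* ℂ) (ρ : Representation ℂ G V) : Representation ℂ G V where
  toFun g := μ g • ρ g
  map_one' := by simp
  map_mul' a b := by
    ext v
    simp only [map_mul, Module.End.mul_apply, LinearMap.smul_apply, map_smul, smul_smul]
    rw [mul_comm]

lemma twist_apply (μ : G →* ℂ) (ρ : Representation ℂ G V) (g : G) (v : V) :
    twist μ ρ g v = μ g • ρ g v := rfl

lemma mu_ne (μ : G →* ℂ) (g : G) : μ g ≠ 0 := by
  intro h
  have : μ (g * g⁻¹) = 1 := by simp
  rw [map_mul, h, zero_mul] at this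
  exact zero_ne_one this

lemma sinv_twist (μ : G →* ℂ) (ρ : Representation ℂ G V) (H : Subgroup G) (W : Submodule ℂ V) :
    SInv (twist μ ρ) H W ↔ SInv ρ H W := by
  constructor
  · intro h g hg v hv
    have := h g hg v hv
    rw [twist_apply] at this
    exact (W.smul_mem_iff (mu_ne μ g)).1 this
  · intro h g hg v hv
    exact W.smul_mem _ (h g hg v hv)

lemma irrSub_twist (μ : G →* ℂ) (ρ : Representation ℂ G V) (H : Subgroup G) (W : Submodule ℂ V) :
    IrrSub (twist μ ρ) H W ↔ IrrSub ρ H W := by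
  simp only [IrrSub, sinv_twist]

/-- the inverse of a linear character -/
def muInv (μ : G →* ℂ) : G →* ℂ where
  toFun g := (μ g)⁻¹
  map_one' := by simp
  map_mul' a b := by simp [mul_comm]

lemma muInv_apply (μ : G →* ℂ) (g : G) : muInv μ g = (μ g)⁻¹ := rfl

lemma lin_char {ρ : Representation ℂ G V} {H : Subgroup G} {L : Submodule ℂ V} (hL : SInv ρ H L)
    (h1 : Module.finrank ℂ L = 1) : ∃ μ : H →* ℂ, ∀ h : H, ∀ v ∈ L, ρ h v = μ h • v := by
  obtain ⟨v0, hv0, hspan⟩ := finrank_eq_one_iff'.1 h1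
  have hv0' : (v0 : V) ≠ 0 := fun h => hv0 (Subtype.ext h)
  have h : ∀ h : H, ∃ c : ℂ, ρ h v0 = c • (v0 : V) := by
    intro h
    obtain ⟨c, hc⟩ := hspan ⟨ρ h v0, hL h h.2 v0 v0.2⟩
    exact ⟨c, (congrArg Subtype.val hc).symm⟩
  choose c hc using h
  have hall : ∀ h : H, ∀ v ∈ L, ρ h v = c h • v := by
    intro h v hv
    obtain ⟨a, ha⟩ := hspan ⟨v, hv⟩
    have : v = a • (v0 : V) := (congrArg Subtype.val ha).symm
    rw [this, map_smul, hc, smul_comm]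
  refine ⟨⟨⟨c, ?_⟩, ?_⟩, hall⟩
  · have := hc 1
    simp only [OneMemClass.coe_one, map_one, Module.End.one_apply] at this
    exact smul_left_injective ℂ hv0' (by simpa using this.symm)
  · intro a b
    have h1 := hc (a * b)
    rw [Subgroup.coe_mul, map_mul, Module.End.mul_apply, hc b, map_smul, hc a, smul_smul, mul_comm] at h1
    exact smul_left_injective ℂ hv0' h1.symm

end Twist

section NormalP
variable {G : Type} [Group G] [Finite G] {V : Type} [AddCommGroup V] [Module ℂ V]
  [FiniteDimensional ℂ V] {p : ℕ}

/-- the operators of a subgroup -/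
def fN (ρ : Representation ℂ G V) (N : Subgroup G) : N → V →ₗ[ℂ] V := fun n => ρ n

lemma equivar_fN (ρ : Representation ℂ G V) (N : Subgroup G) [N.Normal] (H : Subgroup G) :
    Equivar ρ H (fN ρ N) := by
  intro g _ x v
  simp only [fN]
  rw [← Module.End.mul_apply, ← Module.End.mul_apply, ← map_mul, ← map_mul, conjN_coe]
  congr 2
  group

lemma line_of_pPrime (hp : p.Prime) {ρ : Representation ℂ G V} {P : Subgroup G} (hP : IsPGroup p P)
    {W : Submodule ℂ V} (hW : SInv ρ P W) (hd : ¬ p ∣ Module.finrank ℂ W) :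
    ∃ L ≤ W, IrrSub ρ P L ∧ Module.finrank ℂ L = 1 := by
  obtain ⟨L, hL1, hL2, hL3⟩ := exists_irrSub_not_dvd hW p hd
  refine ⟨L, hL1, hL2, ?_⟩
  haveI := Fintype.ofFinite P
  obtain ⟨k, hk⟩ := (deg_of_irrSub hL2).of_pGroup hp hP
  rcases k with _ | k
  · simpa using hk
  · exact absurd (hk ▸ dvd_pow_self p (Nat.succ_ne_zero k)) hL3

lemma lin_comm (hp : p.Prime) {ρ : Representation ℂ G V} (hρ : IrrSub ρ ⊤ ⊤)
    (hd : ¬ p ∣ Module.finrank ℂ V) (N : Subgroup G) [N.Normal] (hN : IsPGroup p N) :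
    ∀ n ∈ N, ∀ m ∈ N, ∀ v, ρ n (ρ m v) = ρ m (ρ n v) := by
  obtain ⟨L, _, hL, hL1⟩ := line_of_pPrime hp hN (SInv.top ρ N) (by simpa using hd)
  obtain ⟨μ, hμ⟩ := lin_char hL.1 hL1
  obtain ⟨v0, hv0, hv00⟩ := Submodule.exists_mem_ne_zero_of_ne_bot hL.2.1
  have hv0e : v0 ∈ eig (fN ρ N) (fun n => μ n) := fun n => hμ n v0 hv0
  let S : Submodule ℂ V := ⨆ w : Wt N, eig (fN ρ N) w
  have hS : SInv ρ ⊤ S := by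
    intro g hg v hv
    refine Submodule.iSup_induction (fun w : Wt N => eig (fN ρ N) w) (motive := fun v => ρ g v ∈ S) hv
      (fun w v hv => ?_) (by simp) (fun a b ha hb => by rw [map_add]; exact S.add_mem ha hb)
    exact (le_iSup (fun w : Wt N => eig (fN ρ N) w) (g • w)) (eig_smul (equivar_fN ρ N ⊤) hg hv)
  have hStop : S = ⊤ := by
    rcases hρ.2.2 S le_top hS with h | h
    · exfalso
      apply hv00
      have : v0 ∈ S := (le_iSup (fun w : Wt N => eig (fN ρ N) w) (fun n => μ n)) hv0e
      rw [h] at this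
      simpa using this
    · exact h
  intro n hn m hm v
  have hv : v ∈ S := hStop ▸ Submodule.mem_top
  refine Submodule.iSup_induction (fun w : Wt N => eig (fN ρ N) w)
    (motive := fun v => ρ n (ρ m v) = ρ m (ρ n v)) hv (fun w v hv => ?_) (by simp)
    (fun a b ha hb => by simp only [map_add, ha, hb])
  have h1 := hv ⟨n, hn⟩
  have h2 := hv ⟨m, hm⟩
  simp only [fN] at h1 h2
  rw [h1, h2, map_smul, map_smul, h1, h2, smul_comm]

lemma exists_lin_weight {ρ : Representation ℂ G V} {N : Subgroup G}
    (hc : ∀ n ∈ N, ∀ m ∈ N, ∀ v, ρ n (ρ m v) = ρ m (ρ n v)) {W : Submodule ℂ V} (hW : SInv ρ N W)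
    (h0 : W ≠ ⊥) : ∃ w : Wt N, W ⊓ eig (fN ρ N) w ≠ ⊥ := by
  obtain ⟨U, hUW, hU⟩ := exists_irrSub hW h0
  have : ∀ n : N, ∃ c : ℂ, ∀ v ∈ U, ρ n v = c • v := fun n =>
    schur hU (ρ n) (hU.1 n n.2) (fun h hh v _ => hc n n.2 h hh v)
  choose w hw using this
  refine ⟨w, fun h => hU.2.1 ?_⟩
  rw [eq_bot_iff, ← h]
  exact le_inf hUW (fun v hv n => hw n v hv)

end NormalP

section Upper

lemma deg_trivial {G : Type} [Group G] [Finite G] (h : (⊤ : Subgroup G) = ⊥) {d : ℕ} (hd : Deg G d) :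
    d = 1 := by
  haveI := Fintype.ofFinite G
  have h1 := hd.sq_dvd
  have h2 : Nat.card G = 1 := by
    rw [← Subgroup.card_top (G := G), h, Subgroup.card_bot]
  rw [← Nat.card_eq_fintype_card, h2] at h1
  have := Nat.dvd_one.1 (by simpa using h1)
  simpa using this

lemma lemU {p : ℕ} (hp : p.Prime) (m : ℕ) (hm : m ≠ 0) : ∀ (n : ℕ) (G : Type) [Group G] [Finite G],
    Nat.card G = n → IsPSolvable p G → ∀ (P : Sylow p G), Deg P (p ^ m) →
    ∃ d, Deg G d ∧ p ∣ d ∧ ¬ p ^ (m + 1) ∣ d := by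
  haveI := Fact.mk hp
  intro n
  induction n using Nat.strong_induction_on with
  | _ n ih =>
  intro G _ _ hn hG P hdeg
  have hp1 : p ^ m ≠ 1 := by
    intro h
    exact hp.one_lt.ne' ((Nat.pow_eq_one.1 h).resolve_right hm)
  have hquot : ∀ (N : Subgroup G) [N.Normal], N ≠ ⊥ →
      Deg ((P : Subgroup G).map (QuotientGroup.mk' N)) (p ^ m) →
      ∃ d, Deg G d ∧ p ∣ d ∧ ¬ p ^ (m + 1) ∣ d := by
    intro N _ hN hd
    have hs := QuotientGroup.mk'_surjective N
    obtain ⟨P1, hP1⟩ := map_syl hp _ hs P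
    rw [← hP1] at hd
    obtain ⟨d, hd, hd2⟩ := ih _ (hn ▸ card_quot_lt N hN) (G ⧸ N) rfl (hG.quot N) P1 hd
    exact ⟨d, hd.of_surj _ hs, hd2⟩
  have htriv : (⊤ : Subgroup G) ≠ ⊥ := by
    intro h
    apply hp1
    refine deg_trivial ?_ hdeg
    rw [eq_bot_iff]
    intro x _
    have : (x : G) ∈ (⊤ : Subgroup G) := trivial
    rw [h, Subgroup.mem_bot] at this
    exact Subtype.ext this
  obtain ⟨N, _, hNn, hN, hcase⟩ := exists_normal_sub hp hG ⊤ inferInstance htriv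
  haveI := hNn
  -- restriction of the quotient map to P
  let f : P →* (P : Subgroup G).map (QuotientGroup.mk' N) := (QuotientGroup.mk' N).subgroupMap P
  have hf : Function.Surjective f := (QuotientGroup.mk' N).subgroupMap_surjective P
  have hfk : ∀ x : P, f x = 1 → (x : G) ∈ N := by
    intro x hx
    have : QuotientGroup.mk' N (x : G) = 1 := congrArg Subtype.val hx
    rwa [← MonoidHom.mem_ker, QuotientGroup.ker_mk'] at this
  obtain ⟨U, _, _, _, τ, hτ, hU⟩ := hdeg
  rcases hcase with hNp | hNp
  · have hNP : N ≤ P := hNp.le_sylow_of_normal P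
    obtain ⟨V, _, _, _, ρ, T, W, hρ, hV1, hV2, hT, hW, hWd, hinj⟩ := coind_irr (P : Subgroup G) τ hτ
      (p ^ (m + 1)) (by
        rw [hU, pow_succ, mul_comm (p ^ m) p]
        intro h
        exact P.not_dvd_index (Nat.dvd_of_mul_dvd_mul_right (pow_pos hp.pos m) h))
    by_cases hpd : p ∣ Module.finrank ℂ V
    · exact ⟨_, ⟨V, _, _, inferInstance, ρ, hρ, rfl⟩, hpd, hV1⟩
    have hc := lin_comm hp hρ hpd N hNp
    obtain ⟨w, hw⟩ := exists_lin_weight hc (hW.1.mono hNP) hW.2.1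
    set Gw := MulAction.stabilizer G w with hGw
    have hcl1 := clifford (equivar_fN ρ N ⊤) hρ w (fun h => hw (by
      rw [eq_bot_iff, ← h]; exact inf_le_inf_right _ le_top))
    have hcl2 := clifford (equivar_fN ρ N P) hW w hw
    rw [← hGw] at hcl1 hcl2
    rw [top_inf_eq] at hcl1
    simp only [finrank_top, Subgroup.relIndex_top_right, inf_top_eq] at hcl1
    have hidx : ¬ p ∣ Gw.index := fun h => hpd (hcl1.1 ▸ h.mul_right _)
    obtain ⟨R, hER, hRG⟩ := exists_syl_between hp Gw ((P : Subgroup G) ⊓ Gw) inf_le_right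
      (P.2.to_le inf_le_left) hidx
    by_cases hPR : P = R
    · have hPG : (P : Subgroup G) ≤ Gw := hPR ▸ hRG
      rw [Subgroup.relIndex_eq_one.2 hPG, one_mul] at hcl2
      have hWe : W ≤ eig (fN ρ N) w := by
        have := Submodule.eq_of_le_of_finrank_eq (inf_le_left : W ⊓ eig (fN ρ N) w ≤ W) hcl2.1.symm
        exact inf_eq_left.1 this
      have hinvP : SInv ρ P (eig (fN ρ N) w) := by
        have := eig_inv (equivar_fN ρ N ⊤) w
        exact this.mono (le_inf hPG le_top)
      obtain ⟨L, hLe, hL, hL1⟩ := line_of_pPrime hp P.2 hinvP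
        (fun h => hpd (hcl1.1 ▸ h.mul_left _))
      obtain ⟨μ, hμ⟩ := lin_char hL.1 hL1
      obtain ⟨v0, hv0, hv00⟩ := Submodule.exists_mem_ne_zero_of_ne_bot hL.2.1
      have hμw : ∀ (x : G) (hx : x ∈ N), μ ⟨x, hNP hx⟩ = w ⟨x, hx⟩ := by
        intro x hx
        have h1 := hμ ⟨x, hNP hx⟩ v0 hv0
        have h2 : ρ x v0 = w ⟨x, hx⟩ • v0 := hLe hv0 ⟨x, hx⟩
        exact smul_left_injective ℂ hv00 (h1.symm.trans h2)
      have hTW : W.map T = ⊤ := by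
        apply Submodule.eq_top_of_finrank_eq
        rw [finrank_map_of_inj T hinj, hWd]
      apply hquot N hN
      rw [← hU]
      refine deg_factor f hf (twist (muInv μ) τ) ((irrSub_twist _ _ _ _).2 hτ) ?_
      intro x hx
      have hxN := hfk x hx
      ext u
      obtain ⟨v, hv, rfl⟩ : u ∈ W.map T := hTW ▸ Submodule.mem_top
      rw [twist_apply, ← hT, muInv_apply]
      have h1 : ρ x v = w ⟨x, hxN⟩ • v := hWe hv ⟨x, hxN⟩
      have h2 := hμw x hxN
      rw [h1, map_smul, ← h2, smul_smul]
      have h3 : (⟨(x : G), hNP hxN⟩ : P) = x := rfl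
      rw [h3, inv_mul_cancel₀ (mu_ne μ x)]
      simp
    · refine lemL hp m n G hn hG P R _ hPR inf_le_left hER ?_
      have h1 : Nat.card (Gw ⊓ (P : Subgroup G) : Subgroup G) * Gw.relIndex P = Nat.card P := by
        have := Subgroup.relIndex_mul_relIndex ⊥ (Gw ⊓ (P : Subgroup G)) P bot_le inf_le_right
        rwa [Subgroup.relIndex_bot_left, Subgroup.relIndex_bot_left, Subgroup.inf_relIndex_right] at this
      rw [← h1, mul_comm, inf_comm]
      refine Nat.mul_le_mul_right _ (Nat.le_of_dvd (pow_pos hp.pos m) ?_)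
      rw [← hU, ← hWd, hcl2.1]
      exact dvd_mul_right _ _
  · apply hquot N hN
    rw [← hU]
    refine deg_factor f hf τ hτ ?_
    intro x hx
    have : x = 1 := Subtype.ext (inf_bot_of_pPrime hp P.2 hNp x.2 (hfk x hx))
    rw [this, map_one]

end Upper

section Close1

/-- the degrees of Sylow subgroups -/
def PropA (p k : ℕ) (G : Type) [Group G] : Prop :=
  ∀ (P : Sylow p G) (d : ℕ), Deg P d → d ≤ p ^ k → d = 1

/-- no close Sylow subgroups -/
def PropB (p k : ℕ) (G : Type) [Group G] : Prop :=
  ∀ (P R : Sylow p G) (D : Subgroup G), D ≤ P → D ≤ R → Nat.card P ≤ p ^ k * Nat.card D → P = R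

lemma frat {S : Type} [Group S] [Finite S] {p : ℕ} (hp : p.Prime) (hS : IsPGroup p S) (H : Subgroup S)
    (h : H ⊔ commutator S = ⊤) : H = ⊤ := by
  haveI := Fact.mk hp
  rcases eq_top_or_exists_le_coatom H with h1 | ⟨M, hM, hHM⟩
  · exact h1
  exfalso
  haveI : Group.IsNilpotent S := hS.isNilpotent
  haveI hMn : M.Normal := Subgroup.NormalizerCondition.normal_of_coatom M
    (Group.normalizerCondition_of_isNilpotent) hM
  have hc : commutator S ≤ M := by
    haveI : Nontrivial (S ⧸ M) := by
      rw [QuotientGroup.nontrivial_iff]; exact hM.1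
    have hcen : Nontrivial (Subgroup.center (S ⧸ M)) := (hS.to_quotient M).center_nontrivial
    have hle : M ≤ (Subgroup.center (S ⧸ M)).comap (QuotientGroup.mk' M) := by
      intro x hx
      have : QuotientGroup.mk' M x = 1 := (QuotientGroup.eq_one_iff x).2 hx
      rw [Subgroup.mem_comap, this]
      exact Subgroup.one_mem _
    have htop : (Subgroup.center (S ⧸ M)).comap (QuotientGroup.mk' M) = ⊤ := by
      apply hM.2
      refine lt_of_le_of_ne hle (fun heq => ?_)
      obtain ⟨⟨z, hz⟩, hz1⟩ := exists_ne (1 : Subgroup.center (S ⧸ M))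
      obtain ⟨x, rfl⟩ := QuotientGroup.mk'_surjective M z
      apply hz1
      have : x ∈ M := heq ▸ hz
      exact Subtype.ext ((QuotientGroup.eq_one_iff x).2 this)
    rw [commutator_def, Subgroup.commutator_le]
    intro a _ b _
    have ha : QuotientGroup.mk' M a ∈ Subgroup.center (S ⧸ M) := by
      have : a ∈ (Subgroup.center (S ⧸ M)).comap (QuotientGroup.mk' M) := htop ▸ trivial
      exact this
    rw [← QuotientGroup.ker_mk' M, MonoidHom.mem_ker, map_commutatorElement,
      commutatorElement_eq_one_iff_mul_comm]
    exact ((Subgroup.mem_center_iff.1 ha) _).symm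
  have : (⊤ : Subgroup S) ≤ M := h ▸ sup_le hHM hc
  exact hM.1 (top_le_iff.1 this)

lemma chars_sep {E : Type} [Group E] [Finite E] {x : E} (h : ∀ ε : E →* ℂ, ε x = 1) :
    x ∈ commutator E := by
  by_contra hx
  have hx' : Abelianization.of x ≠ 1 := by
    intro h1
    apply hx
    rwa [← MonoidHom.mem_ker, Abelianization.ker_of] at h1
  obtain ⟨φ, hφ⟩ := CommGroup.exists_apply_ne_one_of_hasEnoughRootsOfUnity (Abelianization E) ℂ hx'
  apply hφ
  have := h ((Units.coeHom ℂ).comp (φ.comp Abelianization.of))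
  exact Units.ext this

lemma comm_triv {Q V : Type} [Group Q] [Finite Q] [AddCommGroup V] [Module ℂ V] [FiniteDimensional ℂ V]
    (ρ : Representation ℂ Q V) {n : ℕ} (hV : Module.finrank ℂ V ≤ n)
    (hA : ∀ d, Deg Q d → d ≤ n → d = 1) {x : Q} (hx : x ∈ commutator Q) (v : V) : ρ x v = v := by
  have hall : ∀ v ∈ (⊤ : Submodule ℂ V), ρ x v = v := by
    refine inv_induction (ρ := ρ) (H := ⊤) (fun U => ∀ v ∈ U, ρ x v = v) (by simp) ?_ (SInv.top ρ ⊤)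
    intro U U' hU _ _ hU' v hv
    obtain ⟨u, hu, u', hu', rfl⟩ := Submodule.mem_sup.1 hv
    rw [map_add, hU' u' hu']
    congr 1
    have h1 : Module.finrank ℂ U = 1 := hA _ (deg_top.1 (deg_of_irrSub hU))
      ((Submodule.finrank_le U).trans hV)
    obtain ⟨μ, hμ⟩ := lin_char hU.1 h1
    let ν : Q →* ℂˣ := (μ.comp (Subgroup.topEquiv (G := Q)).symm.toMonoidHom).toHomUnits
    have hν : ν x = 1 := by
      have : x ∈ ν.ker := Abelianization.commutator_subset_ker ν hx
      exact this
    have hμ1 : μ ⟨x, trivial⟩ = 1 := congrArg Units.val hν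
    have := hμ ⟨x, trivial⟩ u hu
    rw [hμ1, one_smul] at this
    exact this
  exact hall v trivial

/-- one-dimensional representation of a linear character -/
def linRep {E : Type} [Group E] (ε : E →* ℂ) : Representation ℂ E ℂ where
  toFun g := ε g • LinearMap.id
  map_one' := by ext; simp
  map_mul' a b := by ext; simp [mul_comm]

lemma linRep_apply {E : Type} [Group E] (ε : E →* ℂ) (e : E) (z : ℂ) : linRep ε e z = ε e * z := rfl

lemma comm_le {Q : Type} [Group Q] [Finite Q] (E : Subgroup Q) {n : ℕ} (hE : E.index ≤ n)
    (hA : ∀ d, Deg Q d → d ≤ n → d = 1) : commutator Q ≤ ⁅E, E⁆ := by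
  intro x hx
  have key : ∀ ε : E →* ℂ, ∃ h : x ∈ E, ε ⟨x, h⟩ = 1 := by
    intro ε
    obtain ⟨F, hF1, hF2⟩ := exists_supported E (linRep ε) 1
    have hd : Module.finrank ℂ (CoT E (linRep ε)) ≤ n := by
      rw [finrank_coV]; simpa using hE
    have h1 := comm_triv (coR E (linRep ε)) hd hA hx F
    have h2 : F.1 x = 1 := by
      have := congrArg (fun F : CoT E (linRep ε) => F.1 1) h1
      simp only [coR_apply] at this
      rwa [one_mul, hF1] at this
    have hxE : x ∈ E := by
      by_contra hn
      rw [hF2 x hn] at h2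
      exact zero_ne_one h2
    refine ⟨hxE, ?_⟩
    have h3 := F.2 ⟨x, hxE⟩ 1
    simp only [mul_one] at h3
    rw [h2, hF1, linRep_apply, mul_one] at h3
    exact h3.symm
  have hxE := (key 1).1
  rw [← Subgroup.map_subtype_commutator]
  exact ⟨⟨x, hxE⟩, chars_sep fun ε => (key ε).2, rfl⟩

lemma comm_le' {G : Type} [Group G] [Finite G] {P E : Subgroup G} (hEP : E ≤ P) {n : ℕ}
    (hE : Nat.card P ≤ n * Nat.card E) (hA : ∀ d, Deg P d → d ≤ n → d = 1) : ⁅P, P⁆ = ⁅E, E⁆ := by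
  apply le_antisymm _ (Subgroup.commutator_mono hEP hEP)
  have h1 : (E.subgroupOf P).index ≤ n := by
    have h2 := Subgroup.card_mul_index (E.subgroupOf P)
    rw [Nat.card_congr (Subgroup.subgroupOfEquivOfLe hEP).toEquiv] at h2
    rw [← h2, mul_comm] at hE
    exact Nat.le_of_mul_le_mul_right hE Nat.card_pos
  have h3 := Subgroup.map_mono (f := P.subtype) (comm_le (E.subgroupOf P) h1 hA)
  rw [Subgroup.map_subtype_commutator, Subgroup.map_commutator, Subgroup.subgroupOf_map_subtype,
    inf_eq_left.2 hEP] at h3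
  exact h3

lemma index_of_sup {J : Type} [Group J] [Finite J] (H Z : Subgroup J) [Z.Normal] (h : H ⊔ Z = ⊤) :
    H.index = H.relIndex Z := by
  have h1 := card_sup_normal Z H
  rw [sup_comm, h, Subgroup.card_top] at h1
  have h2 : ∀ A B : Subgroup J, Nat.card (A ⊓ B : Subgroup J) * A.relIndex B = Nat.card B := by
    intro A B
    have := Subgroup.relIndex_mul_relIndex ⊥ (A ⊓ B) B bot_le inf_le_right
    rwa [Subgroup.relIndex_bot_left, Subgroup.relIndex_bot_left, Subgroup.inf_relIndex_right] at this
  have h3 := h2 Z H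
  have h4 := h2 H Z
  have h5 := Subgroup.card_mul_index H
  rw [inf_comm] at h4
  have h6 : 0 < Nat.card H := Nat.card_pos
  apply Nat.eq_of_mul_eq_mul_left h6
  rw [h5, h1]
  calc Nat.card Z * Z.relIndex H = (Nat.card (Z ⊓ H : Subgroup J) * Z.relIndex H) * H.relIndex Z := by
        rw [← h4]; ring
    _ = _ := by rw [h3]

end Close1

section Close2

lemma cj_comm {J : Type} [Group J] (g : J) (H : Subgroup J) : ⁅cj g H, cj g H⁆ = cj g ⁅H, H⁆ := by
  rw [cj, cj, Subgroup.map_commutator]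

lemma cj_normal {J : Type} [Group J] (g : J) (X : Subgroup J) (hX : X.Normal) : cj g X = X := by
  ext x
  rw [mem_cj]
  constructor
  · intro h
    simpa [mul_assoc] using hX.conj_mem _ h g
  · intro h
    simpa using hX.conj_mem _ h g⁻¹

lemma exists_Op {J : Type} [Group J] [Finite J] {p : ℕ} (hp : p.Prime) :
    ∃ N : Subgroup J, N.Normal ∧ IsPGroup p N ∧ ∀ X : Subgroup J, X.Normal → IsPGroup p X → X ≤ N := by
  obtain ⟨X, _, h2, h3, h4⟩ := exists_greatest (G := J) (fun n => ∃ k, n = p ^ k) ⟨0, by simp⟩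
    (by rintro a b ⟨k, rfl⟩ ⟨l, rfl⟩; exact ⟨k + l, by rw [pow_add]⟩)
    (by
      rintro a b hab ⟨k, rfl⟩
      obtain ⟨l, _, hl⟩ := (Nat.dvd_prime_pow hp).1 hab
      exact ⟨l, hl⟩) ⊤
  exact ⟨X, nrm_top.1 h2, (card_pGroup hp X).2 h3, fun Y hY hY' =>
    h4 Y le_top (nrm_top.2 hY) ((card_pGroup hp Y).1 hY')⟩

lemma close_aux {J : Type} [Group J] [Finite J] {p : ℕ} (hp : p.Prime) (hJ : IsPSolvable p J)
    (N0 : Subgroup J) (hN0 : N0.Normal) (hN0p : IsPGroup p N0)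
    (hC : Subgroup.centralizer (N0 : Set J) ≤ N0) (P R : Sylow p J)
    (hX : ⁅(P : Subgroup J), (P : Subgroup J)⁆ = ⁅(R : Subgroup J), (R : Subgroup J)⁆)
    (htop : (P : Subgroup J) ⊔ (R : Subgroup J) = ⊤) : P = R := by
  haveI := Fact.mk hp
  by_contra hPR
  obtain ⟨X, hXdef⟩ : ∃ X, X = ⁅(P : Subgroup J), (P : Subgroup J)⁆ := ⟨_, rfl⟩
  have hnself : ∀ S : Subgroup J, Nrm S ⁅S, S⁆ := by
    intro S s hs x hx
    have h1 : cj s ⁅S, S⁆ = ⁅S, S⁆ := by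
      rw [← cj_comm]
      have : cj s S = S := by
        ext y
        rw [mem_cj]
        constructor
        · intro h
          have := S.mul_mem (S.mul_mem hs h) (S.inv_mem hs)
          simpa [mul_assoc] using this
        · intro h
          exact S.mul_mem (S.mul_mem (S.inv_mem hs) h) hs
      rw [this]
    rw [← h1, mem_cj]
    simpa [mul_assoc] using hx
  have hXn : X.Normal := by
    rw [← nrm_top]
    apply nrm_of_le_normalizer
    rw [← htop]
    exact sup_le (hXdef ▸ (hnself P).le_normalizer) (by rw [hXdef, hX]; exact (hnself R).le_normalizer)
  have hXP : X ≤ P := hXdef ▸ Subgroup.commutator_le_self _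
  have hXp : IsPGroup p X := P.2.to_le hXP
  have hXall : ∀ S : Sylow p J, ⁅(S : Subgroup J), (S : Subgroup J)⁆ = X := by
    intro S
    obtain ⟨g, hg⟩ := MulAction.exists_smul_eq J P S
    have h1 : (S : Subgroup J) = cj g P := by
      rw [← hg]; rfl
    rw [h1, cj_comm, ← hXdef, cj_normal g X hXn]
  obtain ⟨N, hNn, hNp, hNmax⟩ := exists_Op (J := J) hp
  have hNS : ∀ S : Sylow p J, N ≤ S := fun S => hNp.le_sylow_of_normal S
  haveI := hNn
  haveI := hXn
  -- N/X is central
  have hcent : ∀ n ∈ N, ∀ j : J, n * j * n⁻¹ * j⁻¹ ∈ X := by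
    intro n hn j
    have hle : (⊤ : Subgroup J) ≤ (Subgroup.centralizer
        ({QuotientGroup.mk' X n} : Set (J ⧸ X))).comap (QuotientGroup.mk' X) := by
      have : ∀ S : Sylow p J, (S : Subgroup J) ≤ (Subgroup.centralizer
        ({QuotientGroup.mk' X n} : Set (J ⧸ X))).comap (QuotientGroup.mk' X) := by
        intro S s hs
        rw [Subgroup.mem_comap, Subgroup.mem_centralizer_singleton_iff,
          ← commutatorElement_eq_one_iff_mul_comm, ← map_commutatorElement, ← MonoidHom.mem_ker,
          QuotientGroup.ker_mk', ← hXall S]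
        exact Subgroup.commutator_mem_commutator hs (hNS S hn)
      rw [← htop]
      exact sup_le (this P) (this R)
    have h1 := hle (Subgroup.mem_top j)
    rw [Subgroup.mem_comap, Subgroup.mem_centralizer_singleton_iff] at h1
    have h2 : QuotientGroup.mk' X (n * j * n⁻¹ * j⁻¹) = 1 := by
      rw [map_mul, map_mul, map_mul, map_inv, map_inv]
      rw [← h1]; group
    exact (QuotientGroup.eq_one_iff _).1 h2
  have hNtop : N ≠ ⊤ := by
    intro h
    apply hPR
    apply Sylow.ext
    have e1 : (P : Subgroup J) = ⊤ := by
      rw [eq_top_iff, ← h]; exact hNS P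
    have e2 : (R : Subgroup J) = ⊤ := by
      rw [eq_top_iff, ← h]; exact hNS R
    rw [e1, e2]
  have hqt : (⊤ : Subgroup (J ⧸ N)) ≠ ⊥ := by
    intro h
    apply hNtop
    rw [eq_top_iff]
    intro x _
    have : QuotientGroup.mk' N x ∈ (⊤ : Subgroup (J ⧸ N)) := trivial
    rw [h, Subgroup.mem_bot] at this
    exact (QuotientGroup.eq_one_iff x).1 this
  obtain ⟨Zb, _, hZbn, hZb, hcase⟩ := exists_normal_sub hp (hJ.quot N) ⊤ inferInstance hqt
  let Z := Zb.comap (QuotientGroup.mk' N)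
  haveI hZn : Z.Normal := hZbn.comap _
  have hmapZ : Z.map (QuotientGroup.mk' N) = Zb :=
    Subgroup.map_comap_eq_self_of_surjective (QuotientGroup.mk'_surjective N) Zb
  have hNZ : N ≤ Z := by
    intro x hx
    have : QuotientGroup.mk' N x = 1 := (QuotientGroup.eq_one_iff x).2 hx
    rw [Subgroup.mem_comap, this]
    exact Subgroup.one_mem _
  have hcardZ : Nat.card Zb * Nat.card N = Nat.card Z := by
    have := card_map_mul (QuotientGroup.mk' N) Z
    rwa [hmapZ, QuotientGroup.ker_mk', inf_eq_right.2 hNZ] at this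
  have hrel : N.relIndex Z = Nat.card Zb := by
    have := Subgroup.relIndex_mul_relIndex ⊥ N Z bot_le hNZ
    rw [Subgroup.relIndex_bot_left, Subgroup.relIndex_bot_left, ← hcardZ, mul_comm] at this
    exact Nat.eq_of_mul_eq_mul_right Nat.card_pos this
  rcases hcase with hZp | hZp
  · have h1 : IsPGroup p Z := by
      obtain ⟨a, ha⟩ := (card_pGroup hp Zb).1 hZp
      obtain ⟨b, hb⟩ := (card_pGroup hp N).1 hNp
      rw [card_pGroup hp]
      exact ⟨a + b, by rw [← hcardZ, ha, hb, pow_add]⟩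
    have h2 := hNmax Z hZn h1
    apply hZb
    rw [← hmapZ, eq_bot_iff]
    rintro _ ⟨z, hz, rfl⟩
    exact (QuotientGroup.eq_one_iff z).2 (h2 hz)
  -- now a prime
  obtain ⟨l, hl, hlZ⟩ := Nat.exists_prime_and_dvd (n := Nat.card Zb) (by
    intro h; exact hZb (Subgroup.card_eq_one.1 h))
  have hlp : l ≠ p := by rintro rfl; exact hZp hlZ
  haveI := Fact.mk hl
  obtain ⟨L0⟩ : Nonempty (Sylow l Z) := inferInstance
  let L : Subgroup J := (L0 : Subgroup Z).map Z.subtype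
  have hLZ : L ≤ Z := by rintro _ ⟨y, _, rfl⟩; exact y.2
  have hLl : IsPGroup l L := L0.2.map _
  have hLcard : Nat.card L = Nat.card L0 :=
    Nat.card_congr ((L0 : Subgroup Z).equivMapOfInjective _ Z.subtype_injective).toEquiv.symm
  have hfr : Subgroup.normalizer (L : Set J) ⊔ Z = ⊤ := Sylow.normalizer_sup_eq_top L0
  let Y := L ⊔ X
  let H1 := Subgroup.normalizer (Y : Set J)
  have hXN : Nrm ⊤ X := nrm_top.2 hXn
  have hLH : Subgroup.normalizer (L : Set J) ≤ H1 :=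
    Nrm.le_normalizer ((nrm_of_le_normalizer le_rfl).sup (hXN.mono le_top))
  have hNH : N ≤ H1 := by
    apply Nrm.le_normalizer
    intro n hn y hy
    have h1 : n * y * n⁻¹ = (n * y * n⁻¹ * y⁻¹) * y := by group
    rw [h1]
    exact Y.mul_mem (Subgroup.mem_sup_right (hcent n hn y)) hy
  have hH1 : ¬ p ∣ H1.index := by
    rw [index_of_sup H1 Z (top_le_iff.1 (hfr ▸ sup_le_sup_right hLH Z))]
    intro h
    exact hZp (hrel ▸ h.trans (Subgroup.relIndex_dvd_of_le_left Z hNH))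
  obtain ⟨S, _, hSH⟩ := exists_syl_between hp H1 ⊥ bot_le (IsPGroup.of_bot) hH1
  have hXS : X ≤ S := (hXall S) ▸ Subgroup.commutator_le_self _
  have hXZ : X ≤ Z := (hXP.trans' le_rfl).trans' le_rfl |> fun _ => (hNmax X hXn hXp).trans hNZ
  -- Frattini
  have hSX : ∀ x ∈ (S : Subgroup J), ∃ u ∈ X, Subgroup.normalizer (L : Set J) |>.carrier (u⁻¹ * x) := by
    intro x hx
    have hYx : Nrm H1 Y := nrm_of_le_normalizer le_rfl
    have hcle : cj x L ≤ Y := by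
      intro y hy
      rw [mem_cj] at hy
      have := hYx x (hSH hx) _ (Subgroup.mem_sup_left hy)
      simpa [mul_assoc] using this
    have hYZ : Y ≤ Z := sup_le hLZ hXZ
    have hcc : Nat.card ((cj x L).subgroupOf Z) = l ^ (Nat.card Z).factorization l := by
      rw [Nat.card_congr (Subgroup.subgroupOfEquivOfLe (hcle.trans hYZ)).toEquiv, card_cj, hLcard,
        syl_card hl L0]
    haveI : (X.subgroupOf Z).Normal := hXn.subgroupOf Z
    obtain ⟨u, hu, hL⟩ := conj_of_le (P := L0) (R := Sylow.ofCard _ hcc) hl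
      (Q := X.subgroupOf Z) inferInstance (by
        intro y hy
        have h1 : (y : J) ∈ Y := hcle hy
        rw [Subgroup.mem_sup_of_normal_right] at h1 ⊢
        obtain ⟨a, ha, b, hb, hab⟩ := h1
        obtain ⟨a', ha', rfl⟩ := ha
        refine ⟨a', ha', ⟨b, hXZ hb⟩, hb, Subtype.ext hab⟩)
    refine ⟨u, hu, ?_⟩
    change (u : J)⁻¹ * x ∈ Subgroup.normalizer (L : Set J)
    have hmemL : ∀ z : Z, (z : J) ∈ L ↔ z ∈ (L0 : Subgroup Z) := by
      intro z
      constructor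
      · rintro ⟨z', hz', h⟩
        have : z' = z := Subtype.ext h
        exact this ▸ hz'
      · intro h; exact ⟨z, h, rfl⟩
    have hiff : ∀ z : Z, (z : J) ∈ cj x L ↔ (u : J)⁻¹ * z * u ∈ L := by
      intro z
      have h1 := hL z
      have h2 := hmemL (u⁻¹ * z * u)
      rw [← h2] at h1
      exact h1
    have hN : Nrm (Subgroup.zpowers ((u : J)⁻¹ * x)) L := by
      have hone : ∀ y ∈ L, ((u : J)⁻¹ * x) * y * ((u : J)⁻¹ * x)⁻¹ ∈ L := by
        intro y hy
        have h1 : x * y * x⁻¹ ∈ cj x L := by rw [mem_cj]; simpa [mul_assoc] using hy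
        have h2 := (hiff ⟨x * y * x⁻¹, hYZ (hcle h1)⟩).1 h1
        simpa [mul_assoc] using h2
      have hle2 : cj ((u : J)⁻¹ * x) L ≤ L := by
        intro y hy
        rw [mem_cj] at hy
        have := hone _ hy
        have e : (u : J)⁻¹ * x * (((u : J)⁻¹ * x)⁻¹ * y * ((u : J)⁻¹ * x)) * ((u : J)⁻¹ * x)⁻¹ = y := by
          group
        rwa [e] at this
      have heq : cj ((u : J)⁻¹ * x) L = L := Subgroup.eq_of_le_of_card_ge hle2 (card_cj _ _).ge
      apply nrm_of_le_normalizer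
      rw [Subgroup.zpowers_le, Subgroup.mem_normalizer_iff]
      intro h
      refine ⟨hone h, fun hh => ?_⟩
      rw [← heq, mem_cj] at hh
      have e : ((u : J)⁻¹ * x)⁻¹ * ((u : J)⁻¹ * x * h * ((u : J)⁻¹ * x)⁻¹) * ((u : J)⁻¹ * x) = h := by
        group
      rwa [e] at hh
    exact hN.le_normalizer (Subgroup.mem_zpowers _)
  have hSN : (S : Subgroup J) ≤ Subgroup.normalizer (L : Set J) := by
    have h1 : (Subgroup.normalizer (L : Set J)).subgroupOf S = ⊤ := by
      apply frat hp S.2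
      rw [eq_top_iff]
      intro x _
      obtain ⟨u, hu, hux⟩ := hSX x x.2
      have hu2 : u ∈ (commutator (S : Subgroup J)).map (S : Subgroup J).subtype := by
        rw [Subgroup.map_subtype_commutator, hXall S]; exact hu
      obtain ⟨u', hu', rfl⟩ := hu2
      have e : x = u' * (u'⁻¹ * x) := by group
      rw [e, sup_comm]
      exact Subgroup.mul_mem_sup hu' hux
    exact Subgroup.subgroupOf_eq_top.1 h1
  have hLC : L ≤ N0 := by
    refine le_trans ?_ hC
    intro y hy
    rw [Subgroup.mem_centralizer_iff]
    intro n hn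
    have hnN : n ∈ N := hNmax N0 hN0 hN0p hn
    have h1 : n * y * n⁻¹ * y⁻¹ ∈ L :=
      L.mul_mem ((nrm_of_le_normalizer hSN) n (hNS S hnN) y hy) (L.inv_mem hy)
    have h2 : n * y * n⁻¹ * y⁻¹ ∈ N := by
      have := N.mul_mem hnN (hNn.conj_mem _ (N.inv_mem hnN) y)
      simpa [mul_assoc] using this
    have h3 := inf_bot_of_pPrime hp hNp (Q := L) (by
      obtain ⟨k, hk⟩ := (card_pGroup hl L).1 hLl
      rw [hk]
      intro h
      exact hlp ((Nat.prime_dvd_prime_iff_eq hp hl).1 (hp.dvd_of_dvd_pow h)).symm) h2 h1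
    rw [mul_inv_eq_one, mul_inv_eq_iff_eq_mul] at h3
    exact h3
  have hLbot : ∀ y ∈ L, y = 1 := by
    intro y hy
    refine inf_bot_of_pPrime hl hLl (Q := N0) ?_ hy (hLC hy)
    obtain ⟨k, hk⟩ := (card_pGroup hp N0).1 hN0p
    rw [hk]
    intro h
    exact hlp ((Nat.prime_dvd_prime_iff_eq hl hp).1 (hl.dvd_of_dvd_pow h))
  have hL1 : Nat.card L = 1 := Subgroup.card_eq_one.2 ((Subgroup.eq_bot_iff_forall L).2 hLbot)
  rw [hLcard, syl_card hl L0] at hL1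
  have h4 : l ∣ Nat.card Z := hcardZ ▸ hlZ.mul_right _
  have h5 := (hl.dvd_iff_one_le_factorization Nat.card_pos.ne').1 h4
  rw [Nat.pow_eq_one] at hL1
  rcases hL1 with h | h
  · exact hl.one_lt.ne' h
  · omega

lemma lemClose {G : Type} [Group G] [Finite G] {p k : ℕ} (hp : p.Prime) (hG : IsPSolvable p G)
    (hO : ∀ N : Subgroup G, N.Normal → ¬ p ∣ Nat.card N → N = ⊥) (hA : PropA p k G) : PropB p k G := by
  haveI := Fact.mk hp
  intro P R D hDP hDR hD
  obtain ⟨N, hNn, hNp, hNmax⟩ := exists_Op (J := G) hp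
  have hC := hall_higman hp hG hO N hNn hNp hNmax
  have hPR : Nat.card R = Nat.card P := by rw [syl_card hp, syl_card hp]
  have hX : ⁅(P : Subgroup G), (P : Subgroup G)⁆ = ⁅(R : Subgroup G), (R : Subgroup G)⁆ := by
    rw [comm_le' hDP hD (hA P), comm_le' hDR (hPR ▸ hD) (hA R)]
  let J := (P : Subgroup G) ⊔ (R : Subgroup G)
  have hPJ : (P : Subgroup G) ≤ J := le_sup_left
  have hRJ : (R : Subgroup G) ≤ J := le_sup_right
  have hNJ : N ≤ J := (hNp.le_sylow_of_normal P).trans hPJ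
  have hcomm : ∀ S : Sylow p G, ∀ hS : (S : Subgroup G) ≤ J,
      (⁅((S.subtype hS : Sylow p J) : Subgroup J), ((S.subtype hS : Sylow p J) : Subgroup J)⁆).map J.subtype
        = ⁅(S : Subgroup G), (S : Subgroup G)⁆ := by
    intro S hS
    rw [Subgroup.map_commutator, Sylow.coe_subtype, Subgroup.subgroupOf_map_subtype, inf_eq_left.2 hS]
  have h := close_aux (J := J) hp (hG.sub J) (N.subgroupOf J) (hNn.subgroupOf J) (by
      exact hNp.comap_subtype) (by
      intro x hx
      apply hC
      rw [Subgroup.mem_centralizer_iff] at hx ⊢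
      intro n hn
      exact congrArg Subtype.val (hx ⟨n, hNJ hn⟩ hn)) (P.subtype hPJ) (R.subtype hRJ) (by
      apply Subgroup.map_injective J.subtype_injective
      rw [hcomm, hcomm, hX]) (by
      apply Subgroup.map_injective J.subtype_injective
      rw [Subgroup.map_sup, Sylow.coe_subtype, Sylow.coe_subtype, Subgroup.subgroupOf_map_subtype,
        Subgroup.subgroupOf_map_subtype, inf_eq_left.2 hPJ, inf_eq_left.2 hRJ,
        ← MonoidHom.range_eq_map, Subgroup.range_subtype])
  have h2 := congrArg (fun S : Sylow p J => (S : Subgroup J).map J.subtype) h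
  simp only [Sylow.coe_subtype, Subgroup.subgroupOf_map_subtype, inf_eq_left.2 hPJ,
    inf_eq_left.2 hRJ] at h2
  exact Sylow.ext h2

end Close2

section Inherit
variable {G : Type} [Group G] [Finite G] {p k : ℕ}

lemma syl_of_sub (hp : p.Prime) (H : Subgroup G) (hi : ¬ p ∣ H.index) (Q : Sylow p H) :
    ∃ P : Sylow p G, (P : Subgroup G) = (Q : Subgroup H).map H.subtype := by
  haveI := Fact.mk hp
  have hQ : IsPGroup p ((Q : Subgroup H).map H.subtype) := Q.2.map _
  obtain ⟨P, hQP, hPH⟩ := exists_syl_between hp H _ (Subgroup.map_subtype_le _) hQ hi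
  refine ⟨P, ?_⟩
  have h1 := Q.3 (P.subtype hPH).2 (by
    rw [Sylow.coe_subtype]
    intro x hx
    exact hQP ⟨x, hx, rfl⟩)
  rw [← h1, Sylow.coe_subtype, Subgroup.subgroupOf_map_subtype, inf_eq_left.2 hPH]

lemma PropA.sub (hp : p.Prime) (hA : PropA p k G) (H : Subgroup G) (hi : ¬ p ∣ H.index) :
    PropA p k H := by
  intro Q d hd hdk
  obtain ⟨P, hP⟩ := syl_of_sub hp H hi Q
  refine hA P d ?_ hdk
  have e : ((Q : Subgroup H).map H.subtype) ≃* (Q : Subgroup H) :=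
    ((Q : Subgroup H).equivMapOfInjective H.subtype H.subtype_injective).symm
  have := (Deg.equiv e).1 hd
  rw [← hP] at this
  exact this

lemma PropB.sub (hp : p.Prime) (hB : PropB p k G) (H : Subgroup G) (hi : ¬ p ∣ H.index) :
    PropB p k H := by
  intro Q R D hDQ hDR hc
  obtain ⟨P, hP⟩ := syl_of_sub hp H hi Q
  obtain ⟨S, hS⟩ := syl_of_sub hp H hi R
  have hcm : ∀ X : Subgroup H, Nat.card (X.map H.subtype) = Nat.card X := fun X =>
    Nat.card_congr (X.equivMapOfInjective H.subtype H.subtype_injective).symm.toEquiv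
  have h1 := hB P S (D.map H.subtype) (by rw [hP]; exact Subgroup.map_mono hDQ)
    (by rw [hS]; exact Subgroup.map_mono hDR) (by
      rw [hcm]
      have : Nat.card P = Nat.card Q := by
        have := hcm (Q : Subgroup H)
        rw [← hP] at this
        exact this
      rw [this]; exact hc)
  apply Sylow.ext
  apply Subgroup.map_injective H.subtype_injective
  rw [← hP, ← hS, h1]

lemma PropA.surj (hp : p.Prime) (hA : PropA p k G) {G' : Type} [Group G'] [Finite G'] (f : G →* G')
    (hf : Function.Surjective f) : PropA p k G' := by
  intro P' d hd hdk
  haveI := Fact.mk hp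
  obtain ⟨P, hP⟩ := Sylow.mapSurjective_surjective hf p P'
  refine hA P d ?_ hdk
  have h1 : (P : Subgroup G).map f = P' := by rw [← hP]; rfl
  have h2 : Deg ((P : Subgroup G).map f) d := by rw [h1]; exact hd
  exact h2.of_surj (f.subgroupMap P) (f.subgroupMap_surjective P)

lemma card_comap_mul {G' : Type} [Group G'] [Finite G'] (f : G →* G')
    (hf : Function.Surjective f) (D : Subgroup G') :
    Nat.card (D.comap f) = Nat.card D * Nat.card f.ker := by
  rw [← card_map_mul f (D.comap f), Subgroup.map_comap_eq_self_of_surjective hf,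
    inf_eq_right.2 (Subgroup.ker_le_comap f D)]

lemma PropB.surj (hp : p.Prime) (hB : PropB p k G) {G' : Type} [Group G'] [Finite G'] (f : G →* G')
    (hf : Function.Surjective f) : PropB p k G' := by
  intro P' R' D' hDP hDR hc
  haveI := Fact.mk hp
  obtain ⟨E, hEC, hEp, hEc, -⟩ := exists_syl_sub hp (D'.comap f)
  have key : ∀ S' : Sylow p G', D' ≤ S' → ∃ S : Sylow p G, E ≤ S ∧ (S : Subgroup G).map f = S' := by
    intro S' hDS
    obtain ⟨S, h1, h2⟩ := exists_syl_between hp ((S' : Subgroup G').comap f) E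
      (hEC.trans (Subgroup.comap_mono hDS)) hEp (by
        rw [Subgroup.index_comap_of_surjective _ hf]
        exact S'.not_dvd_index)
    refine ⟨S, h1, ?_⟩
    obtain ⟨T, hT⟩ := map_syl hp f hf S
    have := T.3 S'.2 (by rw [hT]; exact Subgroup.map_le_iff_le_comap.2 h2)
    rw [← hT]; exact this.symm
  obtain ⟨P, hP1, hP2⟩ := key P' hDP
  obtain ⟨R, hR1, hR2⟩ := key R' hDR
  have hPR : P = R := by
    apply hB P R E hP1 hR1
    have hD'p : IsPGroup p D' := P'.2.to_le hDP
    obtain ⟨a, ha⟩ := (card_pGroup hp D').1 hD'p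
    have hG : Nat.card G = Nat.card G' * Nat.card f.ker := by
      have := card_comap_mul f hf ⊤
      simpa using this
    rw [hEc, card_comap_mul f hf, ha, syl_card hp P, hG]
    rw [syl_card hp P', ha] at hc
    rw [Nat.factorization_mul Nat.card_pos.ne' Nat.card_pos.ne',
      Nat.factorization_mul (pow_pos hp.pos _).ne' Nat.card_pos.ne', Finsupp.add_apply,
      Finsupp.add_apply, hp.factorization_pow, Finsupp.single_eq_same, pow_add, pow_add, ← mul_assoc]
    exact Nat.mul_le_mul_right _ hc
  apply Sylow.ext
  rw [← hP2, ← hR2, hPR]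

lemma inf_ker_bot (hp : p.Prime) {G' : Type} [Group G'] (f : G →* G') (hk : ¬ p ∣ Nat.card f.ker)
    {X : Subgroup G} (hX : IsPGroup p X) : X ⊓ f.ker = ⊥ := by
  rw [eq_bot_iff]
  intro x hx
  exact inf_bot_of_pPrime hp hX hk hx.1 hx.2

lemma PropA.lift (hp : p.Prime) {G' : Type} [Group G'] [Finite G'] (hA : PropA p k G') (f : G →* G')
    (hf : Function.Surjective f) (hk : ¬ p ∣ Nat.card f.ker) : PropA p k G := by
  intro P d hd hdk
  obtain ⟨P', hP'⟩ := map_syl hp f hf P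
  refine hA P' d ?_ hdk
  have hinj : Function.Injective (f.subgroupMap P) := by
    rw [← MonoidHom.ker_eq_bot_iff, eq_bot_iff]
    intro x hx
    rw [MonoidHom.mem_ker] at hx
    have h1 : f x = 1 := congrArg Subtype.val hx
    have : (x : G) ∈ (P : Subgroup G) ⊓ f.ker := ⟨x.2, h1⟩
    rw [inf_ker_bot hp f hk P.2] at this
    exact Subtype.ext this
  have e := MulEquiv.ofBijective (f.subgroupMap P) ⟨hinj, f.subgroupMap_surjective P⟩
  have := (Deg.equiv e).2 hd
  rw [← hP'] at this
  exact this

lemma PropB.lift (hp : p.Prime) {G' : Type} [Group G'] [Finite G'] (hB : PropB p k G') (f : G →* G')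
    (hf : Function.Surjective f) (hk : ¬ p ∣ Nat.card f.ker) (hcen : ∀ x, f x = 1 → ∀ y, x * y = y * x) :
    PropB p k G := by
  intro P R D hDP hDR hc
  obtain ⟨P', hP'⟩ := map_syl hp f hf P
  obtain ⟨R', hR'⟩ := map_syl hp f hf R
  have hcm : ∀ X : Subgroup G, IsPGroup p X → Nat.card (X.map f) = Nat.card X := by
    intro X hX
    have := card_map_mul f X
    rw [inf_ker_bot hp f hk hX] at this
    simpa using this
  have h1 : P' = R' := by
    apply hB P' R' (D.map f) (by rw [hP']; exact Subgroup.map_mono hDP)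
      (by rw [hR']; exact Subgroup.map_mono hDR)
    have e1 : Nat.card P' = Nat.card P := by
      have := hcm (P : Subgroup G) P.2
      rw [← hP'] at this; exact this
    rw [e1, hcm D (P.2.to_le hDP)]
    exact hc
  have h2 : (R : Subgroup G) ≤ (P : Subgroup G) ⊔ f.ker := by
    apply le_of_map_le
    rw [← hP', ← hR', h1]
  obtain ⟨q, hq, h3⟩ := conj_of_le hp (inferInstance : f.ker.Normal) h2
  apply Sylow.ext
  ext x
  have h4 : q⁻¹ * x * q = x := by
    rw [mul_assoc, ← hcen q hq x, inv_mul_cancel_left]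
  have := h3 x
  rw [h4] at this
  exact this.symm

end Inherit

section LowerS

/-- the lower bound statement -/
def SS (p k n : ℕ) : Prop := ∀ (G : Type) [Group G] [Finite G] (M : Subgroup G), M.Normal →
  ¬ p ∣ Nat.card M → M.index = n → IsPSolvable p G → PropA p k G → PropB p k G →
  ∀ d, Deg G d → ¬ p ^ (k + 1) ∣ d → ¬ p ∣ d

variable {p k n : ℕ} {G : Type} [Group G] [Finite G] {M : Subgroup G}

lemma subStep (hp : p.Prime) (ih : ∀ m < n, SS p k m) (hMn : M.Normal) (hM : ¬ p ∣ Nat.card M)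
    (hn : M.index = n) (hG : IsPSolvable p G) (hA : PropA p k G) (hB : PropB p k G)
    (H : Subgroup G) (hMH : M ≤ H) (hH : H ≠ ⊤) (hi : ¬ p ∣ H.index) {d : ℕ} (hd : Deg H d)
    (hdk : ¬ p ^ (k + 1) ∣ d) : ¬ p ∣ d := by
  have h1 : M.relIndex H * H.index = M.index := Subgroup.relIndex_mul_index hMH
  have h2 : H.index ≠ 1 := fun h => hH (Subgroup.index_eq_one.1 h)
  have h3 : H.index ≠ 0 := H.index_ne_zero_of_finite
  have h4 : M.index ≠ 0 := M.index_ne_zero_of_finite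
  have h5 : M.relIndex H ≠ 0 := fun h => h4 (by rw [← h1, h, zero_mul])
  refine ih (M.relIndex H) ?_ H (M.subgroupOf H) (hMn.subgroupOf H) ?_ rfl (hG.sub H)
    (hA.sub hp H hi) (hB.sub hp H hi) d hd hdk
  · rw [← hn, ← h1]
    have : 2 ≤ H.index := by omega
    nlinarith [Nat.pos_of_ne_zero h5]
  · rwa [Nat.card_congr (Subgroup.subgroupOfEquivOfLe hMH).toEquiv]

lemma quotStep (hp : p.Prime) (ih : ∀ m < n, SS p k m) (hMn : M.Normal) (hM : ¬ p ∣ Nat.card M)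
    (hn : M.index = n) (hG : IsPSolvable p G) (hA : PropA p k G) (hB : PropB p k G)
    (N : Subgroup G) [N.Normal] (hN : IsPGroup p N) (hN0 : N ≠ ⊥) {d : ℕ} (hd : Deg (G ⧸ N) d)
    (hdk : ¬ p ^ (k + 1) ∣ d) : ¬ p ∣ d := by
  have hs := QuotientGroup.mk'_surjective N
  refine ih _ ?_ (G ⧸ N) (M.map (QuotientGroup.mk' N)) (hMn.map _ hs) ?_ rfl (hG.quot N)
    (hA.surj hp _ hs) (hB.surj hp _ hs) d hd hdk
  · rw [← hn, Subgroup.index_map, MonoidHom.range_eq_top.2 hs, Subgroup.index_top, mul_one, QuotientGroup.ker_mk']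
    apply Subgroup.index_strictAnti
    · refine lt_of_le_of_ne le_sup_left fun h => hN0 ?_
      rw [eq_bot_iff]
      intro x hx
      have : x ∈ M := by rw [h]; exact (le_sup_right : N ≤ M ⊔ N) hx
      exact inf_bot_of_pPrime hp hN hM hx this
  · intro h
    apply hM
    rw [← card_map_mul (QuotientGroup.mk' N) M]
    exact h.mul_right _

lemma lemW (hp : p.Prime) (ih : ∀ m < n, SS p k m) [hMn : M.Normal] (hM : ¬ p ∣ Nat.card M)
    (hn : M.index = n) (hG : IsPSolvable p G) (hA : PropA p k G) (hB : PropB p k G)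
    [Fintype G]
    {V : Type} [AddCommGroup V] [Module ℂ V] [FiniteDimensional ℂ V] {ρ : Representation ℂ G V}
    (hρ : IrrSub ρ ⊤ ⊤) (hd : ¬ p ^ (k + 1) ∣ Module.finrank ℂ V) :
    ¬ p ∣ Module.finrank ℂ V ∨ ∃ w : Wt M,
      eig (fun x : M => csum (ρ.comp M.subtype : Representation ℂ M V) x) w = ⊤ := by
  haveI := Fact.mk hp
  obtain ⟨W, _, hW⟩ := exists_irrSub (SInv.top (ρ.comp M.subtype : Representation ℂ M V) ⊤) hρ.2.1
  obtain ⟨w, hw⟩ := exists_weight _ hW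
  obtain ⟨v0, hv0, hv00⟩ := Submodule.exists_mem_ne_zero_of_ne_bot hW.2.1
  have hid : idem M w ≠ 0 := idem_ne_zero_of_weight _ (hw hv0) hv00
  have hcl := clifford (equivar_csum M ρ ⊤) hρ w (by
    rw [top_inf_eq]
    intro h
    apply hv00
    have := hw hv0
    rw [h] at this
    simpa using this)
  rw [top_inf_eq] at hcl
  simp only [finrank_top, Subgroup.relIndex_top_right, inf_top_eq] at hcl
  obtain ⟨hdim, hirr⟩ := hcl
  set H := MulAction.stabilizer G w with hHdef
  have hMH : M ≤ H := le_stab M hid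
  obtain ⟨E, hEH, hE, hEc, P, hEP⟩ := exists_syl_sub hp H
  have hPE : Nat.card P ≤ p ^ k * Nat.card E := by
    rw [hEc, syl_card hp P, ← pow_add, ← H.card_mul_index,
      Nat.factorization_mul Nat.card_pos.ne' H.index_ne_zero_of_finite, Finsupp.add_apply]
    apply Nat.pow_le_pow_right hp.pos
    have : ¬ p ^ (k + 1) ∣ H.index := fun h => hd (by rw [hdim]; exact h.mul_right _)
    rw [hp.pow_dvd_iff_le_factorization H.index_ne_zero_of_finite] at this
    omega
  have hPH : (P : Subgroup G) ≤ H := by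
    by_contra hcon
    obtain ⟨g, hg, hgH⟩ := Set.not_subset.1 hcon
    obtain ⟨q, hq1, g', hg', hq2⟩ := fixed_of_weight hp hM hEP P.2 hid (fun e he => hEH he)
      ⟨g, hg, hgH⟩
    have hR : P = (q : G) • P := by
      refine hB P ((q : G) • P) E hEP ?_ hPE
      intro e he
      have h1 := (conjN_fix M e q).1 (hq1 e he)
      have : e = (q : G) * e * (q : G)⁻¹ := by rw [← h1]; group
      rw [this]
      exact ⟨e, hEP he, rfl⟩
    apply hq2
    rw [conjN_fix]
    have h2 : (q : G) * g' * (q : G)⁻¹ ∈ (P : Subgroup G) := by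
      rw [hR]
      exact ⟨g', hg', rfl⟩
    have h3 : (q : G) * g' * (q : G)⁻¹ * g'⁻¹ ∈ (P : Subgroup G) := P.mul_mem h2 (P.inv_mem hg')
    have h4 : (q : G) * g' * (q : G)⁻¹ * g'⁻¹ ∈ M := by
      have := M.mul_mem q.2 (hMn.conj_mem _ (M.inv_mem q.2) g')
      simpa [mul_assoc] using this
    have h5 := inf_bot_of_pPrime hp P.2 hM h3 h4
    have h6 : (q : G) * g' = ((q : G) * g' * (q : G)⁻¹ * g'⁻¹) * (g' * q) := by group
    rw [h6, h5, one_mul]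
  have hi : ¬ p ∣ H.index := fun h => P.not_dvd_index (h.trans (Subgroup.index_dvd_of_le hPH))
  by_cases hH : H = ⊤
  · right
    refine ⟨w, ?_⟩
    rw [hH] at hirr
    rcases hρ.2.2 _ le_top hirr.1 with h | h
    · exact absurd h hirr.2.1
    · exact h
  · left
    intro h
    rw [hdim] at h hd
    rcases (hp.dvd_mul).1 h with h | h
    · exact hi h
    · exact subStep hp ih hMn hM hn hG hA hB H hMH hH hi (deg_of_irrSub hirr)
        (fun h' => hd (h'.mul_left _)) h

lemma lemN (hp : p.Prime) (ih : ∀ m < n, SS p k m) [hMn : M.Normal] (hM : ¬ p ∣ Nat.card M)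
    (hn : M.index = n) (hG : IsPSolvable p G) (hA : PropA p k G) (hB : PropB p k G)
    (N : Subgroup G) [hNn : N.Normal] (hN : IsPGroup p N) (hN0 : N ≠ ⊥)
    {V : Type} [AddCommGroup V] [Module ℂ V] [FiniteDimensional ℂ V] {ρ : Representation ℂ G V}
    (hρ : IrrSub ρ ⊤ ⊤) (hd : ¬ p ^ (k + 1) ∣ Module.finrank ℂ V) :
    ¬ p ∣ Module.finrank ℂ V := by
  haveI := Fact.mk hp
  obtain ⟨P⟩ : Nonempty (Sylow p G) := inferInstance
  have hNP : N ≤ P := hN.le_sylow_of_normal P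
  obtain ⟨L, -, hL, hLd⟩ := exists_irrSub_not_dvd (SInv.top ρ (P : Subgroup G)) (p ^ (k + 1))
    (by simpa using hd)
  have hL1 : Module.finrank ℂ L = 1 := by
    have h1 := deg_of_irrSub hL
    haveI := Fintype.ofFinite (P : Subgroup G)
    obtain ⟨a, ha⟩ := h1.of_pGroup hp P.2
    refine hA P _ h1 ?_
    rw [ha] at hLd ⊢
    apply Nat.pow_le_pow_right hp.pos
    by_contra hcon
    exact hLd (pow_dvd_pow p (by omega))
  obtain ⟨μ, hμ⟩ := lin_char hL.1 hL1
  obtain ⟨v0, hv0, hv00⟩ := Submodule.exists_mem_ne_zero_of_ne_bot hL.2.1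
  let w : Wt N := fun x => μ ⟨x, hNP x.2⟩
  have hv0e : v0 ∈ eig (fN ρ N) w := fun x => hμ ⟨x, hNP x.2⟩ v0 hv0
  have hcl := clifford (equivar_fN ρ N ⊤) hρ w (by
    rw [top_inf_eq]
    intro h
    apply hv00
    rw [h] at hv0e
    simpa using hv0e)
  rw [top_inf_eq] at hcl
  simp only [finrank_top, Subgroup.relIndex_top_right, inf_top_eq] at hcl
  obtain ⟨hdim, hirr⟩ := hcl
  set H := MulAction.stabilizer G w with hHdef
  have hMH : M ≤ H := by
    intro m hm
    rw [MulAction.mem_stabilizer_iff]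
    funext x
    rw [wt_smul_apply]
    congr 1
    rw [conjN_fix]
    have h1 : m⁻¹ * x * m * (x : G)⁻¹ ∈ N := by
      have := N.mul_mem (hNn.conj_mem x x.2 m⁻¹) (N.inv_mem x.2)
      simpa using this
    have h2 : m⁻¹ * x * m * (x : G)⁻¹ ∈ M := by
      have := M.mul_mem (M.inv_mem hm) (hMn.conj_mem m hm x)
      simpa [mul_assoc] using this
    have h3 := inf_bot_of_pPrime hp hN hM h1 h2
    have h4 : m⁻¹ * (x : G) = (m⁻¹ * x * m * (x : G)⁻¹) * (x * m⁻¹) := by group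
    rw [h4, h3, one_mul]
  have hPH : (P : Subgroup G) ≤ H := by
    intro g hg
    rw [MulAction.mem_stabilizer_iff]
    funext x
    rw [wt_smul_apply]
    have h1 : (⟨_, hNP (g⁻¹ • x : N).2⟩ : (P : Subgroup G)) = (⟨g, hg⟩ : (P : Subgroup G))⁻¹ * ⟨x, hNP x.2⟩ * ⟨g, hg⟩ := by
      apply Subtype.ext
      simp [conjN_coe]
    change μ ⟨_, hNP (g⁻¹ • x : N).2⟩ = μ ⟨x, hNP x.2⟩
    rw [h1, map_mul, map_mul, mul_right_comm, ← map_mul, inv_mul_cancel, map_one, one_mul]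
  have hi : ¬ p ∣ H.index := fun h => P.not_dvd_index (h.trans (Subgroup.index_dvd_of_le hPH))
  by_cases hH : H = ⊤
  swap
  · intro h
    rw [hdim] at h hd
    rcases (hp.dvd_mul).1 h with h | h
    · exact hi h
    · exact subStep hp ih hMn hM hn hG hA hB H hMH hH hi (deg_of_irrSub hirr)
        (fun h' => hd (h'.mul_left _)) h
  have htop : eig (fN ρ N) w = ⊤ := by
    rw [hH] at hirr
    rcases hρ.2.2 _ le_top hirr.1 with h | h
    · exact absurd h hirr.2.1
    · exact h
  have hsc : ∀ (x : N) (v : V), ρ x v = w x • v := fun x v => by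
    have : v ∈ eig (fN ρ N) w := htop ▸ Submodule.mem_top
    exact this x
  by_cases hK : N ⊓ (MonoidHom.ker (ρ : G →* (V →ₗ[ℂ] V))) = ⊥
  swap
  · haveI : (N ⊓ (MonoidHom.ker (ρ : G →* (V →ₗ[ℂ] V)))).Normal := inferInstance
    refine quotStep hp ih hMn hM hn hG hA hB _ (hN.to_le inf_le_left) hK
      (deg_factor (QuotientGroup.mk' _) (QuotientGroup.mk'_surjective _) ρ hρ ?_) hd
    intro g hg
    exact ((QuotientGroup.eq_one_iff g).1 hg).2
  have hcen : ∀ x ∈ N, ∀ g : G, g⁻¹ * x * g = x := by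
    intro x hx g
    have h1 : g⁻¹ * x * g * x⁻¹ ∈ N ⊓ (MonoidHom.ker (ρ : G →* (V →ₗ[ℂ] V))) := by
      refine ⟨?_, ?_⟩
      · have := N.mul_mem (hNn.conj_mem x hx g⁻¹) (N.inv_mem hx)
        simpa using this
      · change ρ (g⁻¹ * x * g * x⁻¹) = 1
        ext v
        have e1 := hsc ⟨x, hx⟩
        simp only at e1
        rw [map_mul, map_mul, map_mul]
        simp only [Module.End.mul_apply]
        rw [e1, map_smul, rho_inv_apply, ← e1, rho_apply_inv]
        rfl
    rw [hK, Subgroup.mem_bot, mul_inv_eq_one] at h1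
    exact h1
  -- transfer
  let μu : (P : Subgroup G) →* ℂˣ := μ.toHomUnits
  have hμu : ∀ x, ((μu x : ℂˣ) : ℂ) = μ x := fun x => rfl
  let τ : G →* ℂˣ := MonoidHom.transfer μu
  have hτ : ∀ x : N, ((τ x : ℂˣ) : ℂ) = w x ^ (P : Subgroup G).index := by
    intro x
    have := MonoidHom.transfer_eq_pow μu (x : G) (by
      intro j g0 _
      exact hcen _ (N.pow_mem x.2 j) g0)
    change ((MonoidHom.transfer μu (x : G) : ℂˣ) : ℂ) = _
    rw [this, hμu]
    have h2 : (⟨(x : G) ^ (P : Subgroup G).index, MonoidHom.transfer_eq_pow_aux _ (by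
      intro j g0 _
      exact hcen _ (N.pow_mem x.2 j) g0)⟩ : (P : Subgroup G)) = (⟨x, hNP x.2⟩ : (P : Subgroup G)) ^ (P : Subgroup G).index := by
      apply Subtype.ext; rfl
    rw [h2, map_pow]
  have hcop : Nat.Coprime (P : Subgroup G).index (Nat.card N) := by
    obtain ⟨a, ha⟩ := (card_pGroup hp N).1 hN
    rw [ha]
    exact Nat.Coprime.pow_right _ ((hp.coprime_iff_not_dvd.2 P.not_dvd_index).symm)
  obtain ⟨j, hj⟩ : ∃ j : ℕ, (P : Subgroup G).index * j ≡ 1 [MOD Nat.card N] := by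
    obtain ⟨j, hj⟩ := Nat.exists_mul_mod_eq_of_coprime 1 hcop Nat.card_pos.ne'
    exact ⟨j, by first | exact hj | exact hj.2⟩
  let δ : G →* ℂ := (Units.coeHom ℂ).comp (τ ^ j)
  have hδ : ∀ x : N, δ x = w x := by
    intro x
    have h1 : δ x = ((τ x : ℂˣ) : ℂ) ^ j := by
      simp [δ]
    rw [h1, hτ, ← pow_mul]
    have h2 : w x ^ Nat.card N = 1 := by
      change μ _ ^ _ = 1
      rw [← map_pow]
      have : (⟨x, hNP x.2⟩ : (P : Subgroup G)) ^ Nat.card N = 1 := by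
        apply Subtype.ext
        have := pow_card_eq_one' (x := x)
        have h6 := congrArg Subtype.val this
        rw [Subgroup.coe_pow] at h6
        exact h6
      rw [this, map_one]
    have h3 := pow_eq_pow_mod ((P : Subgroup G).index * j) h2
    have h4 := pow_eq_pow_mod 1 h2
    rw [h3, hj, ← h4, pow_one]
  have hρ' : IrrSub (twist (muInv δ) ρ) ⊤ ⊤ := by
    rw [irrSub_twist]; exact hρ
  refine quotStep hp ih hMn hM hn hG hA hB N hN hN0
      (deg_factor (QuotientGroup.mk' _) (QuotientGroup.mk'_surjective _) _ hρ' ?_) hd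
  intro g hg
  have hgN := (QuotientGroup.eq_one_iff g).1 hg
  ext v
  rw [twist_apply, muInv_apply, hδ ⟨g, hgN⟩, hsc ⟨g, hgN⟩, inv_smul_smul₀ (mu_ne μ _)]
  rfl

end LowerS

section LowerC
variable {p k n : ℕ}

lemma lemC1 (hp : p.Prime) (ih : ∀ m < n, SS p k m) {G : Type} [Group G] [Finite G]
    {M : Subgroup G} [hMn : M.Normal] (hM : ¬ p ∣ Nat.card M)
    (hn : M.index = n) (hG : IsPSolvable p G) (hA : PropA p k G) (hB : PropB p k G)
    (hcen : ∀ m ∈ M, ∀ g : G, m * g = g * m) {d : ℕ} (hd : Deg G d) (hdk : ¬ p ^ (k + 1) ∣ d) :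
    ¬ p ∣ d := by
  haveI := Fact.mk hp
  haveI := Fintype.ofFinite G
  by_cases htop : M = ⊤
  · refine Deg.of_pPrime hp ?_ hd
    rw [htop, Subgroup.card_top] at hM
    exact hM
  have hqt : (⊤ : Subgroup (G ⧸ M)) ≠ ⊥ := by
    intro h
    apply htop
    rw [eq_top_iff]
    intro x _
    have : QuotientGroup.mk' M x ∈ (⊤ : Subgroup (G ⧸ M)) := trivial
    rw [h, Subgroup.mem_bot] at this
    exact (QuotientGroup.eq_one_iff x).1 this
  have hs := QuotientGroup.mk'_surjective M
  obtain ⟨Yb, _, hYbn, hYb, hcase⟩ := exists_normal_sub hp (hG.quot M) ⊤ inferInstance hqt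
  let Y := Yb.comap (QuotientGroup.mk' M)
  haveI hYn : Y.Normal := hYbn.comap _
  have hMY : M ≤ Y := by
    have := Subgroup.ker_le_comap (QuotientGroup.mk' M) Yb
    rwa [QuotientGroup.ker_mk'] at this
  have hcY : Nat.card Y = Nat.card Yb * Nat.card M := by
    have := card_comap_mul _ hs Yb
    rwa [QuotientGroup.ker_mk'] at this
  have hlt : M < Y := by
    refine lt_of_le_of_ne hMY fun h => hYb ?_
    rw [eq_bot_iff]
    intro y hy
    obtain ⟨x, rfl⟩ := hs y
    have hx : x ∈ Y := hy
    rw [← h] at hx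
    exact (QuotientGroup.eq_one_iff x).2 hx
  rcases hcase with hYp | hYp
  swap
  · refine ih Y.index ?_ G Y hYn ?_ rfl hG hA hB d hd hdk
    · rw [← hn]; exact Subgroup.index_strictAnti hlt
    · rw [hcY]; exact hp.not_dvd_mul hYp hM
  obtain ⟨E, hEY, hE, hEc, -⟩ := exists_syl_sub hp Y
  obtain ⟨a, ha⟩ := (card_pGroup hp Yb).1 hYp
  have hEc' : Nat.card E = p ^ a := by
    rw [hEc, hcY, ha, Nat.factorization_mul (pow_pos hp.pos _).ne' Nat.card_pos.ne', Finsupp.add_apply,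
      Nat.factorization_eq_zero_of_not_dvd hM, hp.factorization_pow, Finsupp.single_eq_same, add_zero]
  have hsup : M ⊔ E = Y := by
    apply Subgroup.eq_of_le_of_card_ge (sup_le hMY hEY)
    have h1 : Nat.card E ∣ Nat.card (M ⊔ E : Subgroup G) := Subgroup.card_dvd_of_le le_sup_right
    have h2 : Nat.card M ∣ Nat.card (M ⊔ E : Subgroup G) := Subgroup.card_dvd_of_le le_sup_left
    have hco : Nat.Coprime (Nat.card E) (Nat.card M) := by
      rw [hEc']
      exact Nat.Coprime.pow_left _ (hp.coprime_iff_not_dvd.2 hM)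
    have h3 := hco.mul_dvd_of_dvd_of_dvd h1 h2
    rw [hcY, ha, ← hEc']
    exact Nat.le_of_dvd Nat.card_pos h3
  have hEn : E.Normal := by
    refine ⟨fun x hx g => ?_⟩
    have h1 : g * x * g⁻¹ ∈ M ⊔ E := hsup ▸ hYn.conj_mem x (hEY hx) g
    obtain ⟨m, hm, e, he, hme⟩ := Subgroup.mem_sup_of_normal_left.1 h1
    obtain ⟨b, hb⟩ := hE ⟨x, hx⟩
    obtain ⟨c, hc⟩ := hE ⟨e, he⟩
    have hb' : x ^ p ^ b = 1 := congrArg Subtype.val hb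
    have hc' : e ^ p ^ c = 1 := congrArg Subtype.val hc
    have h2 : (m * e) ^ (p ^ b * p ^ c) = 1 := by
      rw [hme, conj_pow, pow_mul, hb', one_pow, mul_one, mul_inv_cancel]
    rw [Commute.mul_pow (hcen m hm e), mul_comm (p ^ b), pow_mul e, hc', one_pow, mul_one, ← pow_add] at h2
    have h3 : m = 1 := by
      have h4 : orderOf m ∣ p ^ (c + b) := orderOf_dvd_of_pow_eq_one h2
      have h5 : orderOf m ∣ Nat.card M := Subgroup.orderOf_dvd_natCard M hm
      have h6 : Nat.Coprime (p ^ (c + b)) (Nat.card M) :=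
        Nat.Coprime.pow_left _ (hp.coprime_iff_not_dvd.2 hM)
      rw [← orderOf_eq_one_iff]
      exact Nat.eq_one_of_dvd_coprimes h6 h4 h5
    rw [← hme, h3, one_mul]
    exact he
  have hE0 : E ≠ ⊥ := by
    rintro rfl
    rw [sup_bot_eq] at hsup
    exact hlt.ne hsup
  obtain ⟨V, _, _, _, ρ, hρ, rfl⟩ := hd
  exact lemN hp ih hM hn hG hA hB E hE hE0 hρ hdk

lemma lemC2 (hp : p.Prime) (ih : ∀ m < n, SS p k m) {G : Type} [Group G] [Finite G]
    {M : Subgroup G} [hMn : M.Normal] (hM : ¬ p ∣ Nat.card M)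
    (hn : M.index = n) (hG : IsPSolvable p G) (hA : PropA p k G) (hB : PropB p k G)
    {V : Type} [AddCommGroup V] [Module ℂ V] [FiniteDimensional ℂ V] {ρ : Representation ℂ G V}
    (hρ : IrrSub ρ ⊤ ⊤) (hsc : ∀ m ∈ M, ∃ c : ℂ, ∀ v, ρ m v = c • v)
    (hd : ¬ p ^ (k + 1) ∣ Module.finrank ℂ V) :
    ¬ p ∣ Module.finrank ℂ V := by
  let K : Subgroup G := M ⊓ (MonoidHom.ker (ρ : G →* (V →ₗ[ℂ] V)))
  have hKn : K.Normal := inferInstance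
  have hs := QuotientGroup.mk'_surjective K
  have hD : Deg (G ⧸ K) (Module.finrank ℂ V) := by
    refine deg_factor (QuotientGroup.mk' K) hs ρ hρ ?_
    intro g hg
    exact ((QuotientGroup.eq_one_iff g).1 hg).2
  haveI : (M.map (QuotientGroup.mk' K)).Normal := hMn.map _ hs
  refine lemC1 (M := M.map (QuotientGroup.mk' K)) hp ih ?_ ?_ (hG.quot K) (hA.surj hp _ hs)
    (hB.surj hp _ hs) ?_ hD hd
  · intro h
    apply hM
    rw [← card_map_mul (QuotientGroup.mk' K) M]
    exact h.mul_right _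
  · rw [Subgroup.index_map_eq _ hs (by rw [QuotientGroup.ker_mk']; exact inf_le_left), hn]
  · rintro _ ⟨m, hm, rfl⟩ y
    obtain ⟨g, rfl⟩ := hs y
    rw [← map_mul, ← map_mul]
    have h1 : (m * g) * (g * m)⁻¹ ∈ K := by
      refine ⟨?_, ?_⟩
      · have := M.mul_mem hm (hMn.conj_mem _ (M.inv_mem hm) g)
        simpa [mul_assoc] using this
      · change ρ ((m * g) * (g * m)⁻¹) = 1
        obtain ⟨c, hc⟩ := hsc m hm
        have : ρ (m * g) = ρ (g * m) := by
          ext v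
          rw [map_mul, map_mul, Module.End.mul_apply, Module.End.mul_apply, hc, hc, map_smul]
        rw [map_mul, this, ← map_mul, mul_inv_cancel, map_one]
    have h2 := (QuotientGroup.eq_one_iff _).2 h1
    have h3 : QuotientGroup.mk' K (m * g * (g * m)⁻¹) = 1 := h2
    rw [map_mul, map_inv, mul_inv_eq_one] at h3
    exact h3

end LowerC

section HomU
variable {G : Type} [Group G] {M : Subgroup G} {V : Type} [AddCommGroup V] [Module ℂ V]
  {W : Type} [AddCommGroup W] [Module ℂ W]

/-- intertwiners with values in a subspace -/
def homU (ρ : Representation ℂ G V) (τ : Representation ℂ M W) (X : Submodule ℂ V) :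
    Submodule ℂ (W →ₗ[ℂ] V) where
  carrier := {φ | (∀ (m : M) v, φ (τ m v) = ρ m (φ v)) ∧ ∀ v, φ v ∈ X}
  add_mem' := by
    rintro a b ⟨ha, ha'⟩ ⟨hb, hb'⟩
    refine ⟨fun m v => ?_, fun v => X.add_mem (ha' v) (hb' v)⟩
    simp only [LinearMap.add_apply, ha, hb, map_add]
  zero_mem' := ⟨fun m v => by simp, fun v => by simp⟩
  smul_mem' := by
    rintro c a ⟨ha, ha'⟩
    refine ⟨fun m v => ?_, fun v => X.smul_mem c (ha' v)⟩
    simp only [LinearMap.smul_apply, ha, map_smul]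

lemma mem_homU {ρ : Representation ℂ G V} {τ : Representation ℂ M W} {X : Submodule ℂ V}
    {φ : W →ₗ[ℂ] V} : φ ∈ homU ρ τ X ↔ (∀ (m : M) v, φ (τ m v) = ρ m (φ v)) ∧ ∀ v, φ v ∈ X := Iff.rfl

lemma exists_proj {A X : Submodule ℂ V} (h : A ⊓ X = ⊥) (θ : W →ₗ[ℂ] V)
    (hθ : Function.Injective θ) (hA : LinearMap.range θ = A) :
    ∃ Λ : V →ₗ[ℂ] W, (∀ v, Λ (θ v) = v) ∧ ∀ x ∈ X, Λ x = 0 := by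
  obtain ⟨q, h1, h2⟩ := IsModularLattice.exists_inf_eq_and_codisjoint (le_sup_right : X ≤ A ⊔ X)
  have hXq : X ≤ q := h1 ▸ inf_le_right
  have hc : IsCompl (LinearMap.range θ) q := by
    rw [hA]
    constructor
    · rw [disjoint_iff, eq_bot_iff]
      intro x hx
      have : x ∈ X := by
        rw [← h1]
        exact ⟨(le_sup_left : A ≤ A ⊔ X) hx.1, hx.2⟩
      rw [← h]
      exact ⟨hx.1, this⟩
    · rw [codisjoint_iff] at h2 ⊢
      rw [← h2, sup_assoc, sup_eq_right.2 hXq]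
  exact ⟨LinearMap.linearProjOfIsCompl q θ hθ hc, fun v => LinearMap.linearProjOfIsCompl_apply_left _ _ _ _ v,
    fun x hx => LinearMap.linearProjOfIsCompl_apply_right' _ _ _ _ _ (hXq hx)⟩

variable [Finite G] [FiniteDimensional ℂ V] [FiniteDimensional ℂ W]

lemma homU_le {ρ : Representation ℂ G V} {τ : Representation ℂ M W} (hτ : IrrSub τ ⊤ ⊤)
    (hiso : ∀ A, IrrSub ρ M A → ∃ θ : W →ₗ[ℂ] V, Function.Injective θ ∧ LinearMap.range θ = A ∧
      ∀ (m : M) v, θ (τ m v) = ρ m (θ v)) :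
    Module.finrank ℂ W * Module.finrank ℂ (homU ρ τ ⊤) ≤ Module.finrank ℂ V := by
  suffices h : Module.finrank ℂ W * Module.finrank ℂ (homU ρ τ ⊤) ≤
      Module.finrank ℂ (⊤ : Submodule ℂ V) by simpa using h
  refine inv_induction' (ρ := ρ) (H := M)
    (fun X => Module.finrank ℂ W * Module.finrank ℂ (homU ρ τ X) ≤ Module.finrank ℂ X)
    (SInv.top ρ M) ?_ ?_
  · have : homU ρ τ ⊥ = ⊥ := by
      rw [eq_bot_iff]
      rintro φ ⟨-, h⟩
      rw [Submodule.mem_bot]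
      ext v
      simpa using h v
    rw [this]
    simp
  · intro A X _ _ hA hX hAX hC
    obtain ⟨θ, hθ, hθA, hθe⟩ := hiso A hA
    obtain ⟨Λ, hΛ1, hΛ2⟩ := exists_proj hAX θ hθ hθA
    have hdimA : Module.finrank ℂ A = Module.finrank ℂ W := by
      rw [← hθA, LinearMap.finrank_range_of_inj hθ]
    have hdim : Module.finrank ℂ (A ⊔ X : Submodule ℂ V) = Module.finrank ℂ W + Module.finrank ℂ X := by
      have := Submodule.finrank_sup_add_finrank_inf_eq A X
      rw [hAX, finrank_bot, add_zero, hdimA] at this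
      exact this
    have hscal : ∀ φ ∈ homU ρ τ (A ⊔ X), ∃ c : ℂ, ∀ v, Λ (φ v) = c • v := by
      rintro φ ⟨h1, h2⟩
      obtain ⟨c, hc⟩ := schur hτ (Λ ∘ₗ φ) (fun _ _ => trivial) (by
        intro m _ v _
        simp only [LinearMap.comp_apply]
        rw [h1]
        obtain ⟨a, ha, x, hx, hax⟩ := Submodule.mem_sup.1 (h2 v)
        rw [← hax, map_add, map_add, map_add, hΛ2 x hx, hΛ2 _ (hX m m.2 x hx), add_zero, add_zero]
        rw [← hθA] at ha
        obtain ⟨u, rfl⟩ := ha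
        rw [← hθe, hΛ1, hΛ1])
      exact ⟨c, fun v => hc v trivial⟩
    obtain ⟨v0, -, hv0⟩ := Submodule.exists_mem_ne_zero_of_ne_bot hτ.2.1
    let Φ : homU ρ τ (A ⊔ X) →ₗ[ℂ] W :=
      (Λ ∘ₗ LinearMap.applyₗ v0) ∘ₗ (homU ρ τ (A ⊔ X)).subtype
    have hΦ : ∀ φ, Φ φ = Λ (φ.1 v0) := fun φ => rfl
    have hr : Module.finrank ℂ (LinearMap.range Φ) ≤ 1 := by
      have : LinearMap.range Φ ≤ ℂ ∙ v0 := by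
        rintro _ ⟨φ, rfl⟩
        obtain ⟨c, hc⟩ := hscal φ.1 φ.2
        rw [hΦ, hc]
        exact Submodule.smul_mem _ _ (Submodule.mem_span_singleton_self v0)
      exact (Submodule.finrank_mono this).trans (finrank_span_singleton hv0).le
    have hk : Module.finrank ℂ (LinearMap.ker Φ) ≤ Module.finrank ℂ (homU ρ τ X) := by
      rw [← Submodule.finrank_map_subtype_eq (homU ρ τ (A ⊔ X)) (LinearMap.ker Φ)]
      apply Submodule.finrank_mono
      rintro _ ⟨φ, hφ, rfl⟩
      have hφ' : Φ φ = 0 := hφ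
      obtain ⟨c, hc⟩ := hscal φ.1 φ.2
      rw [hΦ, hc, smul_eq_zero, or_iff_left hv0] at hφ'
      refine ⟨φ.2.1, fun v => ?_⟩
      have h3 := hc v
      rw [hφ', zero_smul] at h3
      obtain ⟨a, ha, x, hx, hax⟩ := Submodule.mem_sup.1 (φ.2.2 v)
      rw [← hax, map_add, hΛ2 x hx, add_zero] at h3
      rw [← hθA] at ha
      obtain ⟨u, rfl⟩ := ha
      rw [hΛ1] at h3
      rw [h3, map_zero, zero_add] at hax
      change φ.1 v ∈ X
      rw [← hax]
      exact hx
    have hrn := LinearMap.finrank_range_add_finrank_ker Φ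
    rw [hdim, ← hrn, mul_add]
    have := Nat.mul_le_mul_left (Module.finrank ℂ W) hr
    have := Nat.mul_le_mul_left (Module.finrank ℂ W) hk
    omega

end HomU

section Gamma
variable {G : Type} [Group G] {M : Subgroup G} [hMn : M.Normal] {V : Type} [AddCommGroup V] [Module ℂ V]
  {W : Type} [AddCommGroup W] [Module ℂ W]

/-- the group of normalized intertwiners -/
def Gam (τ : Representation ℂ M W) : Subgroup ((W ≃ₗ[ℂ] W) × G) where
  carrier := {x | (∀ (m : M) v, x.1 (τ m v) = τ (x.2 • m) (x.1 v)) ∧ LinearEquiv.det x.1 = 1}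
  mul_mem' := by
    rintro x y ⟨hx, hx'⟩ ⟨hy, hy'⟩
    refine ⟨fun m v => ?_, ?_⟩
    · rw [Prod.fst_mul, Prod.snd_mul, LinearEquiv.mul_apply, LinearEquiv.mul_apply, hy, hx, mul_smul]
    · rw [Prod.fst_mul, map_mul, hx', hy', one_mul]
  one_mem' := by
    refine ⟨fun m v => ?_, ?_⟩
    · simp
    · simp
  inv_mem' := by
    rintro x ⟨hx, hx'⟩
    refine ⟨fun m v => ?_, ?_⟩
    · apply x.1.injective
      rw [hx, Prod.snd_inv, smul_inv_smul, Prod.fst_inv, ← LinearEquiv.mul_apply,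
        ← LinearEquiv.mul_apply, mul_inv_cancel]
      rfl
    · rw [Prod.fst_inv, map_inv, hx', inv_one]

/-- projection to the group -/
def gamPr (τ : Representation ℂ M W) : Gam τ →* G := (MonoidHom.snd _ _).comp (Gam τ).subtype

lemma gamPr_apply (τ : Representation ℂ M W) (x : Gam τ) : gamPr τ x = x.1.2 := rfl

/-- action on homomorphisms -/
def homRep (ρ : Representation ℂ G V) (τ : Representation ℂ M W) :
    Representation ℂ (Gam τ) (W →ₗ[ℂ] V) where
  toFun x :=
    { toFun := fun φ => (ρ x.1.2) ∘ₗ φ ∘ₗ (x.1.1⁻¹ : W ≃ₗ[ℂ] W).toLinearMap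
      map_add' := by intro a b; ext v; simp
      map_smul' := by intro a b; ext v; simp }
  map_one' := by ext φ v; simp
  map_mul' x y := by ext φ v; simp [mul_inv_rev]

lemma homRep_apply (ρ : Representation ℂ G V) (τ : Representation ℂ M W) (x : Gam τ) (φ : W →ₗ[ℂ] V)
    (v : W) : homRep ρ τ x φ v = ρ x.1.2 (φ ((x.1.1⁻¹ : W ≃ₗ[ℂ] W) v)) := rfl

lemma homRep_inv (ρ : Representation ℂ G V) (τ : Representation ℂ M W) :
    SInv (homRep ρ τ) ⊤ (homU ρ τ ⊤) := by
  rintro x - φ ⟨h1, -⟩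
  refine ⟨fun m v => ?_, fun _ => trivial⟩
  have h2 := ((Gam τ).inv_mem x.2).1 m v
  simp only [Prod.fst_inv, Prod.snd_inv] at h2
  rw [homRep_apply, homRep_apply, h2, h1, conjN_coe, ← Module.End.mul_apply, ← Module.End.mul_apply,
    ← map_mul, ← map_mul]
  congr 2
  group

lemma gam_scalar [FiniteDimensional ℂ W] {τ : Representation ℂ M W} (hτ : IrrSub τ ⊤ ⊤) (x : Gam τ) (m0 : M) (h : x.1.2 = m0) :
    ∃ c : ℂ, ∀ v, x.1.1 v = c • τ m0 v := by
  obtain ⟨c, hc⟩ := schur hτ (τ m0⁻¹ ∘ₗ x.1.1.toLinearMap) (fun _ _ => trivial) (by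
    intro m _ v _
    simp only [LinearMap.comp_apply, LinearEquiv.coe_coe]
    rw [x.2.1, ← Module.End.mul_apply, ← Module.End.mul_apply, ← map_mul, ← map_mul]
    congr 2
    apply Subtype.ext
    rw [Subgroup.coe_mul, Subgroup.coe_mul, conjN_coe, h, Subgroup.coe_inv]
    group)
  refine ⟨c, fun v => ?_⟩
  have := hc v trivial
  simp only [LinearMap.comp_apply, LinearEquiv.coe_coe] at this
  rw [← map_smul, ← this, rho_apply_inv]

lemma gam_ker [FiniteDimensional ℂ W] {τ : Representation ℂ M W} (hτ : IrrSub τ ⊤ ⊤) (x : Gam τ)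
    (h : gamPr τ x = 1) : ∃ c : ℂ, c ^ Module.finrank ℂ W = 1 ∧ ∀ v, x.1.1 v = c • v := by
  obtain ⟨c, hc⟩ := gam_scalar hτ x 1 h
  refine ⟨c, ?_, fun v => by simpa using hc v⟩
  have h1 : (x.1.1 : W →ₗ[ℂ] W) = c • LinearMap.id := by
    ext v
    simpa using hc v
  have h2 := congrArg Units.val x.2.2
  rw [LinearEquiv.coe_det, h1, LinearMap.det_smul, LinearMap.det_id, mul_one] at h2
  simpa using h2

lemma gam_ext {τ : Representation ℂ M W} {x y : Gam τ} (h1 : ∀ v, x.1.1 v = y.1.1 v)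
    (h2 : x.1.2 = y.1.2) : x = y := by
  apply Subtype.ext
  apply Prod.ext
  · ext v; exact h1 v
  · exact h2

lemma gam_finite [Finite G] [FiniteDimensional ℂ W] {τ : Representation ℂ M W} (hτ : IrrSub τ ⊤ ⊤) :
    Finite (Gam τ) := by
  rw [(gamPr τ).finite_iff_finite_ker_range]
  refine ⟨?_, inferInstance⟩
  haveI : NeZero (Module.finrank ℂ W) := ⟨by
    have : Deg M (Module.finrank ℂ W) := ⟨W, _, _, inferInstance, τ, hτ, rfl⟩
    exact this.pos.ne'⟩
  choose c hc1 hc2 using fun x : (gamPr τ).ker => gam_ker hτ x.1 x.2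
  refine Finite.of_injective (β := rootsOfUnity (Module.finrank ℂ W) ℂ)
    (fun x => rootsOfUnity.mkOfPowEq (c x) (hc1 x)) ?_
  intro x y hxy
  have h1 : c x = c y := by
    have := congrArg (fun z : rootsOfUnity (Module.finrank ℂ W) ℂ => ((z : ℂˣ) : ℂ)) hxy
    simpa using this
  apply Subtype.ext
  apply gam_ext
  · intro v; rw [hc2, hc2, h1]
  · have e1 : gamPr τ x.1 = 1 := x.2
    have e2 : gamPr τ y.1 = 1 := y.2
    rw [← gamPr_apply, ← gamPr_apply, e1, e2]

lemma gam_ker_card [Finite G] [FiniteDimensional ℂ W] {τ : Representation ℂ M W} (hτ : IrrSub τ ⊤ ⊤) {p : ℕ} (hp : p.Prime)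
    (hd : ¬ p ∣ Module.finrank ℂ W) : ¬ p ∣ Nat.card (gamPr τ).ker := by
  haveI := Fact.mk hp
  haveI := gam_finite hτ
  intro h
  obtain ⟨x, hx⟩ := exists_prime_orderOf_dvd_card' p h
  obtain ⟨c, hc1, hc2⟩ := gam_ker hτ x.1 x.2
  have hpow : ∀ (j : ℕ) v, (x.1.1.1 ^ j : W ≃ₗ[ℂ] W) v = c ^ j • v := by
    intro j
    induction j with
    | zero => intro v; simp
    | succ j ihj => intro v; rw [pow_succ, LinearEquiv.mul_apply, hc2, map_smul, ihj, smul_smul, pow_succ']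
  have h1 : x.1.1.1 ^ p = 1 := by
    have := pow_orderOf_eq_one x
    rw [hx] at this
    exact congrArg (fun z : (gamPr τ).ker => z.1.1.1) this
  obtain ⟨v0, -, hv0⟩ := Submodule.exists_mem_ne_zero_of_ne_bot hτ.2.1
  have h2 : c ^ p = 1 := by
    have := hpow p v0
    rw [h1, LinearEquiv.coe_one, id] at this
    have h3 : (c ^ p - 1) • v0 = 0 := by rw [sub_smul, one_smul, ← this, sub_self]
    rw [smul_eq_zero, or_iff_left hv0] at h3
    exact sub_eq_zero.1 h3
  have h3 : c = 1 := by
    have e1 : orderOf c ∣ p := orderOf_dvd_of_pow_eq_one h2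
    have e2 : orderOf c ∣ Module.finrank ℂ W := orderOf_dvd_of_pow_eq_one hc1
    rw [← orderOf_eq_one_iff]
    exact Nat.eq_one_of_dvd_coprimes (hp.coprime_iff_not_dvd.2 hd) e1 e2
  have h4 : x = 1 := by
    apply Subtype.ext
    apply gam_ext
    · intro v; rw [hc2, h3, one_smul]; rfl
    · exact x.2
  rw [h4, orderOf_one] at hx
  exact hp.one_lt.ne hx

lemma gam_surj [Finite G] [Fintype M] [FiniteDimensional ℂ W] {τ : Representation ℂ M W} (hτ : IrrSub τ ⊤ ⊤)
    {w : Wt M} (hw : ⊤ ≤ eig (csum τ) w) (hinv : ∀ g : G, g • w = w) :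
    Function.Surjective (gamPr τ) := by
  intro g
  let α : M ≃* M := MulDistribMulAction.toMulEquiv M g
  have hα : ∀ m, α m = g • m := fun m => rfl
  have hirr : IrrSub (τ.comp α.toMonoidHom : Representation ℂ M W) ⊤ ⊤ := by
    have hr : α.toMonoidHom.range = ⊤ := MonoidHom.range_eq_top.2 (by exact α.surjective)
    rw [irrSub_comp, ← MonoidHom.range_eq_map, hr]
    exact hτ
  have hw' : ⊤ ≤ eig (csum (τ.comp α.toMonoidHom : Representation ℂ M W)) w := by
    intro v _ x
    have h1 : csum (τ.comp α.toMonoidHom : Representation ℂ M W) x = csum τ (g • x) := by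
      unfold csum
      refine Fintype.sum_equiv α.toEquiv _ _ (fun y => ?_)
      change τ (α (y * x * y⁻¹)) = _
      have e : α (y * x * y⁻¹) = α y * α x * (α y)⁻¹ := by rw [map_mul, map_mul, map_inv]
      rw [e]
      rfl
    rw [h1, hw (trivial : v ∈ (⊤ : Submodule ℂ W))]
    congr 1
    have := congrFun (hinv g⁻¹) x
    rw [wt_smul_apply, inv_inv] at this
    exact this
  obtain ⟨T, hT⟩ := iso_of_weight τ (τ.comp α.toMonoidHom) hτ hirr hw hw'
  have hdW : 0 < Module.finrank ℂ W := by
    have : Deg M (Module.finrank ℂ W) := ⟨W, _, _, inferInstance, τ, hτ, rfl⟩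
    exact this.pos
  obtain ⟨c, hc⟩ := IsAlgClosed.exists_pow_nat_eq ((LinearEquiv.det T : ℂˣ) : ℂ)⁻¹ hdW
  have hc0 : c ≠ 0 := by
    rintro rfl
    rw [zero_pow hdW.ne'] at hc
    exact inv_ne_zero (Units.ne_zero _) hc.symm
  refine ⟨⟨(LinearEquiv.smulOfNeZero ℂ W c hc0 * T, g), ?_, ?_⟩, rfl⟩
  · intro m v
    simp only [LinearEquiv.mul_apply, hT, LinearEquiv.smulOfNeZero_apply, map_smul]
    rfl
  · rw [map_mul]
    ext
    rw [Units.val_mul, LinearEquiv.coe_det (LinearEquiv.smulOfNeZero ℂ W c hc0)]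
    have : ((LinearEquiv.smulOfNeZero ℂ W c hc0 : W ≃ₗ[ℂ] W) : W →ₗ[ℂ] W) = c • LinearMap.id := by
      ext v; simp
    rw [this, LinearMap.det_smul, LinearMap.det_id, mul_one, hc, inv_mul_cancel₀ (Units.ne_zero _)]
    rfl

end Gamma

section Homog
variable {G : Type} [Group G] {M : Subgroup G} [hMn : M.Normal] {V : Type} [AddCommGroup V] [Module ℂ V]
  {W : Type} [AddCommGroup W] [Module ℂ W] [Finite G] [FiniteDimensional ℂ V] [FiniteDimensional ℂ W]

lemma homU_big {ρ : Representation ℂ G V} {τ : Representation ℂ M W} (hρ : IrrSub ρ ⊤ ⊤)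
    (hs : Function.Surjective (gamPr τ)) (Y : Submodule ℂ (W →ₗ[ℂ] V))
    (hY : SInv (homRep ρ τ) ⊤ Y) (h0 : Y ≠ ⊥) :
    Module.finrank ℂ V ≤ Module.finrank ℂ Y * Module.finrank ℂ W := by
  let L : TensorProduct ℂ Y W →ₗ[ℂ] V := TensorProduct.lift Y.subtype
  have hL : ∀ (y : Y) v, L (y ⊗ₜ v) = (y : W →ₗ[ℂ] V) v := fun y v => by simp [L]
  have hinv : SInv ρ ⊤ (LinearMap.range L) := by
    rintro g - _ ⟨t, rfl⟩
    obtain ⟨x, hx⟩ := hs g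
    induction t using TensorProduct.induction_on with
    | zero => simp
    | add a b ha hb => rw [map_add, map_add]; exact Submodule.add_mem _ ha hb
    | tmul y v =>
      refine ⟨(⟨homRep ρ τ x y, hY x trivial y y.2⟩ : Y) ⊗ₜ x.1.1 v, ?_⟩
      rw [hL, hL, homRep_apply, ← hx, gamPr_apply, ← LinearEquiv.mul_apply, inv_mul_cancel]
      rfl
  have hne : LinearMap.range L ≠ ⊥ := by
    intro h
    apply h0
    rw [eq_bot_iff]
    intro y hy
    rw [Submodule.mem_bot]
    ext v
    have : L ((⟨y, hy⟩ : Y) ⊗ₜ v) ∈ LinearMap.range L := ⟨_, rfl⟩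
    rw [h, hL] at this
    simpa using this
  rcases hρ.2.2 _ le_top hinv with h | h
  · exact absurd h hne
  · rw [← Module.finrank_tensorProduct]
    exact LinearMap.finrank_le_finrank_of_surjective (LinearMap.range_eq_top.1 h)
  
lemma homU_irr {ρ : Representation ℂ G V} {τ : Representation ℂ M W} (hρ : IrrSub ρ ⊤ ⊤)
    (hτ : IrrSub τ ⊤ ⊤)
    (hiso : ∀ A, IrrSub ρ M A → ∃ θ : W →ₗ[ℂ] V, Function.Injective θ ∧ LinearMap.range θ = A ∧
      ∀ (m : M) v, θ (τ m v) = ρ m (θ v))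
    (hs : Function.Surjective (gamPr τ)) (h0 : homU ρ τ ⊤ ≠ ⊥) :
    IrrSub (homRep ρ τ) ⊤ (homU ρ τ ⊤) ∧
      Module.finrank ℂ V = Module.finrank ℂ (homU ρ τ ⊤) * Module.finrank ℂ W := by
  have h1 := homU_le hτ hiso
  have hW : 0 < Module.finrank ℂ W := by
    have : Deg M (Module.finrank ℂ W) := ⟨W, _, _, inferInstance, τ, hτ, rfl⟩
    exact this.pos
  refine ⟨⟨homRep_inv ρ τ, h0, fun Y hYU hY => ?_⟩, le_antisymm (homU_big hρ hs _ (homRep_inv ρ τ) h0)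
    (by rw [mul_comm]; exact h1)⟩
  by_cases hb : Y = ⊥
  · exact Or.inl hb
  · right
    have h2 := homU_big hρ hs Y hY hb
    have h3 : Module.finrank ℂ W * Module.finrank ℂ (homU ρ τ ⊤) ≤ Module.finrank ℂ W * Module.finrank ℂ Y := by
      rw [mul_comm _ (Module.finrank ℂ Y)]; exact h1.trans h2
    exact Submodule.eq_of_le_of_finrank_le hYU (Nat.le_of_mul_le_mul_left h3 hW)

variable {p k n : ℕ}

lemma homog (hp : p.Prime) (ih : ∀ m < n, SS p k m) (hM : ¬ p ∣ Nat.card M)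
    (hn : M.index = n) (hG : IsPSolvable p G) (hA : PropA p k G) (hB : PropB p k G)
    {ρ : Representation ℂ G V} {τ : Representation ℂ M W} (hρ : IrrSub ρ ⊤ ⊤)
    (hτ : IrrSub τ ⊤ ⊤)
    (hiso : ∀ A, IrrSub ρ M A → ∃ θ : W →ₗ[ℂ] V, Function.Injective θ ∧ LinearMap.range θ = A ∧
      ∀ (m : M) v, θ (τ m v) = ρ m (θ v))
    (hs : Function.Surjective (gamPr τ)) (h0 : homU ρ τ ⊤ ≠ ⊥)
    (hd : ¬ p ^ (k + 1) ∣ Module.finrank ℂ V) : ¬ p ∣ Module.finrank ℂ V := by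
  haveI := gam_finite hτ
  haveI := Fintype.ofFinite M
  have hWp : ¬ p ∣ Module.finrank ℂ W :=
    Deg.of_pPrime hp hM ⟨W, _, _, inferInstance, τ, hτ, rfl⟩
  obtain ⟨hirr, hdim⟩ := homU_irr hρ hτ hiso hs h0
  have hk := gam_ker_card hτ hp hWp
  have hcen : ∀ x, gamPr τ x = 1 → ∀ y, x * y = y * x := by
    intro x hx y
    obtain ⟨c, -, hc⟩ := gam_ker hτ x hx
    apply gam_ext
    · intro v
      change x.1.1 (y.1.1 v) = y.1.1 (x.1.1 v)
      rw [hc, hc, map_smul]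
    · change gamPr τ (x * y) = gamPr τ (y * x)
      rw [map_mul, map_mul, hx, one_mul, mul_one]
  have hsolv : IsPSolvable p (Gam τ) := hG.comap (gamPr τ) (fun x hx =>
    ⟨Nat.card (gamPr τ).ker, ((hp.coprime_iff_not_dvd).2 hk).symm,
      congrArg Subtype.val (pow_card_eq_one' (x := (⟨x, hx⟩ : (gamPr τ).ker)))⟩)
  have hM1 : ¬ p ∣ Nat.card (M.comap (gamPr τ)) := by
    rw [card_comap_mul _ hs, hp.dvd_mul]
    tauto
  have key := lemC2 (M := M.comap (gamPr τ)) hp ih hM1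
    (by rw [Subgroup.index_comap_of_surjective _ hs, hn]) hsolv (hA.lift hp _ hs hk)
    (hB.lift hp _ hs hk hcen) (topRep_irr hirr) (by
      intro x hx
      obtain ⟨c, hc⟩ := gam_scalar hτ x ⟨x.1.2, hx⟩ rfl
      have hc0 : c ≠ 0 := by
        rintro rfl
        obtain ⟨v0, -, hv0⟩ := Submodule.exists_mem_ne_zero_of_ne_bot hτ.2.1
        apply hv0
        apply x.1.1.injective
        rw [hc, zero_smul, map_zero]
      refine ⟨c⁻¹, fun φ => ?_⟩
      apply Subtype.ext
      rw [topRep_apply, Submodule.coe_smul]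
      ext v
      rw [homRep_apply, LinearMap.smul_apply]
      obtain ⟨u, rfl⟩ := x.1.1.surjective v
      rw [← LinearEquiv.mul_apply, inv_mul_cancel, hc, map_smul, smul_smul, inv_mul_cancel₀ hc0, one_smul,
        φ.2.1]
      rfl) (by
      intro h
      exact hd (by rw [hdim]; exact h.mul_right _))
  rw [hdim, hp.dvd_mul]
  tauto

end Homog

lemma lemS {p k : ℕ} (hp : p.Prime) : ∀ n, SS p k n := by
  intro n
  induction n using Nat.strong_induction_on with
  | _ n ih =>
  intro G _ _ M hMn hM hn hG hA hB d hd hdk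
  obtain ⟨V, _, _, _, ρ, hρ, rfl⟩ := hd
  haveI := Fintype.ofFinite G
  rcases lemW hp ih hM hn hG hA hB hρ hdk with h | ⟨w, hw⟩
  · exact h
  have hw' : ∀ v x, csum (ρ.comp M.subtype : Representation ℂ M V) x v = w x • v := by
    intro v x
    have : v ∈ eig (fun x : M => csum (ρ.comp M.subtype : Representation ℂ M V) x) w := by
      rw [hw]; trivial
    exact this x
  have hinv : ∀ g : G, g • w = w := by
    intro g
    obtain ⟨v, -, hv⟩ := Submodule.exists_mem_ne_zero_of_ne_bot hρ.2.1
    have hgv : ρ g v ≠ 0 := by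
      intro h
      apply hv
      rw [← rho_inv_apply ρ g v, h, map_zero]
    have h1 := eig_smul (equivar_csum M ρ ⊤) (h := g) trivial (w := w) (v := v) (by rw [hw]; trivial)
    funext x
    have h2 := h1 x
    simp only [hw'] at h2
    exact (smul_left_injective ℂ hgv h2).symm
  have hwt : ∀ A (hA' : SInv ρ M A), ⊤ ≤ eig (csum (subRep ρ M A hA')) w := by
    intro A hA' v _ x
    apply Subtype.ext
    rw [Submodule.coe_smul, ← hw']
    simp only [csum, LinearMap.sum_apply, Submodule.coe_sum]
    rfl
  obtain ⟨W0, _, hW0⟩ := exists_irrSub (SInv.top ρ M) hρ.2.1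
  have hτ := irrSub_subRep_top hW0
  refine homog hp ih hM hn hG hA hB hρ hτ ?_ (gam_surj hτ (hwt _ hW0.1) hinv) ?_ hdk
  · intro A hA'
    obtain ⟨T, hT⟩ := iso_of_weight (subRep ρ M W0 hW0.1) (subRep ρ M A hA'.1) hτ
      (irrSub_subRep_top hA') (hwt _ _) (hwt _ _)
    refine ⟨A.subtype ∘ₗ T.toLinearMap, ?_, ?_, ?_⟩
    · exact Subtype.val_injective.comp T.injective
    · rw [LinearMap.range_comp, LinearEquiv.range, Submodule.map_top, Submodule.range_subtype]
    · intro m v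
      change ((T (subRep ρ M W0 hW0.1 m v) : A) : V) = _
      rw [hT]
      rfl
  · intro h
    have h1 : W0.subtype ∈ homU ρ (subRep ρ M W0 hW0.1) ⊤ := ⟨fun m v => rfl, fun _ => trivial⟩
    rw [h, Submodule.mem_bot] at h1
    apply hW0.2.1
    rw [← Submodule.range_subtype W0, h1, LinearMap.range_zero]

section Bridge
open CategoryTheory
variable {G : Type} [Group G]

/-- morphisms from equivariant linear maps -/
def mkHom {V W : FDRep ℂ G} (f : V →ₗ[ℂ] W) (hf : ∀ g v, f (V.ρ g v) = W.ρ g (f v)) : V ⟶ W :=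
  ⟨InducedCategory.homMk (ModuleCat.ofHom f), fun g => by
    ext1
    ext v
    exact hf g v⟩

/-- underlying linear map -/
def unHom {V W : FDRep ℂ G} (f : V ⟶ W) : V →ₗ[ℂ] W := f.hom.hom.hom

lemma unHom_mk {V W : FDRep ℂ G} (f : V →ₗ[ℂ] W) (hf : ∀ g v, f (V.ρ g v) = W.ρ g (f v)) :
    unHom (mkHom f hf) = f := rfl

lemma unHom_inj {V W : FDRep ℂ G} {f g : V ⟶ W} (h : unHom f = unHom g) : f = g := by
  ext v
  exact LinearMap.congr_fun h v

lemma unHom_comp {V W X : FDRep ℂ G} (f : V ⟶ W) (g : W ⟶ X) : unHom (f ≫ g) = unHom g ∘ₗ unHom f := rfl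

lemma unHom_id (V : FDRep ℂ G) : unHom (𝟙 V) = LinearMap.id := rfl

lemma unHom_equi {V W : FDRep ℂ G} (f : V ⟶ W) (g : G) (v : V) : unHom f (V.ρ g v) = W.ρ g (unHom f v) := by
  have := f.comm g
  exact ConcreteCategory.congr_hom this v

lemma irr_of_simple (V : FDRep ℂ G) (h : Simple V) : IrrSub V.ρ ⊤ ⊤ := by
  refine ⟨SInv.top _ _, ?_, ?_⟩
  · intro hb
    apply id_nonzero V
    apply unHom_inj
    refine LinearMap.ext fun v => ?_
    have : v ∈ (⊤ : Submodule ℂ V) := trivial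
    rw [hb, Submodule.mem_bot] at this
    rw [this, map_zero, map_zero]
  · intro U _ hU
    by_cases h0 : U = ⊥
    · exact Or.inl h0
    right
    let f : FDRep.of (topRep V.ρ U hU) ⟶ V := mkHom U.subtype (fun g v => rfl)
    have hf : unHom f = U.subtype := rfl
    haveI : Mono f := ⟨fun {Z} a b hab => by
      apply unHom_inj
      refine LinearMap.ext fun z => ?_
      have := congrArg (fun q => unHom q z) hab
      exact Subtype.ext this⟩
    have hne : f ≠ 0 := by
      intro hz
      apply h0
      rw [← Submodule.range_subtype U, ← hf, hz]
      exact LinearMap.range_zero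
    haveI := isIso_of_mono_of_nonzero hne
    rw [eq_top_iff]
    intro v _
    have h1 : unHom (inv f ≫ f) v = v := by rw [IsIso.inv_hom_id]; rfl
    rw [← h1]
    exact (unHom (inv f) v : U).2

lemma simple_of_irr [Finite G] {V : Type} [AddCommGroup V] [Module ℂ V] [FiniteDimensional ℂ V]
    (ρ : Representation ℂ G V) (h : IrrSub ρ ⊤ ⊤) : Simple (FDRep.of ρ) := by
  haveI : NeZero (Nat.card G : ℂ) := ⟨by exact_mod_cast Nat.card_pos.ne'⟩
  rw [FDRep.simple_iff_end_is_rank_one]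
  have hne : 𝟙 (FDRep.of ρ) ≠ 0 := by
    intro h0
    obtain ⟨v, -, hv⟩ := Submodule.exists_mem_ne_zero_of_ne_bot h.2.1
    exact hv (congrArg (fun q : FDRep.of ρ ⟶ FDRep.of ρ => unHom q v) h0)
  rw [finrank_eq_one_iff_of_nonzero' _ hne]
  intro f
  obtain ⟨c, hc⟩ := schur h (unHom f) (fun _ _ => trivial) (fun g _ v _ => unHom_equi f g v)
  refine ⟨c, unHom_inj ?_⟩
  refine LinearMap.ext fun v => ?_
  rw [hc v trivial]
  rfl

lemma irrChar_iff [Finite G] (q : ℕ → Prop) :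
    (∃ χ : G → ℂ, IsIrrChar χ ∧ q (charDeg χ)) ↔ ∃ d, Deg G d ∧ q d := by
  have hdeg : ∀ V : FDRep ℂ G, charDeg V.character = Module.finrank ℂ V := by
    intro V
    unfold charDeg
    rw [FDRep.char_one]
    simp
  constructor
  · rintro ⟨_, ⟨V, hV, rfl⟩, hq⟩
    rw [hdeg] at hq
    exact ⟨_, ⟨V, _, _, inferInstance, V.ρ, irr_of_simple V hV, rfl⟩, hq⟩
  · rintro ⟨_, ⟨V, _, _, _, ρ, hρ, rfl⟩, hq⟩
    refine ⟨_, ⟨FDRep.of ρ, simple_of_irr ρ hρ, rfl⟩, ?_⟩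
    rw [hdeg]
    exact hq
end Bridge

section Final
variable {G : Type} [Group G] [Finite G] {p : ℕ}

lemma sInf_eq_of {A B : Set ℕ} (h1 : ∀ a ∈ A, ∃ b ∈ B, b ≤ a) (h2 : ∀ b ∈ B, ∃ a ∈ A, a ≤ b) :
    sInf A = sInf B := by
  rcases A.eq_empty_or_nonempty with hA | hA
  · rcases B.eq_empty_or_nonempty with hB | ⟨b, hb⟩
    · rw [hA, hB]
    · obtain ⟨a, ha, _⟩ := h2 b hb
      rw [hA] at ha
      exact absurd ha (Set.notMem_empty a)
  · obtain ⟨b, hb, hba⟩ := h1 _ (Nat.sInf_mem hA)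
    obtain ⟨a, ha, hab⟩ := h2 _ (Nat.sInf_mem ⟨b, hb⟩)
    exact le_antisymm ((Nat.sInf_le ha).trans hab) ((Nat.sInf_le hb).trans hba)

lemma syl_deg (hp : p.Prime) (P Q : Sylow p G) {d : ℕ} (h : Deg P d) : Deg Q d := by
  haveI := Fact.mk hp
  exact (Deg.equiv (P.equiv Q)).2 (by simpa using h) |> fun h => h

lemma main_core (hp : p.Prime) (hG : IsPSolvable p G)
    (hO : ∀ N : Subgroup G, N.Normal → ¬ p ∣ Nat.card N → N = ⊥) (P : Sylow p G) :
    sInf {h : ℕ | h ≠ 0 ∧ ∃ d, Deg G d ∧ d.factorization p = h} =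
      sInf {h : ℕ | h ≠ 0 ∧ ∃ d, Deg P d ∧ d.factorization p = h} := by
  haveI := Fact.mk hp
  apply sInf_eq_of
  · rintro h ⟨h0, d, hd, rfl⟩
    by_contra hcon
    push Not at hcon
    have hA : PropA p (d.factorization p) G := by
      intro Q e he hle
      haveI := Fintype.ofFinite Q
      obtain ⟨j, rfl⟩ := he.of_pGroup hp Q.2
      have hj : j ≤ d.factorization p := (Nat.pow_le_pow_iff_right hp.one_lt).1 hle
      by_contra hne
      have hj0 : j ≠ 0 := by
        rintro rfl
        exact hne (pow_zero p)
      have := hcon j ⟨hj0, _, syl_deg hp Q P he, by simp [hp.factorization_pow]⟩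
      omega
    have hB := lemClose hp hG hO hA
    have hbot : ¬ p ∣ Nat.card (⊥ : Subgroup G) := by
      rw [Subgroup.card_bot]
      exact hp.one_lt.ne' ∘ Nat.dvd_one.1
    have := lemS hp _ G ⊥ inferInstance hbot rfl hG hA hB d hd (by
      rw [hp.pow_dvd_iff_le_factorization hd.pos.ne']
      omega)
    apply this
    exact Nat.dvd_of_factorization_pos h0
  · rintro h ⟨h0, d, hd, rfl⟩
    haveI := Fintype.ofFinite P
    obtain ⟨m, rfl⟩ := hd.of_pGroup hp P.2
    have hm : (p ^ m).factorization p = m := by simp [hp.factorization_pow]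
    rw [hm] at h0 ⊢
    obtain ⟨d, h1, h2, h3⟩ := lemU hp m h0 _ G rfl hG P hd
    refine ⟨_, ⟨?_, d, h1, rfl⟩, ?_⟩
    · exact (hp.factorization_pos_of_dvd h1.pos.ne' h2).ne'
    · rw [hp.pow_dvd_iff_le_factorization h1.pos.ne'] at h3
      omega

lemma main_thm (hp : p.Prime) (hG : IsPSolvable p G) (O : Subgroup G) [O.Normal]
    (hO1 : ¬ p ∣ Nat.card O) (hO2 : ∀ N : Subgroup G, N.Normal → ¬ p ∣ Nat.card N → N ≤ O)
    (P : Sylow p G) :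
    sInf {h : ℕ | h ≠ 0 ∧ ∃ d, Deg (G ⧸ O) d ∧ d.factorization p = h} =
      sInf {h : ℕ | h ≠ 0 ∧ ∃ d, Deg P d ∧ d.factorization p = h} := by
  have hs := QuotientGroup.mk'_surjective O
  have hk : (QuotientGroup.mk' O).ker = O := QuotientGroup.ker_mk' O
  obtain ⟨P', hP'⟩ := map_syl hp (QuotientGroup.mk' O) hs P
  have hinj : Function.Injective ((QuotientGroup.mk' O).subgroupMap P) := by
    rw [injective_iff_map_eq_one]
    intro x hx
    have h1 : QuotientGroup.mk' O x.1 = 1 := congrArg Subtype.val hx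
    have h2 : x.1 ∈ O := by rw [← hk]; exact h1
    exact Subtype.ext (inf_bot_of_pPrime hp P.2 hO1 x.2 h2)
  have e : P ≃* P' := by
    refine (MulEquiv.ofBijective ((QuotientGroup.mk' O).subgroupMap P)
      ⟨hinj, MonoidHom.subgroupMap_surjective _ _⟩).trans (MulEquiv.subgroupCongr hP'.symm)
  rw [main_core hp (hG.quot O) ?_ P']
  · simp only [Deg.equiv e]
  · intro N hN hNp
    have h1 := hO2 (N.comap (QuotientGroup.mk' O)) inferInstance (by
      rw [card_comap_mul _ hs, hk, hp.dvd_mul]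
      tauto)
    rw [eq_bot_iff]
    intro x hx
    obtain ⟨g, rfl⟩ := hs x
    have : g ∈ O := h1 hx
    rw [← hk] at this
    exact this
end Final


/-- Theorem A: for a `p`-solvable group `G` whose principal `p`-block `B` has non-abelian
defect group `P ∈ Syl_p(G)`, `mh(B) = mh(P)`.  Here `Irr B = Irr(G/O_{p'}(G))` (Navarro,
Thm 10.20), `O = O_{p'}(G)` is the largest normal `p'`-subgroup, and heights are the
`p`-adic valuations of character degrees. -/
theorem stmt_7 {G : Type} [Group G] [Fintype G] (p : ℕ) (hp : p.Prime)
    (hsolv : IsPSolvable p G)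
    (O : Subgroup G) [O.Normal] (hO1 : ¬ p ∣ Nat.card O)
    (hO2 : ∀ N : Subgroup G, N.Normal → ¬ p ∣ Nat.card N → N ≤ O)
    (P : Sylow p G) (hnab : ¬ ∀ a b : ↥P.toSubgroup, a * b = b * a) :
    sInf {h : ℕ | h ≠ 0 ∧ ∃ χ : G ⧸ O → ℂ, IsIrrChar χ ∧ (charDeg χ).factorization p = h} =
      sInf {h : ℕ | h ≠ 0 ∧
        ∃ χ : ↥P.toSubgroup → ℂ, IsIrrChar χ ∧ (charDeg χ).factorization p = h} := by
  have h1 : ∀ h, (∃ χ : G ⧸ O → ℂ, IsIrrChar χ ∧ (charDeg χ).factorization p = h) ↔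
      ∃ d, Deg (G ⧸ O) d ∧ d.factorization p = h :=
    fun h => irrChar_iff (fun d => d.factorization p = h)
  have h2 : ∀ h, (∃ χ : ↥P.toSubgroup → ℂ, IsIrrChar χ ∧ (charDeg χ).factorization p = h) ↔
      ∃ d, Deg P.toSubgroup d ∧ d.factorization p = h :=
    fun h => irrChar_iff (fun d => d.factorization p = h)
  simp only [h1, h2]
  exact main_thm hp hsolv O hO1 hO2 P
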